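/- Let Δ be a simplicial complex and let R = 𝕜[Δ] be its Stanley–Reisner ring over a field 𝕜, and assume R is Cohen–Macaulay. Then R is Gorenstein on the punctured spectrum if and only if tr(ω_R) = 𝔐_R^i for some i ∈ {0,1,2}. -/

import Mathlib

/-! # Preliminaries

Self-contained definitions: simplicial complexes, simplicial homology, Stanley–Reisner rings,
canonical modules, canonical traces, and the various Gorenstein-type conditions. -/

open CategoryTheory

/-- An abstract simplicial complex on the vertex set `Fin n` (the empty set is a face). -/
structure SC (n : ℕ) where
  faces : Finset (Finset (Fin n))
  empty_mem : ∅ ∈ faces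
  down_closed : ∀ {σ τ : Finset (Fin n)}, σ ∈ faces → τ ⊆ σ → τ ∈ faces

namespace SC

variable {n : ℕ} (Δ : SC n)

/-- The dimension of a simplicial complex, as an integer (the complex `{∅}` has
dimension `-1`). -/
def dim : ℤ := ((Δ.faces.sup Finset.card : ℕ) : ℤ) - 1

/-- `v` is a vertex of `Δ`. -/
def IsVertex (v : Fin n) : Prop := {v} ∈ Δ.faces

/-- A facet is a face which is maximal by inclusion. -/
def IsFacet (σ : Finset (Fin n)) : Prop :=
  σ ∈ Δ.faces ∧ ∀ τ ∈ Δ.faces, σ ⊆ τ → σ = τ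

/-- A cone point is a vertex contained in every facet. -/
def IsConePoint (v : Fin n) : Prop :=
  Δ.IsVertex v ∧ ∀ σ, Δ.IsFacet σ → v ∈ σ

/-- A simplicial complex is connected if it has a vertex and any two vertices are joined
by a path of edges. -/
def Connected : Prop :=
  (∃ v, Δ.IsVertex v) ∧ ∀ u v, Δ.IsVertex u → Δ.IsVertex v →
    Relation.ReflTransGen (fun a b => ({a, b} : Finset (Fin n)) ∈ Δ.faces) u v

/-- A simplicial complex is strongly connected if any two facets are joined by a chain of
facets in which consecutive facets intersect in a face of dimension `dim Δ - 1`. -/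
def StronglyConnected : Prop :=
  ∀ σ τ, Δ.IsFacet σ → Δ.IsFacet τ →
    Relation.ReflTransGen
      (fun α β => Δ.IsFacet α ∧ Δ.IsFacet β ∧ ((α ∩ β).card : ℤ) - 1 = Δ.dim - 1) σ τ

/-- A pseudomanifold: strongly connected, and every face of dimension `dim Δ - 1` is
contained in exactly two facets. -/
def IsPseudomanifold : Prop :=
  Δ.StronglyConnected ∧
    ∀ τ ∈ Δ.faces, (τ.card : ℤ) - 1 = Δ.dim - 1 →
      {σ : Finset (Fin n) | Δ.IsFacet σ ∧ τ ⊆ σ}.ncard = 2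

/-- The link of a face `σ` of `Δ`. -/
def link (σ : Finset (Fin n)) (hσ : σ ∈ Δ.faces) : SC n where
  faces := Δ.faces.filter fun τ => τ ∩ σ = ∅ ∧ τ ∪ σ ∈ Δ.faces
  empty_mem := by
    simp only [Finset.mem_filter]
    exact ⟨Δ.empty_mem, by simp, by simpa using hσ⟩
  down_closed := by
    intro σ' τ' h hsub
    simp only [Finset.mem_filter] at h ⊢
    refine ⟨Δ.down_closed h.1 hsub, ?_, ?_⟩
    · have := h.2.1
      rw [Finset.eq_empty_iff_forall_notMem] at this ⊢
      intro x hx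
      exact this x (Finset.mem_inter.mpr
        ⟨hsub (Finset.mem_inter.mp hx).1, (Finset.mem_inter.mp hx).2⟩)
    · exact Δ.down_closed h.2.2 (Finset.union_subset_union hsub (le_refl σ))

/-- A complex is normal if the link of every face of dimension `≤ dim Δ - 2` is connected. -/
def Normal : Prop :=
  ∀ σ (hσ : σ ∈ Δ.faces), (σ.card : ℤ) - 1 ≤ Δ.dim - 2 → (Δ.link σ hσ).Connected

/-! ## Simplicial homology -/

/-- Faces of `Δ` of cardinality `c` containing the face `σ`.  These index a basis of the
`c`-th chain group of the pair `(Δ, cost_Δ σ)` (for `σ = ∅` this is the augmented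
(reduced) chain complex of `Δ`, since the empty face is included in chain degree `0`). -/
def RFace (σ : Finset (Fin n)) (c : ℕ) : Type :=
  {τ : Finset (Fin n) // τ ∈ Δ.faces ∧ σ ⊆ τ ∧ τ.card = c}

instance (σ : Finset (Fin n)) (c : ℕ) : Fintype (Δ.RFace σ c) :=
  inferInstanceAs (Fintype {τ : Finset (Fin n) // τ ∈ Δ.faces ∧ σ ⊆ τ ∧ τ.card = c})

instance (σ : Finset (Fin n)) (c : ℕ) : DecidableEq (Δ.RFace σ c) :=
  inferInstanceAs (DecidableEq {τ : Finset (Fin n) // τ ∈ Δ.faces ∧ σ ⊆ τ ∧ τ.card = c})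

variable (R : Type) [CommRing R]

/-- Chains of the pair `(Δ, cost_Δ σ)` with coefficients in `R`. -/
abbrev relChain (σ : Finset (Fin n)) (c : ℕ) : Type := Δ.RFace σ c → R

/-- The matrix of the simplicial boundary map of the pair `(Δ, cost_Δ σ)`: the coefficient of
`ρ` in `∂ τ` is `(-1)^j` if `ρ` is obtained from `τ` by deleting its `(j+1)`-st vertex (the
deleted vertex not belonging to `σ`), and `0` otherwise. -/
def relBMat (σ : Finset (Fin n)) (i : ℕ) :
    Matrix (Δ.RFace σ i) (Δ.RFace σ (i + 1)) R :=
  fun ρ τ => ∑ v ∈ τ.1, if v ∉ σ ∧ τ.1.erase v = ρ.1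
    then (-1 : R) ^ ((τ.1.filter (fun w => w < v)).card) else 0

/-- The boundary map of the chain complex of the pair `(Δ, cost_Δ σ)`. -/
noncomputable def relBoundary (σ : Finset (Fin n)) (i : ℕ) :
    Δ.relChain R σ (i + 1) →ₗ[R] Δ.relChain R σ i :=
  (Δ.relBMat R σ i).mulVecLin

/-- The relative simplicial homology `H_d(Δ, cost_Δ σ; R)` (`d ≥ 0`). -/
noncomputable def relHomology (σ : Finset (Fin n)) (d : ℕ) : Type :=
  LinearMap.ker (Δ.relBoundary R σ d) ⧸
    Submodule.comap (LinearMap.ker (Δ.relBoundary R σ d)).subtype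
      (LinearMap.range (Δ.relBoundary R σ (d + 1)))

noncomputable instance (σ : Finset (Fin n)) (d : ℕ) : AddCommGroup (Δ.relHomology R σ d) :=
  inferInstanceAs (AddCommGroup (LinearMap.ker (Δ.relBoundary R σ d) ⧸
    Submodule.comap (LinearMap.ker (Δ.relBoundary R σ d)).subtype
      (LinearMap.range (Δ.relBoundary R σ (d + 1)))))

noncomputable instance (σ : Finset (Fin n)) (d : ℕ) : Module R (Δ.relHomology R σ d) :=
  inferInstanceAs (Module R (LinearMap.ker (Δ.relBoundary R σ d) ⧸
    Submodule.comap (LinearMap.ker (Δ.relBoundary R σ d)).subtype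
      (LinearMap.range (Δ.relBoundary R σ (d + 1)))))

/-- Reduced simplicial homology `H̃_d(Δ; R)` for `d ≥ 0`: the homology of the augmented chain
complex, i.e. of the pair `(Δ, cost_Δ ∅)`. -/
noncomputable abbrev reducedHomology (d : ℕ) : Type := Δ.relHomology R ∅ d

/-- Reduced simplicial homology in degree `-1`. -/
noncomputable def reducedHomologyNeg : Type :=
  (⊤ : Submodule R (Δ.relChain R ∅ 0)) ⧸
    Submodule.comap (⊤ : Submodule R (Δ.relChain R ∅ 0)).subtype
      (LinearMap.range (Δ.relBoundary R ∅ 0))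

noncomputable instance : AddCommGroup (Δ.reducedHomologyNeg R) :=
  inferInstanceAs (AddCommGroup ((⊤ : Submodule R (Δ.relChain R ∅ 0)) ⧸
    Submodule.comap (⊤ : Submodule R (Δ.relChain R ∅ 0)).subtype
      (LinearMap.range (Δ.relBoundary R ∅ 0))))

noncomputable instance : Module R (Δ.reducedHomologyNeg R) :=
  inferInstanceAs (Module R ((⊤ : Submodule R (Δ.relChain R ∅ 0)) ⧸
    Submodule.comap (⊤ : Submodule R (Δ.relChain R ∅ 0)).subtype
      (LinearMap.range (Δ.relBoundary R ∅ 0))))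

/-- Cycles of the non-augmented chain complex of `Δ` in dimension `d` (for `d = 0` every
`0`-chain is a cycle). -/
noncomputable def cyclesUnred (d : ℕ) : Submodule R (Δ.relChain R ∅ (d + 1)) :=
  if d = 0 then ⊤ else LinearMap.ker (Δ.relBoundary R ∅ d)

/-- (Unreduced) simplicial homology `H_d(Δ; R)`. -/
noncomputable def homologyUnred (d : ℕ) : Type :=
  Δ.cyclesUnred R d ⧸
    Submodule.comap (Δ.cyclesUnred R d).subtype (LinearMap.range (Δ.relBoundary R ∅ (d + 1)))

noncomputable instance (d : ℕ) : AddCommGroup (Δ.homologyUnred R d) :=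
  inferInstanceAs (AddCommGroup (Δ.cyclesUnred R d ⧸
    Submodule.comap (Δ.cyclesUnred R d).subtype (LinearMap.range (Δ.relBoundary R ∅ (d + 1)))))

noncomputable instance (d : ℕ) : Module R (Δ.homologyUnred R d) :=
  inferInstanceAs (Module R (Δ.cyclesUnred R d ⧸
    Submodule.comap (Δ.cyclesUnred R d).subtype (LinearMap.range (Δ.relBoundary R ∅ (d + 1)))))

/-- `Δ` is `R`-orientable if `H_d(Δ; R) ≠ 0`, where `d = dim Δ`. -/
def Orientable : Prop :=
  ∃ d : ℕ, Δ.dim = (d : ℤ) ∧ Nontrivial (Δ.homologyUnred R d)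

/-- A `k`-homology sphere condition for a single complex `Γ`:
`H̃_i(Γ; k) = k` for `i = dim Γ` and `0` otherwise. -/
def HomologySphereCond (Γ : SC n) : Prop :=
  (∀ i : ℕ, ((i : ℤ) = Γ.dim → Nonempty ((Γ.reducedHomology R i) ≃ₗ[R] R)) ∧
    ((i : ℤ) ≠ Γ.dim → Subsingleton (Γ.reducedHomology R i))) ∧
  ((-1 : ℤ) = Γ.dim → Nonempty ((Γ.reducedHomologyNeg R) ≃ₗ[R] R)) ∧
  ((-1 : ℤ) ≠ Γ.dim → Subsingleton (Γ.reducedHomologyNeg R))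

/-- `Δ` is a `k`-homology manifold: it is connected and the link of every nonempty face has
the reduced homology of a sphere of its dimension. -/
def IsHomologyManifold : Prop :=
  Δ.Connected ∧ ∀ σ (hσ : σ ∈ Δ.faces), σ ≠ ∅ → HomologySphereCond R (Δ.link σ hσ)

/-- `Δ` is isomorphic to the disjoint union of `m` vertices. -/
def IsDisjointVertices (m : ℕ) : Prop :=
  ∃ v : Fin m → Fin n, Function.Injective v ∧
    ∀ σ : Finset (Fin n), σ ∈ Δ.faces ↔ (σ = ∅ ∨ ∃ i, σ = {v i})

/-- `Δ` is isomorphic to a path of length `m` (with `m` edges and `m+1` vertices). -/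
def IsPathComplex (m : ℕ) : Prop :=
  ∃ v : Fin (m + 1) → Fin n, Function.Injective v ∧
    ∀ σ : Finset (Fin n), σ ∈ Δ.faces ↔
      (σ = ∅ ∨ (∃ i, σ = {v i}) ∨ ∃ i : Fin m, σ = {v i.castSucc, v i.succ})

end SC

/-! ## Commutative algebra -/

/-- The `i`-th Ext module `Ext^i_R(M, N)` of two `R`-modules, as an object of `ModuleCat R`. -/
noncomputable def extMod (R : Type) [CommRing R] (M N : Type) [AddCommGroup M] [Module R M]
    [AddCommGroup N] [Module R N] (i : ℕ) : ModuleCat R :=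
  ((Ext R (ModuleCat R) i).obj (Opposite.op (ModuleCat.of R M))).obj (ModuleCat.of R N)

/-- The trace ideal of an `R`-module `M`: the sum of the images of all `R`-linear maps
`M → R`. -/
noncomputable def traceIdeal (R : Type) [CommRing R] (M : Type) [AddCommGroup M] [Module R M] :
    Ideal R :=
  ⨆ f : M →ₗ[R] R, LinearMap.range f

/-- A Noetherian ring `R` with a distinguished maximal ideal `𝔪` (a local ring, or a graded
ring with its graded maximal ideal) is Cohen--Macaulay when `depth = dim`, i.e. (by the
Ext-characterisation of depth) `Ext^i_R(R/𝔪, R) = 0` for all `i < dim R`. -/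
def IsCohenMacaulayAt (R : Type) [CommRing R] (𝔪 : Ideal R) : Prop :=
  IsNoetherianRing R ∧
    ∀ i : ℕ, (i : WithBot (WithTop ℕ)) < ringKrullDim R → Subsingleton (extMod R (R ⧸ 𝔪) R i)

/-- A Noetherian ring `R` with a distinguished maximal ideal `𝔪` (a local ring, or a graded
ring with its graded maximal ideal) is Gorenstein when `Ext^i_R(R/𝔪, R)` vanishes for
`i ≠ dim R` and is isomorphic to `R/𝔪` for `i = dim R`. -/
def IsGorensteinAt (R : Type) [CommRing R] (𝔪 : Ideal R) : Prop :=
  IsNoetherianRing R ∧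
    ∀ i : ℕ, ((i : WithBot (WithTop ℕ)) = ringKrullDim R →
        Nonempty ((extMod R (R ⧸ 𝔪) R i) ≃ₗ[R] (R ⧸ 𝔪))) ∧
      ((i : WithBot (WithTop ℕ)) ≠ ringKrullDim R → Subsingleton (extMod R (R ⧸ 𝔪) R i))

/-- A Noetherian local ring is Gorenstein. -/
def IsGorensteinLocalRing (A : Type) [CommRing A] [IsLocalRing A] : Prop :=
  IsGorensteinAt A (IsLocalRing.maximalIdeal A)

section Graded

variable (k : Type) [Field k] {n : ℕ}

/-- An ideal of a polynomial ring is homogeneous (graded) if it contains all homogeneous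
components of its elements. -/
def IsHomogIdeal (I : Ideal (MvPolynomial (Fin n) k)) : Prop :=
  ∀ p ∈ I, ∀ d : ℕ, MvPolynomial.homogeneousComponent d p ∈ I

/-- The graded (irrelevant) maximal ideal of `k[x_1,…,x_n]/I`, generated by the images of the
variables. -/
noncomputable def quotMax (I : Ideal (MvPolynomial (Fin n) k)) :
    Ideal (MvPolynomial (Fin n) k ⧸ I) :=
  Ideal.span (Set.range fun i : Fin n => Ideal.Quotient.mk I (MvPolynomial.X i))

/-- The degree `j` component of the standard graded ring `k[x_1,…,x_n]/I`, as a
`k`-subspace. -/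
noncomputable def quotGrade (I : Ideal (MvPolynomial (Fin n) k)) (j : ℕ) :
    Submodule k (MvPolynomial (Fin n) k ⧸ I) :=
  (MvPolynomial.homogeneousSubmodule (Fin n) k j).map (Ideal.Quotient.mkₐ k I).toLinearMap

/-- The `ℤ^n`-graded component of `k[x_1,…,x_n]/I` of multidegree `a`: the `k`-line spanned by
the image of the monomial `x^a`. -/
noncomputable def quotMonomialGrade (I : Ideal (MvPolynomial (Fin n) k)) (a : Fin n → ℕ) :
    Submodule k (MvPolynomial (Fin n) k ⧸ I) :=
  Submodule.span k
    {Ideal.Quotient.mk I (MvPolynomial.monomial (Finsupp.equivFunOnFinite.symm a) (1 : k))}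

/-- The standard graded ring `R = k[x_1,…,x_n]/I` is Gorenstein on the punctured spectrum if
`R_𝔭` is Gorenstein for every graded prime `𝔭` other than the graded maximal ideal. -/
def GorensteinPunctured (I : Ideal (MvPolynomial (Fin n) k)) : Prop :=
  ∀ (𝔭 : Ideal (MvPolynomial (Fin n) k ⧸ I)) [𝔭.IsPrime],
    IsHomogIdeal k (𝔭.comap (Ideal.Quotient.mk I)) → 𝔭 ≠ quotMax k I →
      IsGorensteinLocalRing (Localization.AtPrime 𝔭)

/-- `ω` is a canonical module of the standard graded ring `R = k[x_1,…,x_n]/I`, `d = dim R`,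
when `ω ≅ Ext^{n-d}_S(R, S)` for `S = k[x_1,…,x_n]` (by graded local duality this is, up to
shift, the Matlis dual of the top local cohomology module `H^d_𝔪(R)`). -/
def IsCanonicalModuleQ (I : Ideal (MvPolynomial (Fin n) k)) (ω : Type) [AddCommGroup ω]
    [Module (MvPolynomial (Fin n) k ⧸ I) ω] : Prop :=
  Module.Finite (MvPolynomial (Fin n) k ⧸ I) ω ∧
    ∃ d : ℕ, ringKrullDim (MvPolynomial (Fin n) k ⧸ I) = (d : WithBot (WithTop ℕ)) ∧
      letI : Module (MvPolynomial (Fin n) k) ω := Module.compHom ω (Ideal.Quotient.mk I)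
      Nonempty (ω ≃ₗ[MvPolynomial (Fin n) k]
        (extMod (MvPolynomial (Fin n) k) (MvPolynomial (Fin n) k ⧸ I)
          (MvPolynomial (Fin n) k) (n - d)))

/-- A `ℤ`-grading on a module `ω` over `R = k[x_1,…,x_n]/I` compatible with the standard
grading of `R`. -/
def IsCompatibleGrading (I : Ideal (MvPolynomial (Fin n) k)) (ω : Type) [AddCommGroup ω]
    [Module (MvPolynomial (Fin n) k ⧸ I) ω] [Module k ω] (gr : ℤ → Submodule k ω) : Prop :=
  DirectSum.IsInternal gr ∧
    ∀ (i : ℕ) (j : ℤ) (r : MvPolynomial (Fin n) k ⧸ I) (m : ω),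
      r ∈ quotGrade k I i → m ∈ gr j → r • m ∈ gr ((i : ℤ) + j)

/-- The minimal number of generators of a module `M` over `R = k[…]/I` with graded maximal
ideal `𝔪`: the `k`-dimension of `M/𝔪M`. -/
noncomputable def muGen (R : Type) [CommRing R] [Algebra k R] (𝔪 : Ideal R) (M : Type)
    [AddCommGroup M] [Module R M] : ℕ :=
  letI : Module k (M ⧸ (𝔪 • (⊤ : Submodule R M))) :=
    Module.compHom (M ⧸ (𝔪 • (⊤ : Submodule R M))) (algebraMap k R)
  Module.finrank k (M ⧸ (𝔪 • (⊤ : Submodule R M)))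

/-- The Hilbert--Samuel function `j ↦ dim_k M/𝔪^j M` of a module. -/
noncomputable def hilbSam (R : Type) [CommRing R] [Algebra k R] (𝔪 : Ideal R) (M : Type)
    [AddCommGroup M] [Module R M] (j : ℕ) : ℕ :=
  letI : Module k (M ⧸ ((𝔪 ^ j) • (⊤ : Submodule R M))) :=
    Module.compHom (M ⧸ ((𝔪 ^ j) • (⊤ : Submodule R M))) (algebraMap k R)
  Module.finrank k (M ⧸ ((𝔪 ^ j) • (⊤ : Submodule R M)))

/-- `M` is an Ulrich module with respect to `𝔪`: its minimal number of generators `μ(M)`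
equals its multiplicity `e(𝔪; M) = lim_j t!·dim_k(M/𝔪^j M)/j^t`, where `t = dim M`. -/
def IsUlrich (R : Type) [CommRing R] [Algebra k R] (𝔪 : Ideal R) (M : Type) [AddCommGroup M]
    [Module R M] : Prop :=
  ∃ t : ℕ, ringKrullDim (R ⧸ Module.annihilator R M) = (t : WithBot (WithTop ℕ)) ∧
    Filter.Tendsto
      (fun j : ℕ => ((t.factorial : ℝ) * (hilbSam k R 𝔪 M j : ℝ)) / (j : ℝ) ^ t)
      Filter.atTop (nhds ((muGen k R 𝔪 M : ℝ)))

end Graded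

section SR

variable (k : Type) [Field k] {n : ℕ}

/-- The Stanley--Reisner ideal of `Δ`: generated by the squarefree monomials supported on
non-faces of `Δ`. -/
noncomputable def srIdeal (Δ : SC n) : Ideal (MvPolynomial (Fin n) k) :=
  Ideal.span {m | ∃ σ : Finset (Fin n), σ ∉ Δ.faces ∧ m = ∏ i ∈ σ, MvPolynomial.X i}

/-- The Stanley--Reisner ring `k[Δ]`. -/
abbrev SRRing (Δ : SC n) : Type := MvPolynomial (Fin n) k ⧸ srIdeal k Δ

/-- The graded maximal ideal of `k[Δ]`. -/
noncomputable abbrev srMax (Δ : SC n) : Ideal (SRRing k Δ) := quotMax k (srIdeal k Δ)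

/-- The value at `j` of the Hilbert function of the (canonically graded) canonical module of
`k[Δ]`, as computed by Gräbe's theorem:
`dim_k [ω]_j = Σ_{a ∈ ℕ^n, |a| = j} dim_k H_{dim Δ}(Δ, cost_Δ(supp a); k)`. -/
noncomputable def canonicalHilbert (Δ : SC n) (j : ℕ) : ℕ :=
  ∑ a ∈ (Fintype.piFinset fun _ : Fin n => Finset.range (j + 1)).filter
      (fun a => ∑ i, a i = j),
    Module.finrank k
      (Δ.relHomology k (Finset.univ.filter fun i => a i ≠ 0) (Δ.faces.sup Finset.card - 1))

/-- A `ℤ`-grading `gr` on a module `ω` over `k[Δ]` is the canonical grading of the canonical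
module if it is a compatible grading, is supported in nonnegative degrees, and its Hilbert
function is the one given by Gräbe's theorem. -/
def IsCanonicallyGraded (Δ : SC n) (ω : Type) [AddCommGroup ω] [Module (SRRing k Δ) ω]
    [Module k ω] (gr : ℤ → Submodule k ω) : Prop :=
  IsCompatibleGrading k (srIdeal k Δ) ω gr ∧ (∀ j : ℤ, j < 0 → gr j = ⊥) ∧
    ∀ j : ℕ, Module.finrank k (gr (j : ℤ)) = canonicalHilbert k Δ j

/-- A `ℤ^n`-grading `grN` on a module `ω` over `k[Δ]` (supported in `ℕ^n`) is the canonical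
multigrading of the canonical module if it is an internal direct sum, is compatible with the
`ℤ^n`-grading of `k[Δ]`, and its multigraded Hilbert function is the one given by Gräbe's
theorem: `dim_k [ω]_a = dim_k H_{dim Δ}(Δ, cost_Δ(supp a); k)`. -/
def IsCanonicallyMultiGraded (Δ : SC n) (ω : Type) [AddCommGroup ω] [Module (SRRing k Δ) ω]
    [Module k ω] (grN : (Fin n → ℕ) → Submodule k ω) : Prop :=
  DirectSum.IsInternal grN ∧
    (∀ (a b : Fin n → ℕ) (r : SRRing k Δ) (m : ω),
      r ∈ quotMonomialGrade k (srIdeal k Δ) a → m ∈ grN b → r • m ∈ grN (a + b)) ∧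
    ∀ a : Fin n → ℕ, Module.finrank k (grN a) =
      Module.finrank k
        (Δ.relHomology k (Finset.univ.filter fun i => a i ≠ 0) (Δ.faces.sup Finset.card - 1))

end SR

/-- The chain map `C_•(Δ, cost_Δ τ) → C_•(Δ, cost_Δ σ)` (for `τ ⊆ σ`) induced by the
inclusion `cost_Δ τ ⊆ cost_Δ σ`: basis faces not containing `σ` are sent to `0`. -/
def SC.relChainMap {n : ℕ} (Δ : SC n) (R : Type) [CommRing R] (τ σ : Finset (Fin n)) (c : ℕ) :
    Δ.relChain R τ c →ₗ[R] Δ.relChain R σ c :=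
  Matrix.mulVecLin (fun (β : Δ.RFace σ c) (α : Δ.RFace τ c) => if α.1 = β.1 then (1 : R) else 0)

set_option synthInstance.maxHeartbeats 1000000 in
/-- `R = k[x_1,…,x_n]/I` is almost Gorenstein with respect to a canonical module `ω` with
(canonical) grading `gr`: writing `a = a_R` for the `a`-invariant (so `-a` is the least degree
of `ω`), there is an injective degree-zero `R`-linear map `φ : R → ω(-a)` whose cokernel is
zero or an Ulrich module. -/
def IsAlmostGorenstein (k : Type) [Field k] {n : ℕ} (I : Ideal (MvPolynomial (Fin n) k))
    (ω : Type) [AddCommGroup ω] [Module (MvPolynomial (Fin n) k ⧸ I) ω] [Module k ω]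
    (gr : ℤ → Submodule k ω) : Prop :=
  ∃ a : ℤ, (gr (-a) ≠ ⊥ ∧ ∀ j : ℤ, j < -a → gr j = ⊥) ∧
    ∃ φ : (MvPolynomial (Fin n) k ⧸ I) →ₗ[MvPolynomial (Fin n) k ⧸ I] ω,
      Function.Injective φ ∧
      (∀ (i : ℕ) (r : MvPolynomial (Fin n) k ⧸ I),
        r ∈ quotGrade k I i → φ r ∈ gr ((i : ℤ) - a)) ∧
      (Subsingleton (ω ⧸ LinearMap.range φ) ∨
        IsUlrich k (MvPolynomial (Fin n) k ⧸ I) (quotMax k I) (ω ⧸ LinearMap.range φ))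

section
section Bridge
open Abelian Limits

variable {R : Type} [CommRing R] {X : ModuleCat.{0} R} (P : ProjectiveResolution X)
  (Y : ModuleCat.{0} R) (i : ℕ)

theorem extMk_smul_aux (f : P.complex.X i ⟶ Y) (hf : P.complex.d (i+1) i ≫ f = 0) (r : R) :
    P.extMk (r • f) (i+1) rfl (by rw [Linear.comp_smul, hf, smul_zero]) =
      r • P.extMk f (i+1) rfl hf := by
  rw [Abelian.Ext.smul_eq_comp_mk₀, P.extMk_comp_mk₀]
  congr 1

theorem extMk_zero_inj_aux (f : P.complex.X 0 ⟶ Y) (hf : P.complex.d 1 0 ≫ f = 0)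
    (h : P.extMk f 1 rfl hf = 0) : f = 0 := by
  simp only [← P.extEquivCohomologyClass.apply_eq_iff_eq,
    ProjectiveResolution.extEquivCohomologyClass_extMk,
    ProjectiveResolution.extEquivCohomologyClass_zero,
    CochainComplex.HomComplex.CohomologyClass.mk_eq_zero_iff] at h
  rw [CochainComplex.HomComplex.Cocycle.toSingleMk_mem_coboundaries_iff _ _ _ _ _ 1 (by simp)] at h
  obtain ⟨g, hg⟩ := h
  have h1 : IsZero (P.cochainComplex.X 1) := by
    apply P.cochainComplex.isZero_of_isStrictlyLE 0 1 (by lia)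
  rw [h1.eq_of_src g 0] at hg
  simp only [comp_zero] at hg
  rw [← cancel_epi (P.cochainComplexXIso (-(0:ℕ)) 0 rfl).hom]
  exact hg.symm.trans (by simp)

/-- cocycles to Ext -/
noncomputable def cocToExt :
    LinearMap.ker ((P.complex.linearYonedaObj R Y).d i (i+1)).hom →ₗ[R] Abelian.Ext.{0} X Y i where
  toFun f := P.extMk (Y := Y) f.1 (i+1) rfl f.2
  map_add' f g := (P.add_extMk (Y := Y) f.1 g.1 (i+1) rfl f.2 g.2).symm
  map_smul' r f := extMk_smul_aux P Y i f.1 f.2 r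

theorem cocToExt_surjective : Function.Surjective (cocToExt P Y i) := by
  intro α
  obtain ⟨f, hf, rfl⟩ := P.extMk_surjective α (i+1) rfl
  exact ⟨⟨f, hf⟩, rfl⟩

theorem cocToExt_zero_injective : Function.Injective (cocToExt P Y 0) := by
  rw [← LinearMap.ker_eq_bot, LinearMap.ker_eq_bot']
  rintro ⟨f, hf⟩ h
  exact Subtype.ext (extMk_zero_inj_aux P Y f hf h)

theorem cocToExt_ker_succ : LinearMap.ker (cocToExt P Y (i+1)) =
    Submodule.comap (Submodule.subtype _)
      (LinearMap.range ((P.complex.linearYonedaObj R Y).d i (i+1)).hom) := by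
  ext ⟨f, hf⟩
  simp only [LinearMap.mem_ker, Submodule.mem_comap, LinearMap.mem_range]
  exact P.extMk_eq_zero_iff (Y := Y) f (i+1+1) rfl hf i rfl

theorem ext_bridge {R : Type} [CommRing R] {X : ModuleCat.{0} R} (P : ProjectiveResolution X)
  (Y : ModuleCat.{0} R) (i : ℕ) : Nonempty
    (((_root_.Ext R (ModuleCat R) i).obj (Opposite.op X)).obj Y ≃ₗ[R] Abelian.Ext.{0} X Y i) := by
  let K := P.complex.linearYonedaObj R Y
  let e1 := (P.isoExt (R := R) i Y).toLinearEquiv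
  obtain _ | i := i
  · let S := K.sc' ((ComplexShape.up ℕ).prev 0) 0 1
    let e2 := (ShortComplex.homologyMapIso (K.isoSc' _ 0 1 rfl (by simp))).toLinearEquiv
    let e3 := (S.moduleCatHomologyIso).toLinearEquiv
    refine ⟨e1 ≪≫ₗ e2 ≪≫ₗ e3 ≪≫ₗ ?_⟩
    have h0 : S.f = 0 := K.shape _ _ (by simp)
    let ψ : LinearMap.ker S.g.hom →ₗ[R] Abelian.Ext.{0} X Y 0 := cocToExt P Y 0
    have hs : Function.Surjective ψ := cocToExt_surjective P Y 0
    have hi : Function.Injective ψ := cocToExt_zero_injective P Y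
    have : LinearMap.range S.moduleCatToCycles = LinearMap.ker ψ := by
      rw [LinearMap.ker_eq_bot.2 hi]
      rw [LinearMap.range_eq_bot]
      ext x
      simp [ShortComplex.moduleCatToCycles, h0]
    exact Submodule.quotEquivOfEq _ _ this ≪≫ₗ
      LinearMap.quotKerEquivOfSurjective _ hs
  · let S := K.sc' i (i+1) (i+1+1)
    let e2 := (ShortComplex.homologyMapIso (K.isoSc' i (i+1) (i+1+1) (by simp) (by simp))).toLinearEquiv
    let e3 := (S.moduleCatHomologyIso).toLinearEquiv
    refine ⟨e1 ≪≫ₗ e2 ≪≫ₗ e3 ≪≫ₗ ?_⟩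
    let ψ : LinearMap.ker S.g.hom →ₗ[R] Abelian.Ext.{0} X Y (i+1) := cocToExt P Y (i+1)
    have hs : Function.Surjective ψ := cocToExt_surjective P Y (i+1)
    have hk := cocToExt_ker_succ P Y i
    have : LinearMap.range S.moduleCatToCycles = LinearMap.ker ψ := by
      refine Eq.trans ?_ hk.symm
      ext ⟨x, hx⟩
      exact ⟨fun ⟨y, hy⟩ => ⟨y, congrArg Subtype.val hy⟩, fun ⟨y, hy⟩ => ⟨y, Subtype.ext hy⟩⟩
    exact Submodule.quotEquivOfEq _ _ this ≪≫ₗ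
      LinearMap.quotKerEquivOfSurjective _ hs
end Bridge

theorem extMod_bridge (R : Type) [CommRing R] (M N : Type) [AddCommGroup M] [Module R M]
    [AddCommGroup N] [Module R N] (i : ℕ) : Nonempty
    (extMod R M N i ≃ₗ[R] Abelian.Ext.{0} (ModuleCat.of R M) (ModuleCat.of R N) i) :=
  ext_bridge (ProjectiveResolution.of _) _ i
end

section
/-- Unbundled Ext. -/
abbrev EX (R : Type) [CommRing R] (M N : Type) [AddCommGroup M] [Module R M]
    [AddCommGroup N] [Module R N] (i : ℕ) : Type :=
  Abelian.Ext.{0} (ModuleCat.of R M) (ModuleCat.of R N) i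

namespace EX
open Abelian
variable {R : Type} [CommRing R] {M M' M'' N N' N'' : Type}
  [AddCommGroup M] [Module R M] [AddCommGroup M'] [Module R M'] [AddCommGroup M''] [Module R M'']
  [AddCommGroup N] [Module R N] [AddCommGroup N'] [Module R N'] [AddCommGroup N''] [Module R N'']

/-- Contravariant functoriality. -/
noncomputable def pre (N : Type) [AddCommGroup N] [Module R N] (f : M →ₗ[R] M') (i : ℕ) :
    EX R M' N i →ₗ[R] EX R M N i :=
  (Ext.mk₀ (ModuleCat.ofHom f)).precompOfLinear R (ModuleCat.of R N) (zero_add i)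

/-- Covariant functoriality. -/
noncomputable def post (M : Type) [AddCommGroup M] [Module R M] (f : N →ₗ[R] N') (i : ℕ) :
    EX R M N i →ₗ[R] EX R M N' i :=
  (Ext.mk₀ (ModuleCat.ofHom f)).postcompOfLinear R (ModuleCat.of R M) (add_zero i)

theorem pre_apply (f : M →ₗ[R] M') (i : ℕ) (e : EX R M' N i) :
    pre N f i e = (Ext.mk₀ (ModuleCat.ofHom f)).comp e (zero_add i) := rfl

theorem post_apply (f : N →ₗ[R] N') (i : ℕ) (e : EX R M N i) :
    post M f i e = e.comp (Ext.mk₀ (ModuleCat.ofHom f)) (add_zero i) := rfl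

theorem pre_comp (f : M →ₗ[R] M') (g : M' →ₗ[R] M'') (i : ℕ) (e : EX R M'' N i) :
    pre N (g ∘ₗ f) i e = pre N f i (pre N g i e) := by
  rw [pre_apply, pre_apply, pre_apply, Ext.mk₀_comp_mk₀_assoc]
  rfl

theorem post_comp (f : N →ₗ[R] N') (g : N' →ₗ[R] N'') (i : ℕ) (e : EX R M N i) :
    post M (g ∘ₗ f) i e = post M g i (post M f i e) := by
  rw [post_apply, post_apply, post_apply, Ext.comp_assoc_of_third_deg_zero, Ext.mk₀_comp_mk₀]
  rfl

theorem pre_id (i : ℕ) (e : EX R M N i) : pre N (LinearMap.id : M →ₗ[R] M) i e = e := by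
  rw [pre_apply]; exact Ext.mk₀_id_comp e

theorem post_id (i : ℕ) (e : EX R M N i) : post M (LinearMap.id : N →ₗ[R] N) i e = e := by
  rw [post_apply]; exact Ext.comp_mk₀_id e

theorem pre_smul (r : R) (f : M →ₗ[R] M') (i : ℕ) (e : EX R M' N i) :
    pre N (r • f) i e = r • pre N f i e := by
  rw [pre_apply, pre_apply, ← Ext.smul_comp, ← Ext.mk₀_smul]; rfl

theorem post_smul (r : R) (f : N →ₗ[R] N') (i : ℕ) (e : EX R M N i) :
    post M (r • f) i e = r • post M f i e := by
  rw [post_apply, post_apply, ← Ext.comp_smul, ← Ext.mk₀_smul]; rfl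

theorem pre_add (f g : M →ₗ[R] M') (i : ℕ) (e : EX R M' N i) :
    pre N (f + g) i e = pre N f i e + pre N g i e := by
  rw [pre_apply, pre_apply, pre_apply, ← Ext.add_comp, ← Ext.mk₀_add]; rfl

theorem pre_zero (i : ℕ) (e : EX R M' N i) :
    pre N (0 : M →ₗ[R] M') i e = 0 := by
  have := pre_smul (0:R) (0 : M →ₗ[R] M') i e
  simpa using this

theorem post_zero (i : ℕ) (e : EX R M N i) :
    post M (0 : N →ₗ[R] N') i e = 0 := by
  have := post_smul (0:R) (0 : N →ₗ[R] N') i e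
  simpa using this

/-- Congruence in the first variable. -/
noncomputable def congrLeft (N : Type) [AddCommGroup N] [Module R N] (f : M ≃ₗ[R] M') (i : ℕ) :
    EX R M' N i ≃ₗ[R] EX R M N i :=
  LinearEquiv.ofLinearMap (pre N f.toLinearMap i) (pre N f.symm.toLinearMap i)
    (by ext e; rw [LinearMap.comp_apply, ← pre_comp]; simp [pre_id])
    (by ext e; rw [LinearMap.comp_apply, ← pre_comp]; simp [pre_id])

/-- Congruence in the second variable. -/
noncomputable def congrRight (M : Type) [AddCommGroup M] [Module R M] (f : N ≃ₗ[R] N') (i : ℕ) :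
    EX R M N i ≃ₗ[R] EX R M N' i :=
  LinearEquiv.ofLinearMap (post M f.toLinearMap i) (post M f.symm.toLinearMap i)
    (by ext e; rw [LinearMap.comp_apply, ← post_comp]; simp [post_id])
    (by ext e; rw [LinearMap.comp_apply, ← post_comp]; simp [post_id])

/-- Ext^0 = Hom. -/
noncomputable def zeroEquiv (R M N : Type) [CommRing R] [AddCommGroup M] [Module R M]
    [AddCommGroup N] [Module R N] : EX R M N 0 ≃ₗ[R] (M →ₗ[R] N) :=
  (Ext.linearEquiv₀ (R := R)).trans ModuleCat.homLinearEquiv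

theorem zeroEquiv_symm_apply (f : M →ₗ[R] N) :
    (zeroEquiv R M N).symm f = Ext.mk₀ (ModuleCat.ofHom f) := rfl

theorem pre_zeroEquiv_symm (f : M →ₗ[R] M') (g : M' →ₗ[R] N) :
    pre N f 0 ((zeroEquiv R M' N).symm g) = (zeroEquiv R M N).symm (g ∘ₗ f) := by
  rw [zeroEquiv_symm_apply, zeroEquiv_symm_apply, pre_apply, Ext.mk₀_comp_mk₀]; rfl

theorem zeroEquiv_pre (f : M →ₗ[R] M') (e : EX R M' N 0) :
    zeroEquiv R M N (pre N f 0 e) = (zeroEquiv R M' N e) ∘ₗ f := by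
  apply (zeroEquiv R M N).symm.injective
  rw [← pre_zeroEquiv_symm]; simp

theorem post_zeroEquiv_symm (f : N →ₗ[R] N') (g : M →ₗ[R] N) :
    post M f 0 ((zeroEquiv R M N).symm g) = (zeroEquiv R M N').symm (f ∘ₗ g) := by
  rw [zeroEquiv_symm_apply, zeroEquiv_symm_apply, post_apply, Ext.mk₀_comp_mk₀]; rfl

theorem zeroEquiv_post (f : N →ₗ[R] N') (e : EX R M N 0) :
    zeroEquiv R M N' (post M f 0 e) = f ∘ₗ (zeroEquiv R M N e) := by
  apply (zeroEquiv R M N').symm.injective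
  rw [← post_zeroEquiv_symm]; simp

theorem shortExact (f : M →ₗ[R] M') (g : M' →ₗ[R] M'') (hf : Function.Injective f)
    (hg : Function.Surjective g) (h : Function.Exact f g) :
    (ShortComplex.mk (ModuleCat.ofHom f) (ModuleCat.ofHom g)
      (by ext x; exact h.apply_apply_eq_zero x)).ShortExact :=
  ModuleCat.shortComplex_shortExact _ h hf hg

theorem les (N : Type) [AddCommGroup N] [Module R N]
    (f : M →ₗ[R] M') (g : M' →ₗ[R] M'') (hf : Function.Injective f)
    (hg : Function.Surjective g) (h : Function.Exact f g) :
    ∃ δ : ∀ i, EX R M N i →ₗ[R] EX R M'' N (i+1),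
      (∀ i, Function.Exact (pre N g i) (pre N f i)) ∧
      (∀ i, Function.Exact (pre N f i) (δ i)) ∧ (∀ i, Function.Exact (δ i) (pre N g (i+1))) := by
  have hS := shortExact f g hf hg h
  refine ⟨fun i => hS.extClass.precompOfLinear R _ (add_comm 1 i), fun i e => ⟨fun he => ?_, ?_⟩,
    fun i e => ⟨fun he => ?_, ?_⟩, fun i e => ⟨fun he => ?_, ?_⟩⟩
  · exact Ext.contravariant_sequence_exact₂ hS _ e he
  · rintro ⟨e, rfl⟩
    rw [← pre_comp, h.linearMap_comp_eq_zero, pre_zero]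
  · exact Ext.contravariant_sequence_exact₁ hS _ e (add_comm 1 i) he
  · rintro ⟨e, rfl⟩
    exact hS.extClass_comp_assoc e (h := add_comm 1 i)
  · exact Ext.contravariant_sequence_exact₃ hS _ e he (add_comm 1 i)
  · rintro ⟨e, rfl⟩
    exact hS.comp_extClass_assoc e (add_comm 1 i)

theorem pre_zero_injective (N : Type) [AddCommGroup N] [Module R N] (g : M →ₗ[R] M')
    (hg : Function.Surjective g) : Function.Injective (pre N g 0) := by
  intro a b hab
  apply (zeroEquiv R M' N).injective
  have := congrArg (zeroEquiv R M N) hab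
  rw [zeroEquiv_pre, zeroEquiv_pre] at this
  ext x
  obtain ⟨y, rfl⟩ := hg x
  exact LinearMap.congr_fun this y

theorem les_cov (M : Type) [AddCommGroup M] [Module R M]
    (f : N →ₗ[R] N') (g : N' →ₗ[R] N'') (hf : Function.Injective f)
    (hg : Function.Surjective g) (h : Function.Exact f g) :
    ∃ δ : ∀ i, EX R M N'' i →ₗ[R] EX R M N (i+1),
      (∀ i, Function.Exact (post M f i) (post M g i)) ∧
      (∀ i, Function.Exact (post M g i) (δ i)) ∧ (∀ i, Function.Exact (δ i) (post M f (i+1))) := by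
  have hS := shortExact f g hf hg h
  refine ⟨fun i => hS.extClass.postcompOfLinear R _ rfl, fun i e => ⟨fun he => ?_, ?_⟩,
    fun i e => ⟨fun he => ?_, ?_⟩, fun i e => ⟨fun he => ?_, ?_⟩⟩
  · exact Ext.covariant_sequence_exact₂ _ hS e he
  · rintro ⟨e, rfl⟩
    rw [← post_comp, h.linearMap_comp_eq_zero, post_zero]
  · exact Ext.covariant_sequence_exact₃ _ hS e rfl he
  · rintro ⟨e, rfl⟩
    refine (Ext.comp_assoc_of_second_deg_zero e (Ext.mk₀ (ModuleCat.ofHom g)) hS.extClass rfl).trans ?_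
    exact (congrArg (fun z => Ext.comp e z _) (hS.comp_extClass)).trans (Ext.comp_zero _ _ _ _ _)
  · exact Ext.covariant_sequence_exact₁ _ hS e he rfl
  · rintro ⟨e, rfl⟩
    refine (Ext.comp_assoc_of_third_deg_zero e hS.extClass (Ext.mk₀ (ModuleCat.ofHom f)) rfl).trans ?_
    exact (congrArg (fun z => Ext.comp e z _) (hS.extClass_comp)).trans (Ext.comp_zero _ _ _ _ _)

theorem subsingleton_projective [Module.Projective R M] (i : ℕ) :
    Subsingleton (EX R M N (i+1)) := by
  refine ⟨fun a b => ?_⟩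
  have : Projective (ModuleCat.of R M) := inferInstance
  rw [Ext.eq_zero_of_projective a, Ext.eq_zero_of_projective b]

theorem subsingleton_left [Subsingleton M] (i : ℕ) : Subsingleton (EX R M N i) := by
  refine ⟨fun a b => ?_⟩
  rw [← pre_id i a, ← pre_id i b, Subsingleton.elim (LinearMap.id : M →ₗ[R] M) 0, pre_zero, pre_zero]

theorem smul_eq_zero_of_left {r : R} (h : ∀ m : M, r • m = 0) (i : ℕ) (e : EX R M N i) :
    r • e = 0 := by
  have := pre_smul r (LinearMap.id : M →ₗ[R] M) i e
  rw [pre_id] at this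
  rw [← this, show r • (LinearMap.id : M →ₗ[R] M) = 0 by ext m; exact h m, pre_zero]

theorem finite [IsNoetherianRing R] [Module.Finite R M] [Module.Finite R N] (i : ℕ) :
    Module.Finite R (EX R M N i) :=
  ModuleCat.finite_ext R (ModuleCat.of R M) (ModuleCat.of R N) i

open Pointwise in
/-- The quotient map to `M/xM`. -/
abbrev qmk (x : R) (M : Type) [AddCommGroup M] [Module R M] : M →ₗ[R] QuotSMulTop x M :=
  Submodule.mkQ (x • (⊤ : Submodule R M))

/-- LES for multiplication by a regular element. -/
theorem les_smul (N : Type) [AddCommGroup N] [Module R N] (x : R) (hx : IsSMulRegular M x) :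
    ∃ δ : ∀ i, EX R M N i →ₗ[R] EX R (QuotSMulTop x M) N (i+1),
      (∀ i, Function.Exact (pre N (qmk x M) i)
        (fun e : EX R M N i => x • e)) ∧
      (∀ i, Function.Exact (fun e : EX R M N i => x • e) (δ i)) ∧
      (∀ i, Function.Exact (δ i) (pre N (qmk x M) (i+1))) := by
  have key : ∀ i, (pre N (x • (LinearMap.id : M →ₗ[R] M)) i : EX R M N i → EX R M N i) =
      fun e => x • e := by
    intro i; ext1 e; rw [pre_smul, pre_id]
  obtain ⟨δ, h1, h2, h3⟩ := les N (x • (LinearMap.id : M →ₗ[R] M))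
    (qmk x M) (fun a b hab => hx hab)
    (Submodule.mkQ_surjective _) (by
      intro y
      rw [← LinearMap.mem_ker, qmk, Submodule.ker_mkQ, Submodule.mem_smul_pointwise_iff_exists]
      simp)
  refine ⟨δ, fun i => ?_, fun i => ?_, h3⟩
  · rw [← key]; exact h1 i
  · rw [← key]; exact h2 i

/-- covariant LES for multiplication by a regular element. -/
theorem les_cov_smul (M : Type) [AddCommGroup M] [Module R M] (x : R) (hx : IsSMulRegular N x) :
    ∃ δ : ∀ i, EX R M (QuotSMulTop x N) i →ₗ[R] EX R M N (i+1),
      (∀ i, Function.Exact (fun e : EX R M N i => x • e)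
        (post M (qmk x N) i)) ∧
      (∀ i, Function.Exact (post M (qmk x N) i) (δ i)) ∧
      (∀ i, Function.Exact (δ i) (fun e : EX R M N (i+1) => x • e)) := by
  have key : ∀ i, (post M (x • (LinearMap.id : N →ₗ[R] N)) i : EX R M N i → EX R M N i) =
      fun e => x • e := by
    intro i; ext1 e; rw [post_smul, post_id]
  obtain ⟨δ, h1, h2, h3⟩ := les_cov M (x • (LinearMap.id : N →ₗ[R] N))
    (qmk x N) (fun a b hab => hx hab)
    (Submodule.mkQ_surjective _) (by
      intro y
      rw [← LinearMap.mem_ker, qmk, Submodule.ker_mkQ, Submodule.mem_smul_pointwise_iff_exists]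
      simp)
  refine ⟨δ, fun i => ?_, h2, fun i => ?_⟩
  · rw [← key]; exact h1 i
  · rw [← key]; exact h3 i

end EX
end

section
open IsLocalRing RingTheory.Sequence

theorem reg_exch {B : Type} [CommRing B] [IsLocalRing B] {d : ℕ} (s : Fin (d+1) → B)
    (hs : Ideal.span (Set.range s) = maximalIdeal B) (x : B) (hx : x ∈ maximalIdeal B)
    (hx2 : x ∉ maximalIdeal B ^ 2) :
    ∃ j : Fin (d+1), Ideal.span (Set.range (fun i => s (j.succAbove i))) ⊔ Ideal.span {x}
      = maximalIdeal B := by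
  have hx' := hx
  rw [← hs] at hx
  obtain ⟨a, rfl⟩ := (Ideal.mem_span_range_iff_exists_fun).1 hx
  have hsm : ∀ i, s i ∈ maximalIdeal B := fun i => hs ▸ Ideal.subset_span ⟨i, rfl⟩
  have : ∃ j, a j ∉ maximalIdeal B := by
    by_contra! h
    apply hx2
    rw [pow_two]
    exact Ideal.sum_mem _ fun i _ => Ideal.mul_mem_mul (h i) (hsm i)
  obtain ⟨j, hj⟩ := this
  refine ⟨j, le_antisymm (sup_le (Ideal.span_le.2 ?_) (Ideal.span_le.2 ?_)) ?_⟩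
  · rintro _ ⟨i, rfl⟩; exact hsm _
  · rintro _ rfl; exact hx'
  rw [← hs, Ideal.span_le]
  set J := Ideal.span (Set.range (fun i => s (j.succAbove i))) ⊔ Ideal.span {∑ i, a i * s i}
  have h1 : ∀ i, s (j.succAbove i) ∈ J := fun i =>
    Ideal.mem_sup_left (Ideal.subset_span ⟨i, rfl⟩)
  have h2 : ∑ i, a i * s i ∈ J := Ideal.mem_sup_right (Ideal.subset_span rfl)
  rw [Fin.sum_univ_succAbove _ j] at h2
  have h3 : a j * s j ∈ J := by
    rwa [Submodule.add_mem_iff_left] at h2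
    exact Ideal.sum_mem _ fun i _ => J.mul_mem_left _ (h1 i)
  have hu : IsUnit (a j) := by simpa using hj
  rintro _ ⟨i, rfl⟩
  rcases Fin.eq_self_or_eq_succAbove j i with rfl | ⟨i, rfl⟩
  · exact (Ideal.unit_mul_mem_iff_mem J hu).1 h3
  · exact h1 i

theorem reg_main : ∀ (d : ℕ) (B : Type) [CommRing B] [IsLocalRing B] [IsNoetherianRing B],
    ringKrullDim B = d → ∀ s : Fin d → B, Ideal.span (Set.range s) = maximalIdeal B →
    IsDomain B ∧ ∃ rs : List B, rs.length = d ∧ Ideal.ofList rs = maximalIdeal B ∧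
      IsWeaklyRegular B rs := by
  intro d
  induction d with
  | zero =>
    intro B _ _ _ hd s hs
    have h0 : maximalIdeal B = ⊥ := by rw [← hs]; simp
    have := IsLocalRing.isField_iff_maximalIdeal_eq.2 h0
    exact ⟨this.isDomain, [], rfl, by simp [h0], by simp⟩
  | succ d ih =>
    intro B _ _ _ hd s hs
    have hne : ¬ maximalIdeal B ≤ maximalIdeal B ^ 2 := by
      intro h
      have h0 : maximalIdeal B = ⊥ := by
        apply Submodule.eq_bot_of_le_smul_of_le_jacobson_bot (maximalIdeal B) _
          (IsNoetherian.noetherian _)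
        · rw [pow_two] at h; exact h
        · exact (IsLocalRing.jacobson_eq_maximalIdeal _ bot_ne_top).ge
      have := IsLocalRing.isField_iff_maximalIdeal_eq.2 h0
      rw [ringKrullDim_eq_zero_of_isField this] at hd
      exact absurd hd (by norm_cast)
    have hfin : (minimalPrimes B).Finite := minimalPrimes.finite_of_isNoetherianRing B
    classical
    have hav : ∃ x ∈ maximalIdeal B, x ∉ maximalIdeal B ^ 2 ∧ ∀ q ∈ minimalPrimes B, x ∉ q := by
      by_contra! hcon
      have hsub : ((maximalIdeal B : Ideal B) : Set B) ⊆
          ⋃ i ∈ ((insert (maximalIdeal B ^ 2) hfin.toFinset : Finset (Ideal B)) : Set (Ideal B)),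
            ((id i : Ideal B) : Set B) := by
        intro x hx
        by_cases h2 : x ∈ maximalIdeal B ^ 2
        · simp only [Set.mem_iUnion]; exact ⟨_, by simp, h2⟩
        · obtain ⟨q, hq, hxq⟩ := hcon x hx h2
          simp only [Set.mem_iUnion]; exact ⟨q, by simp [hq], hxq⟩
      rw [Ideal.subset_union_prime (maximalIdeal B ^ 2) (maximalIdeal B ^ 2)] at hsub
      · obtain ⟨q, hq, hle⟩ := hsub
        rw [Finset.mem_insert] at hq
        rcases hq with rfl | hq
        · exact hne hle
        · have hq : q ∈ minimalPrimes B := by simpa using hq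
          have hqm : maximalIdeal B = q := le_antisymm hle (le_maximalIdeal hq.1.1.ne_top)
          rw [← hqm] at hq
          have h0 : (maximalIdeal B).height = 0 := Ideal.height_eq_zero_iff.2 hq
          have := IsLocalRing.maximalIdeal_height_eq_ringKrullDim (R := B)
          rw [h0, hd] at this
          exact absurd this (by norm_cast)
      · intro i hi h1 _
        rw [Finset.mem_insert] at hi
        have : i ∈ minimalPrimes B := by simpa [h1] using hi
        exact this.1.1
    obtain ⟨x, hx, hx2, hq⟩ := hav
    obtain ⟨j, hj⟩ := reg_exch s hs x hx hx2
    have hspan_ne : Ideal.span {x} ≠ ⊤ := by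
      intro h; rw [Ideal.span_singleton_eq_top] at h
      exact (mem_maximalIdeal x).1 hx h
    have : Nontrivial (B ⧸ Ideal.span {x}) := Ideal.Quotient.nontrivial_iff.2 hspan_ne
    have : IsLocalRing (B ⧸ Ideal.span {x}) :=
      IsLocalRing.of_surjective' (Ideal.Quotient.mk _) Ideal.Quotient.mk_surjective
    have hmap : (maximalIdeal B).map (Ideal.Quotient.mk (Ideal.span {x})) =
        maximalIdeal (B ⧸ Ideal.span {x}) := by
      exact IsLocalRing.map_maximalIdeal_of_surjective (Ideal.Quotient.mk (Ideal.span {x})) Ideal.Quotient.mk_surjective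
    have hgen : Ideal.span (Set.range (fun i => Ideal.Quotient.mk (Ideal.span {x})
        (s (j.succAbove i)))) = maximalIdeal (B ⧸ Ideal.span {x}) := by
      rw [← hmap, ← hj, Ideal.map_sup, Ideal.map_quotient_self, sup_bot_eq, Ideal.map_span,
        ← Set.range_comp]
      rfl
    have hdim : ringKrullDim (B ⧸ Ideal.span {x}) = d := by
      apply le_antisymm
      · have := ringKrullDim_le_spanFinrank_maximalIdeal (B ⧸ Ideal.span {x})
        refine this.trans ?_
        rw [← hgen]
        have := Submodule.spanFinrank_span_le_ncard_of_finite (R := B ⧸ Ideal.span {x}) (Set.finite_range (fun i => Ideal.Quotient.mk (Ideal.span {x})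
        (s (j.succAbove i))))
        have h2 : (Set.range (fun i => Ideal.Quotient.mk (Ideal.span {x})
          (s (j.succAbove i)))).ncard ≤ d := by
          rw [← Set.image_univ]
          refine (Set.ncard_image_le Set.finite_univ).trans ?_
          simp [Set.ncard_univ]
        exact_mod_cast this.trans h2
      · have := ringKrullDim_le_ringKrullDim_quotSMulTop_succ hx
        rw [hd, ← Submodule.ideal_span_singleton_smul, smul_eq_mul, Ideal.mul_top] at this
        have h3 : ((d:WithBot ℕ∞)) + 1 ≤ ringKrullDim (B ⧸ Ideal.span {x}) + 1 := by
          exact_mod_cast this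
        exact ENat.WithBot.add_le_add_one_right_iff.1 h3
    obtain ⟨hdom, rs, hlen, hrs, hreg⟩ := ih (B ⧸ Ideal.span {x}) hdim _ hgen
    have hprime : (Ideal.span {x}).IsPrime := (Ideal.Quotient.isDomain_iff_prime _).1 hdom
    obtain ⟨q, hqm, hqx⟩ := Ideal.exists_minimalPrimes_le (I := ⊥) (J := Ideal.span {x}) bot_le
    have hq0 : q = ⊥ := by
      apply Submodule.eq_bot_of_le_smul_of_le_jacobson_bot (maximalIdeal B) _
          (IsNoetherian.noetherian _)
      · intro y hy
        obtain ⟨z, rfl⟩ := Ideal.mem_span_singleton'.1 (hqx hy)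
        have := (hqm.1.1.mem_or_mem hy).resolve_right (hq q hqm)
        rw [mul_comm]
        exact Submodule.smul_mem_smul hx this
      · exact (IsLocalRing.jacobson_eq_maximalIdeal _ bot_ne_top).ge
    have hBdom : IsDomain B := by
      have := hqm.1.1
      rw [hq0] at this
      exact IsDomain.of_bot_isPrime B
    have hx0 : x ≠ 0 := by
      rintro rfl; exact hx2 (Ideal.zero_mem _)
    refine ⟨hBdom, ?_⟩
    obtain ⟨rs', hrs'⟩ : ∃ rs' : List B, rs'.map (Ideal.Quotient.mk (Ideal.span {x})) = rs := by
      have := List.map_surjective_iff.2 (Ideal.Quotient.mk_surjective (I := Ideal.span {x}))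
      exact this rs
    refine ⟨x :: rs', by simp [← hlen, ← hrs'], ?_, ?_⟩
    · have h1 : (Ideal.ofList rs').map (Ideal.Quotient.mk (Ideal.span {x})) =
          (maximalIdeal B).map (Ideal.Quotient.mk (Ideal.span {x})) := by
        rw [Ideal.map_ofList, hrs', hrs, hmap]
      have h2 := congrArg (Ideal.comap (Ideal.Quotient.mk (Ideal.span {x}))) h1
      rw [Ideal.comap_map_of_surjective _ Ideal.Quotient.mk_surjective,
        Ideal.comap_map_of_surjective _ Ideal.Quotient.mk_surjective, ← RingHom.ker_eq_comap_bot,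
        Ideal.mk_ker, sup_eq_left.2 (show Ideal.span {x} ≤ maximalIdeal B from
          (Ideal.span_singleton_le_iff_mem _).2 hx)] at h2
      rw [Ideal.ofList_cons, sup_comm, h2]
    · rw [isWeaklyRegular_cons_iff]
      refine ⟨?_, ?_⟩
      · intro a b hab
        exact mul_left_cancel₀ hx0 hab
      · have e : QuotSMulTop x B ≃ₗ[B] (B ⧸ Ideal.span {x}) :=
          Submodule.quotEquivOfEq _ _ (by
            rw [← Submodule.ideal_span_singleton_smul, smul_eq_mul, Ideal.mul_top])
        rw [e.isWeaklyRegular_congr, ← isWeaklyRegular_map_algebraMap_iff (B ⧸ Ideal.span {x})]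
        rw [show rs'.map (algebraMap B (B ⧸ Ideal.span {x})) = rs from hrs']
        exact hreg

theorem reg_list (B : Type) [CommRing B] [IsRegularLocalRing B] (N : ℕ) (hN : ringKrullDim B = N) :
    IsDomain B ∧ ∃ rs : List B, rs.length = N ∧ Ideal.ofList rs = maximalIdeal B ∧
      IsWeaklyRegular B rs := by
  have h := IsRegularLocalRing.spanFinrank_maximalIdeal (R := B)
  have hf : Submodule.FG (maximalIdeal B) := IsNoetherian.noetherian _
  have hc := hf.generators_ncard
  have hN' : (Submodule.generators (maximalIdeal B)).ncard = N := by
    rw [hc]; rw [hN] at h; exact_mod_cast h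
  have hfin := hf.finite_generators
  have : Finite (Submodule.generators (maximalIdeal B)) := hfin
  have hcard : Nat.card (Submodule.generators (maximalIdeal B)) = N := hN'
  let e := Finite.equivFinOfCardEq hcard
  refine reg_main N B hN (fun i => (e.symm i).1) ?_
  refine Eq.trans (congrArg Ideal.span ?_) (Submodule.span_generators (maximalIdeal B))
  rw [show (fun i => (e.symm i).1) = Subtype.val ∘ e.symm from rfl, Set.range_comp]
  simp

/-- Ext into `B` concentrated in degree `j`, where it is isomorphic to `M`. -/
def ExtSelf (B M : Type) [CommRing B] [AddCommGroup M] [Module B M] (j : ℕ) : Prop :=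
  (∀ i, i ≠ j → Subsingleton (EX B M B i)) ∧ Nonempty (EX B M B j ≃ₗ[B] M)

theorem extSelf_congr {B M M' : Type} [CommRing B] [AddCommGroup M] [Module B M]
    [AddCommGroup M'] [Module B M'] (e : M ≃ₗ[B] M') {j : ℕ} (h : ExtSelf B M j) :
    ExtSelf B M' j := by
  refine ⟨fun i hi => ?_, ?_⟩
  · have := h.1 i hi
    exact (EX.congrLeft B e i).toEquiv.subsingleton
  · obtain ⟨f⟩ := h.2
    exact ⟨(EX.congrLeft B e j).trans (f.trans e)⟩

theorem extSelf_step {B M : Type} [CommRing B] [AddCommGroup M] [Module B M] (x : B)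
    (hx : IsSMulRegular M x) {j : ℕ} (h : ExtSelf B M j) :
    ExtSelf B (QuotSMulTop x M) (j+1) := by
  obtain ⟨δ, h1, h2, h3⟩ := EX.les_smul (M := M) B x hx
  obtain ⟨f⟩ := h.2
  have hinj : ∀ i (e : EX B M B i), x • e = 0 → e = 0 := by
    intro i e he
    by_cases hi : i = j
    · subst hi
      apply f.injective
      have : x • f e = x • (0 : M) := by rw [← map_smul, he]; simp
      rw [map_zero]; exact hx this
    · have := h.1 i hi
      exact Subsingleton.elim _ _
  constructor
  · intro i hi
    rcases i with _ | i
    · refine subsingleton_of_forall_eq 0 fun e => ?_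
      apply EX.pre_zero_injective B (EX.qmk x M) (Submodule.mkQ_surjective _)
      rw [map_zero]
      exact hinj _ _ ((h1 0 _).2 ⟨e, rfl⟩)
    · have := h.1 i (by omega)
      refine subsingleton_of_forall_eq 0 fun e => ?_
      obtain ⟨y, rfl⟩ := (h3 i e).1 (hinj _ _ ((h1 (i+1) _).2 ⟨e, rfl⟩))
      rw [Subsingleton.elim y 0, map_zero]
  · have hs := h.1 (j+1) (by omega)
    have hsurj : Function.Surjective (δ j) := fun e => (h3 j e).1 (Subsingleton.elim _ _)
    have hker : LinearMap.ker (δ j) = (LinearMap.range (x • (LinearMap.id : EX B M B j →ₗ[B] _))) := by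
      ext e
      rw [LinearMap.mem_ker, h2 j e]
      simp
    let e1 := (LinearMap.quotKerEquivOfSurjective (δ j) hsurj).symm
    refine ⟨e1.trans (Submodule.Quotient.equiv _ _ f ?_)⟩
    rw [hker]
    ext m
    constructor
    · rintro ⟨_, ⟨y, rfl⟩, rfl⟩
      rw [Submodule.mem_smul_pointwise_iff_exists]
      exact ⟨f y, trivial, by simp⟩
    · intro hm
      rw [Submodule.mem_smul_pointwise_iff_exists] at hm
      obtain ⟨y, -, rfl⟩ := hm
      exact ⟨x • f.symm y, ⟨f.symm y, rfl⟩, by simp⟩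

theorem extSelf_list {B : Type} [CommRing B] (rs : List B) : ∀ (M : Type) [AddCommGroup M]
    [Module B M] (j : ℕ), ExtSelf B M j → IsWeaklyRegular M rs →
    ExtSelf B (M ⧸ (Ideal.ofList rs • ⊤ : Submodule B M)) (j + rs.length) := by
  induction rs with
  | nil =>
    intro M _ _ j h _
    refine extSelf_congr ?_ h
    exact (Submodule.quotEquivOfEqBot _ (by simp)).symm
  | cons x rs ih =>
    intro M _ _ j h hr
    rw [isWeaklyRegular_cons_iff] at hr
    have := ih _ _ (extSelf_step x hr.1 h) hr.2
    rw [List.length_cons, show j + (rs.length + 1) = j + 1 + rs.length by omega]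
    exact extSelf_congr (Submodule.quotOfListConsSMulTopEquivQuotSMulTopInner M x rs).symm this

theorem extSelf_ring (B : Type) [CommRing B] : ExtSelf B B 0 := by
  refine ⟨fun i hi => ?_, ⟨(EX.zeroEquiv B B B).trans (LinearMap.ringLmapEquivSelf B B B)⟩⟩
  obtain ⟨i, rfl⟩ := Nat.exists_eq_succ_of_ne_zero hi
  exact EX.subsingleton_projective i

theorem extSelf_residue (B : Type) [CommRing B] [IsRegularLocalRing B] (N : ℕ)
    (hN : ringKrullDim B = N) : ExtSelf B (B ⧸ maximalIdeal B) N := by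
  obtain ⟨-, rs, hl, hrs, hreg⟩ := reg_list B N hN
  have := extSelf_list rs B 0 (extSelf_ring B) hreg
  rw [zero_add, hl] at this
  exact extSelf_congr (Submodule.quotEquivOfEq _ _ (by simp [hrs])) this
end

section
open IsLocalRing RingTheory.Sequence

set_option linter.unusedSectionVars false

section Loc
variable {B : Type} [CommRing B] [IsLocalRing B] [IsNoetherianRing B] {N : ℕ}

theorem nak_surj {M : Type} [AddCommGroup M] [Module B M] [Module.Finite B M] {x : B}
    (hx : x ∈ maximalIdeal B) (h : ∀ m : M, ∃ m', x • m' = m) : Subsingleton M := by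
  have : (⊤ : Submodule B M) = ⊥ := by
    apply Submodule.eq_bot_of_le_smul_of_le_jacobson_bot (maximalIdeal B) _ Module.Finite.fg_top
    · intro m _
      obtain ⟨m', rfl⟩ := h m
      exact Submodule.smul_mem_smul hx trivial
    · exact (IsLocalRing.jacobson_eq_maximalIdeal _ bot_ne_top).ge
  exact (Submodule.subsingleton_iff B).1 (subsingleton_of_bot_eq_top this.symm)

theorem extFL (hB : ExtSelf B (B ⧸ maximalIdeal B) N) (L : Type) [AddCommGroup L] [Module B L]
    (h : IsFiniteLength B L) :
    (∀ i, i ≠ N → Subsingleton (EX B L B i)) ∧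
      Module.length B (EX B L B N) = Module.length B L := by
  induction h with
  | of_subsingleton =>
    rename_i M _ _ _
    refine ⟨fun i _ => EX.subsingleton_left i, ?_⟩
    have := EX.subsingleton_left (R := B) (M := M) (N := B) N
    rw [Module.length_eq_zero, Module.length_eq_zero]
  | of_simple_quotient h ih =>
    rename_i M _ _ K hs
    obtain ⟨m, hm, ⟨e⟩⟩ := isSimpleModule_iff_quot_maximal.1 hs
    have hm' := IsLocalRing.eq_maximalIdeal hm
    subst hm'
    have hq := extSelf_congr e.symm hB
    obtain ⟨δ, h1, h2, h3⟩ := EX.les B K.subtype K.mkQ K.subtype_injective K.mkQ_surjective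
      (LinearMap.exact_subtype_mkQ K)
    refine ⟨fun i hi => ?_, ?_⟩
    · have a1 := hq.1 i hi
      have a2 := ih.1 i hi
      refine subsingleton_of_forall_eq 0 fun z => ?_
      obtain ⟨y, rfl⟩ := (h1 i z).1 (Subsingleton.elim _ _)
      rw [Subsingleton.elim y 0, map_zero]
    · have hinj : Function.Injective (EX.pre B K.mkQ N) := by
        rcases Nat.eq_zero_or_pos N with rfl | hN
        · exact EX.pre_zero_injective B _ K.mkQ_surjective
        · obtain ⟨n, rfl⟩ := Nat.exists_eq_succ_of_ne_zero hN.ne'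
          rw [injective_iff_map_eq_zero]
          intro z hz
          obtain ⟨y, rfl⟩ := (h3 n z).1 hz
          have := ih.1 n (by omega)
          rw [Subsingleton.elim y 0, map_zero]
      have hsurj : Function.Surjective (EX.pre B K.subtype N) := by
        intro z
        have := hq.1 (N+1) (by omega)
        exact (h2 N z).1 (Subsingleton.elim _ _)
      rw [Module.length_eq_add_of_exact _ _ hinj hsurj (h1 N), ih.2, hq.2.some.length_eq,
        Module.length_eq_add_of_exact K.subtype K.mkQ K.subtype_injective K.mkQ_surjective
          (LinearMap.exact_subtype_mkQ K), add_comm]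

theorem fl_of {L : Type} [AddCommGroup L] [Module B L] [IsNoetherian B L] [IsArtinian B L] :
    IsFiniteLength B L := isFiniteLength_iff_isNoetherian_isArtinian.2 ⟨inferInstance, inferInstance⟩

theorem extFL_surj (hB : ExtSelf B (B ⧸ maximalIdeal B) N) {L L' : Type} [AddCommGroup L]
    [Module B L] [AddCommGroup L'] [Module B L'] [IsNoetherian B L'] [IsArtinian B L']
    (f : L →ₗ[B] L') (hf : Function.Injective f) : Function.Surjective (EX.pre B f N) := by
  obtain ⟨δ, h1, h2, h3⟩ := EX.les B f (LinearMap.range f).mkQ hf (Submodule.mkQ_surjective _)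
      (by intro y; rw [← LinearMap.mem_ker, Submodule.ker_mkQ]; rfl)
  intro z
  have := (extFL hB (L' ⧸ LinearMap.range f) fl_of).1 (N+1) (by omega)
  exact (h2 N z).1 (Subsingleton.elim _ _)

theorem extFL_inj (hB : ExtSelf B (B ⧸ maximalIdeal B) N) {L L' : Type} [AddCommGroup L]
    [Module B L] [AddCommGroup L'] [Module B L'] [IsNoetherian B L] [IsArtinian B L]
    (f : L →ₗ[B] L') (hf : Function.Surjective f) : Function.Injective (EX.pre B f N) := by
  obtain ⟨δ, h1, h2, h3⟩ := EX.les B (LinearMap.ker f).subtype f (Submodule.subtype_injective _) hf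
      (LinearMap.exact_subtype_ker_map f)
  rcases Nat.eq_zero_or_pos N with rfl | hN
  · exact EX.pre_zero_injective B _ hf
  · obtain ⟨n, rfl⟩ := Nat.exists_eq_succ_of_ne_zero hN.ne'
    rw [injective_iff_map_eq_zero]
    intro z hz
    obtain ⟨y, rfl⟩ := (h3 n z).1 hz
    have := (extFL hB (LinearMap.ker f) fl_of).1 n (by omega)
    rw [Subsingleton.elim y 0, map_zero]

theorem ext_vanish (hB : ExtSelf B (B ⧸ maximalIdeal B) N) (rs : List B) :
    ∀ (M : Type) [AddCommGroup M] [Module B M] [Module.Finite B M],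
    IsWeaklyRegular M rs → (∀ r ∈ rs, r ∈ maximalIdeal B) →
    IsFiniteLength B (M ⧸ (Ideal.ofList rs • ⊤ : Submodule B M)) →
    ∀ i, i + rs.length ≠ N → Subsingleton (EX B M B i) := by
  induction rs with
  | nil =>
    intro M _ _ _ _ _ hfl i hi
    have e : (M ⧸ (Ideal.ofList [] • ⊤ : Submodule B M)) ≃ₗ[B] M :=
      Submodule.quotEquivOfEqBot _ (by rw [Ideal.ofList_nil (R := B)]; exact Submodule.bot_smul (⊤ : Submodule B M))
    exact (extFL hB M (e.isFiniteLength hfl)).1 i (by simpa using hi)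
  | cons x rs ih =>
    intro M _ _ _ hr hm hfl i hi
    rw [isWeaklyRegular_cons_iff] at hr
    have e := (Submodule.quotOfListConsSMulTopEquivQuotSMulTopInner M x rs)
    have := ih (QuotSMulTop x M) hr.2 (fun r h => hm r (by simp [h])) (e.isFiniteLength hfl) (i+1)
      (by rw [List.length_cons] at hi; omega)
    obtain ⟨δ, h1, h2, h3⟩ := EX.les_smul (M := M) B x hr.1
    have := EX.finite (R := B) (M := M) (N := B) i
    exact nak_surj (hm x (by simp)) fun z => (h2 i z).1 (Subsingleton.elim _ _)

theorem exists_socle {L : Type} [AddCommGroup L] [Module B L] [IsNoetherian B L] [IsArtinian B L]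
    (K : Submodule B L) (hK : K ≠ ⊥) : ∃ s ∈ K, s ≠ 0 ∧ ∀ b ∈ maximalIdeal B, b • s = 0 := by
  obtain ⟨a, ha, haK⟩ := (IsAtomic.eq_bot_or_exists_atom_le K).resolve_left hK
  have h1 : maximalIdeal B • a ≤ a := Submodule.smul_le_right
  have h2 : maximalIdeal B • a = ⊥ := by
    rcases h1.lt_or_eq with h | h
    · exact ha.2 _ h
    · exfalso
      apply ha.1
      exact Submodule.eq_bot_of_le_smul_of_le_jacobson_bot (maximalIdeal B) a
        (IsNoetherian.noetherian _) h.ge (IsLocalRing.jacobson_eq_maximalIdeal _ bot_ne_top).ge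
  obtain ⟨s, hs, hs0⟩ := (Submodule.ne_bot_iff _).1 ha.1
  refine ⟨s, haK hs, hs0, fun b hb => ?_⟩
  have := Submodule.smul_mem_smul hb hs
  rw [h2] at this
  simpa using this

/-- From a cyclic module, define a map by the image of the generator. -/
theorem cyclic_map {M E : Type} [AddCommGroup M] [Module B M] [AddCommGroup E] [Module B E]
    (g : M) (hg : ∀ m, ∃ b : B, m = b • g) (e : E) (h : ∀ b : B, b • g = 0 → b • e = 0) :
    ∃ φ : M →ₗ[B] E, φ g = e := by
  let p : B →ₗ[B] M := LinearMap.toSpanSingleton B M g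
  let q : B →ₗ[B] E := LinearMap.toSpanSingleton B E e
  have hp : Function.Surjective p := fun m => by
    obtain ⟨b, rfl⟩ := hg m; exact ⟨b, rfl⟩
  have hk : LinearMap.ker p ≤ LinearMap.ker q := fun b hb => h b hb
  refine ⟨(Submodule.liftQ _ q hk) ∘ₗ (p.quotKerEquivOfSurjective hp).symm.toLinearMap, ?_⟩
  have : (p.quotKerEquivOfSurjective hp).symm g = Submodule.Quotient.mk 1 := by
    rw [LinearEquiv.symm_apply_eq, LinearMap.quotKerEquivOfSurjective_apply_mk]
    simp [p]
  rw [LinearMap.comp_apply, LinearEquiv.coe_coe, this, Submodule.liftQ_apply]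
  simp [q]

theorem ext_gor_base (hB : ExtSelf B (B ⧸ maximalIdeal B) N) (M : Type) [AddCommGroup M]
    [Module B M] [IsNoetherian B M] [IsArtinian B M] (g : M) (hg : ∀ m, ∃ b : B, m = b • g)
    (hs : ∀ u v : M, (∀ b ∈ maximalIdeal B, b • u = 0) → (∀ b ∈ maximalIdeal B, b • v = 0) →
      u ≠ 0 → ∃ b : B, v = b • u) : Nonempty (EX B M B N ≃ₗ[B] M) := by
  rcases subsingleton_or_nontrivial M with hM | hM
  · have := EX.subsingleton_left (R := B) (M := M) (N := B) N
    exact ⟨0⟩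
  have hlen := (extFL hB M fl_of).2
  have hlt : Module.length B M ≠ ⊤ := Module.length_ne_top_iff.2 fl_of
  obtain ⟨s, -, hs0, hsm⟩ := exists_socle (⊤ : Submodule B M) (by
    intro h; exact not_subsingleton M ((Submodule.subsingleton_iff B).1
      (subsingleton_of_bot_eq_top h.symm)))
  obtain ⟨b, rfl⟩ := hg s
  have hE : ∃ e : EX B M B N, b • e ≠ 0 := by
    by_contra! hcon
    let f : M →ₗ[B] M := b • LinearMap.id
    have hsurj := extFL_surj hB (LinearMap.range f).subtype (Submodule.subtype_injective _)
    have hinj := extFL_inj hB f.rangeRestrict f.surjective_rangeRestrict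
    have hz : ∀ z : EX B (LinearMap.range f) B N, z = 0 := by
      intro z
      apply hinj
      obtain ⟨e, rfl⟩ := hsurj z
      rw [← EX.pre_comp, map_zero]
      have : (LinearMap.range f).subtype ∘ₗ f.rangeRestrict = b • LinearMap.id := by ext; rfl
      rw [this, EX.pre_smul, EX.pre_id, hcon]
    have hl := (extFL hB (LinearMap.range f) fl_of).2
    have : Subsingleton (EX B (LinearMap.range f) B N) := subsingleton_of_forall_eq 0 hz
    rw [Module.length_eq_zero, eq_comm, Module.length_eq_zero_iff] at hl
    have : (⟨b • g, g, rfl⟩ : LinearMap.range f) = 0 := Subsingleton.elim _ _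
    exact hs0 (congrArg Subtype.val this)
  obtain ⟨e, he⟩ := hE
  obtain ⟨φ, hφ⟩ := cyclic_map g hg e (by
    intro b' hb'
    apply EX.smul_eq_zero_of_left
    intro m
    obtain ⟨c, rfl⟩ := hg m
    rw [smul_comm, hb', smul_zero])
  have hinj : Function.Injective φ := by
    rw [← LinearMap.ker_eq_bot]
    by_contra hK
    obtain ⟨u, huK, hu0, hum⟩ := exists_socle _ hK
    obtain ⟨c, hc⟩ := hs u (b • g) hum hsm hu0
    apply he
    rw [← hφ, ← map_smul, hc, map_smul, LinearMap.mem_ker.1 huK, smul_zero]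
  have hsurj : Function.Surjective φ := by
    rw [← LinearMap.range_eq_top]
    by_contra hne
    have h1 := Module.length_eq_add_of_exact φ (LinearMap.range φ).mkQ hinj
      (Submodule.mkQ_surjective _) (by intro y; rw [← LinearMap.mem_ker, Submodule.ker_mkQ]; rfl)
    rw [hlen] at h1
    have h2 : Module.length B (EX B M B N ⧸ LinearMap.range φ) = 0 := by
      have : Module.length B M + 0 = Module.length B M + Module.length B (EX B M B N ⧸ LinearMap.range φ) := by
        rw [add_zero]; exact h1
      exact (WithTop.add_left_cancel hlt this).symm
    rw [Module.length_eq_zero_iff] at h2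
    exact hne (Submodule.Quotient.subsingleton_iff.1 h2)
  exact ⟨(LinearEquiv.ofBijective φ ⟨hinj, hsurj⟩).symm⟩

theorem ext_gor (hB : ExtSelf B (B ⧸ maximalIdeal B) N) (rs : List B) :
    ∀ (M : Type) [AddCommGroup M] [Module B M] [Module.Finite B M],
    IsWeaklyRegular M rs → (∀ r ∈ rs, r ∈ maximalIdeal B) →
    IsFiniteLength B (M ⧸ (Ideal.ofList rs • ⊤ : Submodule B M)) →
    (∃ g : M, ∀ m, ∃ b : B, m = b • g) →
    (∀ u v : M ⧸ (Ideal.ofList rs • ⊤ : Submodule B M), (∀ b ∈ maximalIdeal B, b • u = 0) →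
      (∀ b ∈ maximalIdeal B, b • v = 0) → u ≠ 0 → ∃ b : B, v = b • u) →
    ∀ c, c + rs.length = N → Nonempty (EX B M B c ≃ₗ[B] M) := by
  induction rs with
  | nil =>
    intro M _ _ _ _ _ hfl hg hs c hc
    have e : (M ⧸ (Ideal.ofList [] • ⊤ : Submodule B M)) ≃ₗ[B] M :=
      Submodule.quotEquivOfEqBot _ (by rw [Ideal.ofList_nil (R := B)]; exact Submodule.bot_smul (⊤ : Submodule B M))
    have hfl' := e.isFiniteLength hfl
    obtain ⟨h1, h2⟩ := isFiniteLength_iff_isNoetherian_isArtinian.1 hfl'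
    obtain ⟨g, hg⟩ := hg
    obtain rfl : c = N := by simpa using hc
    refine ext_gor_base hB M g hg fun u v hu hv hu0 => ?_
    obtain ⟨b, hb⟩ := hs (e.symm u) (e.symm v) (fun b hb => by rw [← map_smul, hu b hb, map_zero])
      (fun b hb => by rw [← map_smul, hv b hb, map_zero]) (by simpa using hu0)
    refine ⟨b, ?_⟩
    rw [← map_smul] at hb
    exact e.symm.injective hb
  | cons x rs ih =>
    intro M _ _ _ hr hm hfl hg hs c hc
    have hxm := hm x (by simp)
    rw [List.length_cons] at hc
    have hr' := hr
    rw [isWeaklyRegular_cons_iff] at hr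
    let e := (Submodule.quotOfListConsSMulTopEquivQuotSMulTopInner M x rs)
    obtain ⟨g, hg⟩ := hg
    have hfl' := e.isFiniteLength hfl
    have hm' : ∀ r ∈ rs, r ∈ maximalIdeal B := fun r h => hm r (by simp [h])
    obtain ⟨F⟩ := ih (QuotSMulTop x M) hr.2 hm' hfl'
      ⟨EX.qmk x M g, fun m => by
        obtain ⟨m, rfl⟩ := Submodule.mkQ_surjective _ m
        obtain ⟨b, rfl⟩ := hg m
        exact ⟨b, by simp⟩⟩ (by
        intro u v hu hv hu0
        obtain ⟨b, hb⟩ := hs (e.symm u) (e.symm v)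
          (fun b hb => by rw [← map_smul, hu b hb, map_zero])
          (fun b hb => by rw [← map_smul, hv b hb, map_zero]) (by simpa using hu0)
        refine ⟨b, ?_⟩
        rw [← map_smul] at hb
        exact e.symm.injective hb) (c+1) (by omega)
    have v1 := ext_vanish hB rs (QuotSMulTop x M) hr.2 hm' hfl' c (by omega)
    have v2 := ext_vanish hB (x :: rs) M hr' hm hfl (c+1) (by rw [List.length_cons]; omega)
    obtain ⟨δ, h1, h2, h3⟩ := EX.les_smul (M := M) B x hr.1
    have hEf := EX.finite (R := B) (M := M) (N := B) c
    have hxinj : ∀ z : EX B M B c, x • z = 0 → z = 0 := by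
      intro z hz
      obtain ⟨y, rfl⟩ := (h1 c z).1 hz
      rw [Subsingleton.elim y 0, map_zero]
    have hδ : Function.Surjective (δ c) := fun z => (h3 c z).1 (Subsingleton.elim _ _)
    obtain ⟨e0, he0⟩ := hδ (F.symm (EX.qmk x M g))
    obtain ⟨φ, hφ⟩ := cyclic_map g hg e0 (by
      intro b' hb'
      apply EX.smul_eq_zero_of_left
      intro m
      obtain ⟨c, rfl⟩ := hg m
      rw [smul_comm, hb', smul_zero])
    have key : ∀ m, F (δ c (φ m)) = EX.qmk x M m := by
      intro m
      obtain ⟨b, rfl⟩ := hg m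
      simp [hφ, he0]
    have hsurj : Function.Surjective φ := by
      rw [← LinearMap.range_eq_top]
      rw [← Submodule.Quotient.subsingleton_iff]
      apply nak_surj hxm
      intro z
      obtain ⟨z, rfl⟩ := Submodule.mkQ_surjective _ z
      obtain ⟨m, hm⟩ := Submodule.mkQ_surjective _ (F (δ c z))
      obtain ⟨z', hz'⟩ := (h2 c (z - φ m)).1 (by
        apply F.injective
        rw [map_sub, map_sub, key, map_zero, ← hm, sub_self])
      refine ⟨Submodule.mkQ _ z', ?_⟩
      rw [← map_smul, ← sub_eq_zero, ← map_sub, ← LinearMap.mem_ker, Submodule.ker_mkQ]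
      simp only at hz'
      rw [hz']
      exact ⟨-m, by simp⟩
    have hinj : Function.Injective φ := by
      rw [← LinearMap.ker_eq_bot]
      have : Subsingleton (LinearMap.ker φ) := by
        apply nak_surj hxm
        rintro ⟨m, hmk⟩
        have : EX.qmk x M m = 0 := by rw [← key, LinearMap.mem_ker.1 hmk]; simp
        rw [← LinearMap.mem_ker, Submodule.ker_mkQ, Submodule.mem_smul_pointwise_iff_exists] at this
        obtain ⟨m', -, rfl⟩ := this
        refine ⟨⟨m', ?_⟩, rfl⟩
        rw [LinearMap.mem_ker, map_smul] at hmk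
        exact hxinj _ hmk
      exact Submodule.subsingleton_iff_eq_bot.1 this
    exact ⟨(LinearEquiv.ofBijective φ ⟨hinj, hsurj⟩).symm⟩
end Loc
end

section
open IsLocalRing RingTheory.Sequence

theorem rees {R : Type} [CommRing R] [IsNoetherianRing R] (I : Ideal R) (hI : I ≠ ⊤) (t : ℕ)
    (h : ∀ i < t, Subsingleton (EX R (R ⧸ I) R i)) :
    ∃ rs : List R, rs.length = t ∧ (∀ r ∈ rs, r ∈ I) ∧ IsRegular R rs := by
  refine ModuleCat.exists_isRegular_of_exists_subsingleton_ext I t (ModuleCat.of R R) ?_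
    (ModuleCat.of R (R ⧸ I)) ?_ h
  · have : I • (⊤ : Submodule R R) = I := by simp
    exact lt_of_le_of_ne le_top (fun h => hI (this.symm.trans h))
  · exact (Module.support_eq_zeroLocus (M := R ⧸ I)).trans (by rw [Ideal.annihilator_quotient])

theorem isFL_of_dim {B A : Type} [CommRing B] [CommRing A] [IsNoetherianRing B] [Algebra B A]
    (hs : Function.Surjective (algebraMap B A)) (h : ringKrullDim A ≤ 0) : IsFiniteLength B A := by
  have : IsNoetherianRing A := isNoetherianRing_of_surjective B A _ hs
  have : Ring.KrullDimLE 0 A := Ring.krullDimLE_iff.2 h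
  have : IsArtinianRing A := isArtinianRing_iff_krullDimLE_zero.2 inferInstance
  have h1 : IsArtinian B A := isArtinian_of_surjective_algebraMap hs
  have h2 : IsNoetherian B A := isNoetherian_of_surjective
    (Algebra.linearMap B A) (LinearMap.range_eq_top.2 hs)
  exact isFiniteLength_iff_isNoetherian_isArtinian.2 ⟨h2, h1⟩

/-- Lifting a regular sequence along a surjection. -/
theorem lift_list {B A : Type} [CommRing B] [CommRing A] [IsLocalRing B] [IsLocalRing A]
    [IsNoetherianRing B] [Algebra B A]
    (hs : Function.Surjective (algebraMap B A)) (rs : List A) (hm : ∀ r ∈ rs, r ∈ maximalIdeal A)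
    (hr : IsWeaklyRegular A rs) (hd : ringKrullDim (A ⧸ Ideal.ofList rs) ≤ 0) :
    ∃ rs' : List B, rs'.length = rs.length ∧ IsWeaklyRegular A rs' ∧
      (∀ r ∈ rs', r ∈ maximalIdeal B) ∧
      IsFiniteLength B (A ⧸ (Ideal.ofList rs' • ⊤ : Submodule B A)) ∧
      Nonempty ((A ⧸ (Ideal.ofList rs' • ⊤ : Submodule B A)) ≃ₗ[B] (A ⧸ Ideal.ofList rs)) := by
  obtain ⟨rs', rfl⟩ := List.map_surjective_iff.2 hs rs
  have : IsLocalHom (algebraMap B A) := IsLocalHom.of_surjective _ hs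
  have e : (A ⧸ (Ideal.ofList rs' • ⊤ : Submodule B A)) ≃ₗ[B]
      (A ⧸ Ideal.ofList (rs'.map (algebraMap B A))) := by
    refine (Submodule.quotEquivOfEq _ _ ?_).trans
      (Submodule.Quotient.restrictScalarsEquiv B (Ideal.ofList (rs'.map (algebraMap B A))))
    rw [Ideal.smul_top_eq_map, Ideal.map_ofList]
  refine ⟨rs', by simp, (isWeaklyRegular_map_algebraMap_iff A A rs').1 hr, ?_, ?_, ⟨e⟩⟩
  · intro r h
    have := hm (algebraMap B A r) (List.mem_map_of_mem h)
    rw [mem_maximalIdeal, mem_nonunits_iff] at this ⊢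
    exact fun hu => this (hu.map _)
  · refine e.symm.isFiniteLength (isFL_of_dim ?_ hd)
    exact Ideal.Quotient.mk_surjective.comp hs

section
variable {A : Type} [CommRing A] [IsLocalRing A] [IsNoetherianRing A]

/-- Socle elements of `M/rs M` embed into `Ext^t(κ, M)`. -/
theorem socle_ext (rs : List A) : ∀ (M : Type) [AddCommGroup M] [Module A M] [Module.Finite A M],
    IsWeaklyRegular M rs → (∀ r ∈ rs, r ∈ maximalIdeal A) →
    (∀ i < rs.length, Subsingleton (EX A (A ⧸ maximalIdeal A) M i)) ∧
    ∃ φ : ((A ⧸ maximalIdeal A) →ₗ[A] (M ⧸ (Ideal.ofList rs • ⊤ : Submodule A M))) →ₗ[A]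
      EX A (A ⧸ maximalIdeal A) M rs.length, Function.Injective φ := by
  induction rs with
  | nil =>
    intro M _ _ _ _ _
    have e : (M ⧸ (Ideal.ofList [] • ⊤ : Submodule A M)) ≃ₗ[A] M :=
      Submodule.quotEquivOfEqBot _ (by rw [Ideal.ofList_nil (R := A)]; exact Submodule.bot_smul (⊤ : Submodule A M))
    refine ⟨by simp, ((EX.zeroEquiv A (A ⧸ maximalIdeal A) M).symm).toLinearMap ∘ₗ
      (LinearEquiv.congrRight e).toLinearMap, ?_⟩
    exact (EX.zeroEquiv A (A ⧸ maximalIdeal A) M).symm.injective.comp (LinearEquiv.congrRight e).injective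
  | cons x rs ih =>
    intro M _ _ _ hr hm
    rw [isWeaklyRegular_cons_iff] at hr
    have e := (Submodule.quotOfListConsSMulTopEquivQuotSMulTopInner M x rs)
    obtain ⟨h0, φ, hφ⟩ := ih (QuotSMulTop x M) hr.2 (fun r h => hm r (by simp [h]))
    obtain ⟨δ, h1, h2, h3⟩ := EX.les_cov_smul (N := M) (A ⧸ maximalIdeal A) x hr.1
    have hx0 : ∀ i (z : EX A (A ⧸ maximalIdeal A) M i), x • z = 0 := fun i z =>
      EX.smul_eq_zero_of_left (by
        intro m
        obtain ⟨a, rfl⟩ := Ideal.Quotient.mk_surjective m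
        rw [Algebra.smul_def, Ideal.Quotient.algebraMap_eq, ← map_mul, Ideal.Quotient.eq_zero_iff_mem]
        exact Ideal.mul_mem_right _ _ (hm x (by simp))) i z
    have hv : ∀ i < (x :: rs).length, Subsingleton (EX A (A ⧸ maximalIdeal A) M i) := by
      intro i hi
      refine subsingleton_of_forall_eq 0 fun z => ?_
      cases i with
      | zero =>
        -- injectivity of mult by x in degree 0
        apply (EX.zeroEquiv A (A ⧸ maximalIdeal A) M).injective
        rw [map_zero]
        have : x • (EX.zeroEquiv A (A ⧸ maximalIdeal A) M z) = 0 := by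
          rw [← map_smul, hx0, map_zero]
        refine LinearMap.ext fun y => hr.1 ?_
        have h5 := LinearMap.congr_fun this y
        simpa using h5
      | succ i =>
        obtain ⟨y, hy⟩ := (h3 i z).1 (hx0 _ _)
        have := h0 i (by simpa using hi)
        rw [← hy, Subsingleton.elim y 0, map_zero]
    refine ⟨hv, δ rs.length ∘ₗ φ ∘ₗ (LinearEquiv.congrRight e).toLinearMap, ?_⟩
    have hδ : Function.Injective (δ rs.length) := by
      rw [injective_iff_map_eq_zero]
      intro y hy
      obtain ⟨w, rfl⟩ := (h2 _ y).1 hy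
      have := hv rs.length (by simp)
      rw [Subsingleton.elim w 0, map_zero]
    exact hδ.comp (hφ.comp (LinearEquiv.congrRight e).injective)

theorem socle_one (rs : List A) (M : Type) [AddCommGroup M] [Module A M] [Module.Finite A M]
    (hr : IsWeaklyRegular M rs) (hm : ∀ r ∈ rs, r ∈ maximalIdeal A)
    (e : EX A (A ⧸ maximalIdeal A) M rs.length ≃ₗ[A] (A ⧸ maximalIdeal A))
    (u v : M ⧸ (Ideal.ofList rs • ⊤ : Submodule A M)) (hu : ∀ b ∈ maximalIdeal A, b • u = 0)
    (hv : ∀ b ∈ maximalIdeal A, b • v = 0) (hu0 : u ≠ 0) : ∃ b : A, v = b • u := by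
  obtain ⟨-, φ, hφ⟩ := socle_ext rs M hr hm
  let f : ∀ w : M ⧸ (Ideal.ofList rs • ⊤ : Submodule A M), (∀ b ∈ maximalIdeal A, b • w = 0) →
      ((A ⧸ maximalIdeal A) →ₗ[A] (M ⧸ (Ideal.ofList rs • ⊤ : Submodule A M))) := fun w hw =>
    Submodule.liftQ _ (LinearMap.toSpanSingleton A _ w) (fun b hb => hw b hb)
  have hf : ∀ w hw, f w hw (1 : A ⧸ maximalIdeal A) = w := by
    intro w hw
    change f w hw (Submodule.Quotient.mk 1) = w
    exact (Submodule.liftQ_apply _ _ _).trans (one_smul A w)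
  set ψ := e.toLinearMap ∘ₗ φ with hψ
  have hψi : Function.Injective ψ := e.injective.comp hφ
  have h1 : ψ (f u hu) ≠ 0 := by
    intro h
    have := hψi (h.trans (map_zero ψ).symm)
    apply hu0
    rw [← hf u hu, this]; rfl
  letI := Ideal.Quotient.field (maximalIdeal A)
  obtain ⟨b, hb⟩ := Ideal.Quotient.mk_surjective (ψ (f v hv) / ψ (f u hu))
  refine ⟨b, ?_⟩
  have : ψ (f v hv) = ψ (b • f u hu) := by
    rw [map_smul, Algebra.smul_def, Ideal.Quotient.algebraMap_eq, hb, div_mul_cancel₀ _ h1]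
  have := hψi this
  rw [← hf v hv, this, LinearMap.smul_apply, hf]

end

theorem dim_quot_le {A : Type} [CommRing A] [IsLocalRing A] [IsNoetherianRing A] {t : ℕ}
    (rs : List A) (hr : IsRegular A rs) (ht : ringKrullDim A ≤ t) (hl : rs.length = t) :
    ringKrullDim (A ⧸ Ideal.ofList rs) ≤ 0 := by
  have h := ringKrullDim_add_length_eq_ringKrullDim_of_isRegular rs hr
  rw [← h, hl] at ht
  generalize ringKrullDim (A ⧸ Ideal.ofList rs) = q at ht
  induction q with
  | bot => simp
  | coe q =>
    induction q with
    | top => 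
      exfalso
      have h3 : ((t:ℕ) : WithBot ℕ∞) = ((t : ℕ∞) : WithBot ℕ∞) := rfl
      rw [h3, ← WithBot.coe_add, WithBot.coe_le_coe] at ht
      simp at ht
    | coe q =>
      norm_cast at ht ⊢
      have : q + t ≤ t := by exact_mod_cast ht
      have : q = 0 := by omega
      simp [this]

/-- L4. -/
theorem ext_of_gor {B A : Type} [CommRing B] [CommRing A] [IsLocalRing B] [IsLocalRing A]
    [IsNoetherianRing B] [Algebra B A] (hs : Function.Surjective (algebraMap B A)) {N t : ℕ}
    (hB : ExtSelf B (B ⧸ maximalIdeal B) N) (ht : ringKrullDim A = t)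
    (hA : IsGorensteinLocalRing A) :
    (∀ i, i + t ≠ N → Subsingleton (EX B A B i)) ∧
    (∀ c, c + t = N → Nonempty (EX B A B c ≃ₗ[B] A)) := by
  have : IsNoetherianRing A := hA.1
  have hA' : ∀ i, (i = t → Nonempty (EX A (A ⧸ maximalIdeal A) A i ≃ₗ[A] (A ⧸ maximalIdeal A))) ∧
      (i ≠ t → Subsingleton (EX A (A ⧸ maximalIdeal A) A i)) := by
    intro i
    obtain ⟨e⟩ := extMod_bridge A (A ⧸ maximalIdeal A) A i
    obtain ⟨h1, h2⟩ := hA.2 i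
    rw [ht] at h1 h2
    constructor
    · intro h
      obtain ⟨f⟩ := h1 (by rw [h]; rfl)
      exact ⟨e.symm.trans f⟩
    · intro h
      have := h2 (by intro h'; exact h (Nat.cast_injective (R := WithBot ℕ∞) h'))
      exact e.symm.toEquiv.subsingleton
  obtain ⟨rs, hl, hm, hr⟩ := rees (maximalIdeal A) (maximalIdeal.isMaximal A).ne_top t
    (fun i hi => (hA' i).2 hi.ne)
  have hd : ringKrullDim (A ⧸ Ideal.ofList rs) ≤ 0 := dim_quot_le rs hr ht.le hl
  obtain ⟨rs', hl', hr', hm', hfl, ⟨e⟩⟩ := lift_list hs rs hm hr.toIsWeaklyRegular hd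
  have : Module.Finite B A := Module.Finite.of_surjective (Algebra.linearMap B A) hs
  refine ⟨fun i hi => ext_vanish hB rs' A hr' hm' hfl i (by rwa [hl', hl]), fun c hc => ?_⟩
  refine ext_gor hB rs' A hr' hm' hfl ⟨1, fun m => ?_⟩ ?_ c (by rwa [hl', hl])
  · obtain ⟨b, rfl⟩ := hs m
    exact ⟨b, by rw [Algebra.smul_def, mul_one]⟩
  · intro u v hu hv hu0
    obtain ⟨ε⟩ := (hA' rs.length).1 hl
    have e2 : (A ⧸ (Ideal.ofList rs • ⊤ : Submodule A A)) ≃ₗ[A] (A ⧸ Ideal.ofList rs) :=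
      Submodule.quotEquivOfEq _ _ (by simp)
    have key : ∀ w : A ⧸ (Ideal.ofList rs' • ⊤ : Submodule B A),
        (∀ b ∈ maximalIdeal B, b • w = 0) → ∀ a ∈ maximalIdeal A, a • e2.symm (e w) = 0 := by
      intro w hw a ha
      obtain ⟨b, rfl⟩ := hs a
      have hb : b ∈ maximalIdeal B := by
        rw [mem_maximalIdeal, mem_nonunits_iff] at ha ⊢
        exact fun hu => ha (hu.map _)
      rw [← map_smul, algebraMap_smul, ← map_smul, hw b hb, map_zero, map_zero]
    obtain ⟨a, ha⟩ := socle_one rs A hr.toIsWeaklyRegular hm ε (e2.symm (e u)) (e2.symm (e v))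
      (key u hu) (key v hv) (by simpa using hu0)
    obtain ⟨b, rfl⟩ := hs a
    refine ⟨b, e.injective (e2.symm.injective ?_)⟩
    rw [ha, map_smul, ← map_smul, algebraMap_smul]
end

section
open IsLocalRing RingTheory.Sequence
set_option linter.unusedSectionVars false

namespace DS
section
variable {B A : Type} [CommRing B] [CommRing A] [IsNoetherianRing A] [Algebra B A]

theorem pre_sum {R M M' N ι : Type} [CommRing R] [AddCommGroup M] [Module R M]
    [AddCommGroup M'] [Module R M'] [AddCommGroup N] [Module R N] (s : Finset ι)
    (f : ι → M →ₗ[R] M') (i : ℕ) (e : EX R M' N i) :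
    EX.pre N (∑ j ∈ s, f j) i e = ∑ j ∈ s, EX.pre N (f j) i e := by
  classical
  induction s using Finset.induction_on with
  | empty => simp [EX.pre_zero]
  | insert a s ha ih => rw [Finset.sum_insert ha, Finset.sum_insert ha, EX.pre_add, ih]

theorem free_decomp {n : ℕ} (i : ℕ) (e : EX B (Fin n → A) B i) :
    e = ∑ l, EX.pre B (LinearMap.proj l : (Fin n → A) →ₗ[B] A) i
      (EX.pre B (LinearMap.single B (fun _ => A) l) i e) := by
  conv_lhs => rw [← EX.pre_id i e]
  have : (LinearMap.id : (Fin n → A) →ₗ[B] _) = ∑ l, (LinearMap.single B (fun _ => A) l) ∘ₗ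
      (LinearMap.proj l : (Fin n → A) →ₗ[B] A) := by
    apply LinearMap.ext
    intro v
    rw [LinearMap.sum_apply]
    simp only [LinearMap.comp_apply, LinearMap.proj_apply, LinearMap.id_apply, LinearMap.coe_single]
    exact (Finset.univ_sum_single v).symm
  rw [this, pre_sum]
  exact Finset.sum_congr rfl fun l _ => EX.pre_comp _ _ _ _


theorem free_van {c : ℕ} (hvan : ∀ i, i ≠ c → Subsingleton (EX B A B i))
    {n : ℕ} (i : ℕ) (hi : i ≠ c) : Subsingleton (EX B (Fin n → A) B i) := by
  refine subsingleton_of_forall_eq 0 fun e => ?_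
  have := hvan i hi
  rw [free_decomp i e]
  exact Finset.sum_eq_zero fun l _ => by
    rw [Subsingleton.elim (EX.pre B (LinearMap.single B (fun _ => A) l) i e) 0, map_zero]

theorem low_van {c : ℕ} (hvan : ∀ i, i ≠ c → Subsingleton (EX B A B i))
    (j : ℕ) : ∀ (M : Type) [AddCommGroup M] [Module A M] [Module B M]
    [IsScalarTower B A M] [Module.Finite A M], j < c → Subsingleton (EX B M B j) := by
  induction j with
  | zero =>
    intro M _ _ _ _ _ hj
    obtain ⟨n, π, hπ⟩ := Module.Finite.exists_fin' A M
    have := free_van hvan (n := n) 0 hj.ne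
    exact (EX.pre_zero_injective B (π.restrictScalars B) hπ).subsingleton
  | succ j ih =>
    intro M _ _ _ _ _ hj
    obtain ⟨n, π, hπ⟩ := Module.Finite.exists_fin' A M
    obtain ⟨δ, h1, h2, h3⟩ := EX.les B ((LinearMap.ker π).subtype.restrictScalars B)
      (π.restrictScalars B) (Submodule.subtype_injective _) hπ (LinearMap.exact_subtype_ker_map π)
    have := free_van hvan (n := n) (j+1) hj.ne
    have := ih (LinearMap.ker π) (by omega)
    refine subsingleton_of_forall_eq 0 fun e => ?_
    obtain ⟨y, rfl⟩ := (h3 j e).1 (Subsingleton.elim _ _)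
    rw [Subsingleton.elim y 0, map_zero]

theorem pre_c_inj {c : ℕ} (hvan : ∀ i, i ≠ c → Subsingleton (EX B A B i))
    {M F K : Type} [AddCommGroup M] [Module A M] [Module B M]
    [IsScalarTower B A M] [AddCommGroup F] [Module A F] [Module B F]
    [IsScalarTower B A F] [AddCommGroup K] [Module A K] [Module B K]
    [IsScalarTower B A K] [Module.Finite A K] (f : K →ₗ[B] F) (g : F →ₗ[B] M)
    (hf : Function.Injective f) (hg : Function.Surjective g) (h : Function.Exact f g) :
    Function.Injective (EX.pre B g c) := by
  cases c with
  | zero => exact EX.pre_zero_injective B g hg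
  | succ c =>
    obtain ⟨δ, h1, h2, h3⟩ := EX.les B f g hf hg h
    rw [injective_iff_map_eq_zero]
    intro e he
    obtain ⟨y, rfl⟩ := (h3 c e).1 he
    have := low_van hvan c K (by omega)
    rw [Subsingleton.elim y 0, map_zero]
end

section
variable {B A : Type} [CommRing B] [CommRing A] [IsNoetherianRing A] [Algebra B A]
  (hs : Function.Surjective (algebraMap B A)) {c : ℕ}
  {W : Type} [AddCommGroup W] [Module A W] [Module B W] [IsScalarTower B A W]
  (θ : W ≃ₗ[B] EX B A B c)
  {M M' : Type} [AddCommGroup M] [Module A M] [Module B M] [IsScalarTower B A M]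
  [AddCommGroup M'] [Module A M'] [Module B M'] [IsScalarTower B A M']

/-- `a ↦ a • m` as a `B`-linear map. -/
def tsp (B : Type) {A : Type} [CommRing B] [CommRing A] [Algebra B A] {M : Type} [AddCommGroup M]
    [Module A M] [Module B M] [IsScalarTower B A M] (m : M) : A →ₗ[B] M :=
  (LinearMap.toSpanSingleton A M m).restrictScalars B

theorem tsp_add (m m' : M) : tsp B (A := A) (m + m') = tsp B m + tsp B m' := by
  apply LinearMap.ext; intro a; simp [tsp]

theorem tsp_smul (b : B) (m : M) : tsp B (A := A) (b • m) = b • tsp B m := by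
  apply LinearMap.ext; intro a; simp [tsp]
  rw [smul_comm]

/-- The comparison map. -/
noncomputable def Th (M : Type) [AddCommGroup M] [Module A M] [Module B M] [IsScalarTower B A M]
    (e : EX B M B c) : M →ₗ[A] W :=
  LinearMap.extendScalarsOfSurjective hs
  { toFun := fun m => θ.symm (EX.pre B (tsp B m) c e)
    map_add' := fun m m' => by rw [tsp_add, EX.pre_add, map_add]
    map_smul' := fun b m => by rw [tsp_smul, EX.pre_smul, map_smul]; rfl }


theorem Th_apply (e : EX B M B c) (m : M) : Th hs θ M e m = θ.symm (EX.pre B (tsp B m) c e) := rfl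

theorem Th_nat (f : M →ₗ[A] M') (e : EX B M' B c) :
    Th hs θ M (EX.pre B (f.restrictScalars B) c e) = Th hs θ M' e ∘ₗ f := by
  apply LinearMap.ext; intro m
  rw [Th_apply, LinearMap.comp_apply, Th_apply, ← EX.pre_comp]
  congr 3
  apply LinearMap.ext; intro a
  simp [tsp]

theorem Th_smul (b : B) (e : EX B M B c) : Th hs θ M (b • e) = algebraMap B A b • Th hs θ M e := by
  apply LinearMap.ext; intro m
  rw [Th_apply, map_smul, map_smul, LinearMap.smul_apply, algebraMap_smul, Th_apply]

theorem Th_add (e e' : EX B M B c) : Th hs θ M (e + e') = Th hs θ M e + Th hs θ M e' := by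
  apply LinearMap.ext; intro m
  rw [Th_apply, map_add, map_add, LinearMap.add_apply, Th_apply, Th_apply]

theorem Th_zero : Th hs θ M (0 : EX B M B c) = 0 := by
  apply LinearMap.ext; intro m
  rw [Th_apply, map_zero, map_zero, LinearMap.zero_apply]

theorem Th_free_surj {n : ℕ} : Function.Surjective (Th hs θ (Fin n → A)) := by
  intro h
  refine ⟨∑ l, EX.pre B (LinearMap.proj l : (Fin n → A) →ₗ[B] A) c (θ (h (Pi.single l 1))), ?_⟩
  apply LinearMap.pi_ext'
  intro l
  apply LinearMap.ext_ring
  rw [LinearMap.comp_apply, LinearMap.comp_apply, Th_apply, map_sum, map_sum]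
  rw [Finset.sum_eq_single l]
  · rw [← EX.pre_comp]
    have : (LinearMap.proj l : (Fin n → A) →ₗ[B] A) ∘ₗ
        (tsp B (A := A) ((LinearMap.single A (fun _ => A) l) 1)) = LinearMap.id := by
      apply LinearMap.ext; intro a; simp [tsp]
    rw [this, EX.pre_id]; simp
  · intro j _ hj
    rw [← EX.pre_comp]
    have : (LinearMap.proj j : (Fin n → A) →ₗ[B] A) ∘ₗ
        (tsp B (A := A) ((LinearMap.single A (fun _ => A) l) 1)) = 0 := by
      apply LinearMap.ext; intro a; simp [tsp, hj]
    rw [this, EX.pre_zero, map_zero]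
  · simp

theorem Th_free_inj {n : ℕ} (e : EX B (Fin n → A) B c) (h : Th hs θ _ e = 0) : e = 0 := by
  rw [free_decomp c e]
  refine Finset.sum_eq_zero fun l _ => ?_
  have : EX.pre B (LinearMap.single B (fun _ : Fin n => A) l) c e = 0 := by
    have := LinearMap.congr_fun h (Pi.single l 1)
    rw [Th_apply, LinearMap.zero_apply, LinearEquiv.map_eq_zero_iff] at this
    rw [← this]
    congr 2
    apply LinearMap.ext; intro a
    ext j
    by_cases hj : j = l
    · subst hj; simp [tsp]
    · simp [tsp, hj]
  rw [this, map_zero]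

theorem Th_inj (hvan : ∀ i, i ≠ c → Subsingleton (EX B A B i)) [Module.Finite A M]
    (e : EX B M B c) (h : Th hs θ _ e = 0) : e = 0 := by
  obtain ⟨n, π, hπ⟩ := Module.Finite.exists_fin' A M
  have hi := pre_c_inj hvan ((LinearMap.ker π).subtype.restrictScalars B)
      (π.restrictScalars B) (Submodule.subtype_injective _) hπ (LinearMap.exact_subtype_ker_map π)
  apply hi
  rw [map_zero]
  apply Th_free_inj hs θ
  rw [Th_nat, h, LinearMap.zero_comp]

theorem Th_surj (hvan : ∀ i, i ≠ c → Subsingleton (EX B A B i)) [Module.Finite A M] :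
    Function.Surjective (Th hs θ M) := by
  intro f
  obtain ⟨n, π, hπ⟩ := Module.Finite.exists_fin' A M
  obtain ⟨δ, h1, h2, h3⟩ := EX.les B ((LinearMap.ker π).subtype.restrictScalars B)
      (π.restrictScalars B) (Submodule.subtype_injective _) hπ (LinearMap.exact_subtype_ker_map π)
  obtain ⟨e, he⟩ := Th_free_surj hs θ (f ∘ₗ π)
  have : EX.pre B ((LinearMap.ker π).subtype.restrictScalars B) c e = 0 := by
    apply Th_inj hs θ hvan
    rw [Th_nat, he]
    apply LinearMap.ext; intro x
    have : π x = 0 := x.2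
    simp
  obtain ⟨e', rfl⟩ := (h1 c e).1 this
  refine ⟨e', ?_⟩
  rw [Th_nat] at he
  apply LinearMap.ext; intro m
  obtain ⟨x, rfl⟩ := hπ m
  exact LinearMap.congr_fun he x

/-- Induced semilinear equivalence between quotients. -/
theorem induced {X X' Y Y' : Type} [AddCommGroup X] [Module B X] [AddCommGroup Y] [Module B Y]
    [AddCommGroup X'] [Module A X'] [AddCommGroup Y'] [Module A Y'] (d : X →ₗ[B] Y)
    (d' : X' →ₗ[A] Y') (hd : Function.Surjective d) (hd' : Function.Surjective d')
    (φ : X → X') (h0 : ∀ x y, φ (x + y) = φ x + φ y)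
    (hsm : ∀ (b : B) x, φ (b • x) = algebraMap B A b • φ x) (hφ : Function.Surjective φ)
    (hk : ∀ x, d x = 0 ↔ d' (φ x) = 0) :
    ∃ ψ : Y → Y', (∀ x y, ψ (x + y) = ψ x + ψ y) ∧
      (∀ (b : B) x, ψ (b • x) = algebraMap B A b • ψ x) ∧ Function.Bijective ψ := by
  have hsub : ∀ x y, φ (x - y) = φ x - φ y := fun x y => by
    have := h0 (x - y) y
    rw [sub_add_cancel] at this
    rw [this, add_sub_cancel_right]
  choose s hss using hd
  have key : ∀ x, d' (φ (s (d x))) = d' (φ x) := fun x => by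
    rw [← sub_eq_zero, ← map_sub, ← hsub, ← hk, map_sub, hss, sub_self]
  refine ⟨fun y => d' (φ (s y)), fun x y => ?_, fun b x => ?_, ?_, ?_⟩
  · have := key (s x + s y)
    rw [map_add, hss, hss] at this
    change d' (φ (s (x + y))) = _
    rw [this, h0, map_add]
  · have := key (b • s x)
    rw [map_smul, hss] at this
    change d' (φ (s (b • x))) = _
    rw [this, hsm, map_smul]
  · intro x y hxy
    have : d' (φ (s x - s y)) = 0 := by
      rw [hsub, map_sub]; exact sub_eq_zero.2 hxy
    rw [← hk, map_sub, hss, hss, sub_eq_zero] at this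
    exact this
  · intro y'
    obtain ⟨x', rfl⟩ := hd' y'
    obtain ⟨x, rfl⟩ := hφ x'
    exact ⟨d x, key x⟩

theorem ext_compare (hs : Function.Surjective (algebraMap B A)) (θ : W ≃ₗ[B] EX B A B c)
    (hvan : ∀ i, i ≠ c → Subsingleton (EX B A B i)) (i : ℕ) :
    ∀ (M : Type) [AddCommGroup M] [Module A M] [Module B M] [IsScalarTower B A M]
    [Module.Finite A M],
    ∃ ψ : EX B M B (c + i) → EX A M W i, (∀ x y, ψ (x + y) = ψ x + ψ y) ∧
      (∀ (b : B) x, ψ (b • x) = algebraMap B A b • ψ x) ∧ Function.Bijective ψ := by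
  induction i with
  | zero =>
    intro M _ _ _ _ _
    refine ⟨fun e => (EX.zeroEquiv A M W).symm (Th hs θ M e), fun x y => ?_, fun b x => ?_, ?_, ?_⟩
    · exact (congrArg _ (Th_add hs θ x y)).trans (map_add _ _ _)
    · exact (congrArg _ (Th_smul hs θ b x)).trans (map_smul _ _ _)
    · intro x y hxy
      have h1 := (EX.zeroEquiv A M W).symm.injective hxy
      rw [← sub_eq_zero]
      apply Th_inj hs θ hvan
      have := Th_add hs θ (x - y) y
      rw [sub_add_cancel, h1] at this
      exact left_eq_add.1 (this.trans (add_comm _ _))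
    · exact (EX.zeroEquiv A M W).symm.surjective.comp (Th_surj hs θ hvan)
  | succ i ih =>
    intro M _ _ _ _ _
    obtain ⟨n, π, hπ⟩ := Module.Finite.exists_fin' A M
    obtain ⟨δ, h1, h2, h3⟩ := EX.les B ((LinearMap.ker π).subtype.restrictScalars B)
      (π.restrictScalars B) (Submodule.subtype_injective _) hπ (LinearMap.exact_subtype_ker_map π)
    obtain ⟨δ', h1', h2', h3'⟩ := EX.les W ((LinearMap.ker π).subtype)
      π (Submodule.subtype_injective _) hπ (LinearMap.exact_subtype_ker_map π)
    have hd : Function.Surjective (δ (c+i)) := fun e => by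
      have := free_van hvan (n := n) (c + i + 1) (by omega)
      exact (h3 (c+i) e).1 (Subsingleton.elim _ _)
    have hd' : Function.Surjective (δ' i) := fun e => by
      have := EX.subsingleton_projective (R := A) (M := Fin n → A) (N := W) i
      exact (h3' i e).1 (Subsingleton.elim _ _)
    cases i with
    | zero =>
      refine induced (δ c) (δ' 0) hd hd'
        (fun e => (EX.zeroEquiv A _ W).symm (Th hs θ _ e)) (fun x y => ?_) (fun b x => ?_) ?_ ?_
      · rw [Th_add, map_add]
      · rw [Th_smul, map_smul]
      · exact (EX.zeroEquiv A _ W).symm.surjective.comp (Th_surj hs θ hvan)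
      · intro x
        rw [h2 c x, h2' 0]
        constructor
        · rintro ⟨e, rfl⟩
          refine ⟨(EX.zeroEquiv A _ W).symm (Th hs θ _ e), ?_⟩
          rw [EX.pre_zeroEquiv_symm, Th_nat]
        · rintro ⟨e, he⟩
          obtain ⟨e1, he1⟩ := Th_free_surj hs θ (EX.zeroEquiv A _ W e)
          refine ⟨e1, ?_⟩
          rw [← sub_eq_zero]
          apply Th_inj hs θ hvan
          rw [sub_eq_add_neg, ← neg_one_smul B, Th_add, Th_smul, Th_nat, he1]
          have he2 : Th hs θ _ x = (EX.zeroEquiv A _ W e) ∘ₗ (LinearMap.ker π).subtype := by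
            have := congrArg (EX.zeroEquiv A _ W) he
            rw [EX.zeroEquiv_pre, LinearEquiv.apply_symm_apply] at this
            exact this.symm
          rw [he2]
          simp
    | succ i =>
      obtain ⟨φ, ha, hb, hφ⟩ := ih (LinearMap.ker π)
      have hφ0 : φ 0 = 0 := by
        have := ha 0 0
        rw [add_zero] at this
        exact left_eq_add.1 this
      refine induced (δ (c+(i+1))) (δ' (i+1)) hd hd' φ ha hb hφ.2 ?_
      intro x
      rw [h2, h2']
      constructor
      · rintro ⟨e, rfl⟩
        have := free_van hvan (n := n) (c + (i+1)) (by omega)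
        rw [Subsingleton.elim e 0, map_zero, hφ0]
        exact ⟨0, map_zero _⟩
      · rintro ⟨e, he⟩
        have := EX.subsingleton_projective (R := A) (M := Fin n → A) (N := W) i
        rw [Subsingleton.elim e 0, map_zero, ← hφ0] at he
        rw [← hφ.1 he]
        exact ⟨0, map_zero _⟩

end
end DS
end

section
open IsLocalRing RingTheory.Sequence

/-- If the rank one module `W` (dual of `A`) surjects onto `A`, then `A` is Gorenstein. -/
theorem gor_of_surj {B A : Type} [CommRing B] [CommRing A] [IsLocalRing B] [IsLocalRing A]
    [IsNoetherianRing B] [Algebra B A] (hs : Function.Surjective (algebraMap B A)) {N c : ℕ}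
    (hB : ExtSelf B (B ⧸ maximalIdeal B) N) (hN : ringKrullDim B = N)
    (hvan : ∀ i, i ≠ c → Subsingleton (EX B A B i))
    {W : Type} [AddCommGroup W] [Module A W] [Module B W] [IsScalarTower B A W]
    (θ : W ≃ₗ[B] EX B A B c) (f : W →ₗ[A] A) (hf : Function.Surjective f) :
    IsGorensteinLocalRing A := by
  have : IsNoetherianRing A := isNoetherianRing_of_surjective B A _ hs
  have hloc : IsLocalHom (algebraMap B A) := IsLocalHom.of_surjective _ hs
  obtain ⟨w, hw⟩ := hf 1
  let g : A →ₗ[A] W := LinearMap.toSpanSingleton A W w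
  have hfg : f ∘ₗ g = LinearMap.id := by ext; simp [g, hw]
  -- residue field comparison
  have eκ : (B ⧸ maximalIdeal B) ≃ₗ[B] (A ⧸ maximalIdeal A) := by
    let q : B →ₗ[B] (A ⧸ maximalIdeal A) := Algebra.linearMap B _
    have hq : Function.Surjective q := Ideal.Quotient.mk_surjective.comp hs
    refine (Submodule.quotEquivOfEq _ _ ?_).trans (q.quotKerEquivOfSurjective hq)
    ext b
    have : q b = Ideal.Quotient.mk (maximalIdeal A) (algebraMap B A b) := rfl
    rw [LinearMap.mem_ker, this, Ideal.Quotient.eq_zero_iff_mem]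
    simp only [mem_maximalIdeal, mem_nonunits_iff, isUnit_map_iff]
  have hκ : ExtSelf B (A ⧸ maximalIdeal A) N := extSelf_congr eκ hB
  -- Ext into A embeds into Ext into W
  have hpost : ∀ i, Function.Injective (EX.post (A ⧸ maximalIdeal A) g i) := by
    intro i x y hxy
    have := congrArg (EX.post (A ⧸ maximalIdeal A) f i) hxy
    rwa [← EX.post_comp, ← EX.post_comp, hfg, EX.post_id, EX.post_id] at this
  have hz : ∀ i, c + i ≠ N → Subsingleton (EX A (A ⧸ maximalIdeal A) A i) := by
    intro i hi
    obtain ⟨ψ, -, -, hψ⟩ := DS.ext_compare hs θ hvan i (A ⧸ maximalIdeal A)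
    have := hκ.1 (c + i) hi
    have : Subsingleton (EX A (A ⧸ maximalIdeal A) W i) := hψ.2.subsingleton
    exact (hpost i).subsingleton
  -- dimension
  have hI : RingHom.ker (algebraMap B A) ≠ ⊤ := RingHom.ker_ne_top _
  have eI : (B ⧸ RingHom.ker (algebraMap B A)) ≃ₗ[B] A :=
    (Ideal.quotientKerAlgEquivOfSurjective (f := Algebra.ofId B A) hs).toLinearEquiv
  obtain ⟨rs, hl, hm, hr⟩ := rees (RingHom.ker (algebraMap B A)) hI c (fun i hi => by
    have := hvan i hi.ne
    exact (EX.congrLeft B eI i).symm.toEquiv.subsingleton)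
  have hdim1 := ringKrullDim_add_length_eq_ringKrullDim_of_isRegular rs hr
  have hle : ringKrullDim A ≤ ringKrullDim (B ⧸ Ideal.ofList rs) := by
    refine ringKrullDim_le_of_surjective (Ideal.Quotient.lift (Ideal.ofList rs) (algebraMap B A) ?_) ?_
    · intro b hb
      have : Ideal.ofList rs ≤ RingHom.ker (algebraMap B A) := Ideal.span_le.2 hm
      exact this hb
    · exact Ideal.Quotient.lift_surjective_of_surjective _ _ hs
  have hle2 : ringKrullDim A + c ≤ N := by
    rw [← hN, ← hdim1, hl]
    exact add_le_add_left hle _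
  obtain ⟨t, ht⟩ : ∃ t : ℕ, ringKrullDim A = t := by
    have hfin := finiteRingKrullDim_iff_ne_bot_and_top.1 (inferInstance : FiniteRingKrullDim A)
    obtain ⟨t, ht⟩ := WithBot.ne_bot_iff_exists.1 hfin.1
    cases t with
    | top => exact absurd ht.symm hfin.2
    | coe t => exact ⟨t, ht.symm⟩
  have htc : t + c ≤ N := by rw [ht] at hle2; exact_mod_cast hle2
  have hlen : ∀ t', (∀ i < t', Subsingleton (EX A (A ⧸ maximalIdeal A) A i)) → t' ≤ t := by
    intro t' h
    obtain ⟨rs, hl, hm, hr⟩ := rees (maximalIdeal A) (maximalIdeal.isMaximal A).ne_top t' h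
    have h2 := ringKrullDim_add_length_eq_ringKrullDim_of_isRegular rs hr
    rw [ht, hl] at h2
    have : (0 : WithBot ℕ∞) ≤ ringKrullDim (A ⧸ Ideal.ofList rs) := by
      have : Nontrivial (A ⧸ Ideal.ofList rs) := Ideal.Quotient.nontrivial_iff.2 (by
        refine ne_top_of_le_ne_top (maximalIdeal.isMaximal A).ne_top (Ideal.span_le.2 hm))
      exact ringKrullDim_nonneg_of_nontrivial
    have h3 : (0 : WithBot ℕ∞) + t' ≤ t := by
      rw [← h2]; exact add_le_add_left this _
    rw [zero_add] at h3
    exact_mod_cast h3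
  have htN : t + c = N := by
    have := hlen (N - c) (fun i hi => hz i (by omega))
    omega
  have hne : ¬ Subsingleton (EX A (A ⧸ maximalIdeal A) A t) := by
    intro h
    have := hlen (t + 1) (fun i hi => by
      rcases Nat.lt_succ_iff_lt_or_eq.1 hi with h' | h'
      · exact hz i (by omega)
      · rw [h']; exact h)
    omega
  have htop : Nonempty (EX A (A ⧸ maximalIdeal A) A t ≃ₗ[A] (A ⧸ maximalIdeal A)) := by
    obtain ⟨ψ, h1, h2, hψ⟩ := DS.ext_compare hs θ hvan t (A ⧸ maximalIdeal A)
    obtain ⟨e⟩ := hκ.2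
    obtain rfl : N = c + t := by omega
    let Ψ := Equiv.ofBijective ψ hψ
    have hΨ : ∀ z, ψ (Ψ.symm z) = z := fun z => Ψ.apply_symm_apply z
    let χ : EX A (A ⧸ maximalIdeal A) A t →ₗ[A] (A ⧸ maximalIdeal A) :=
      { toFun := fun x => e (Ψ.symm (EX.post _ g t x))
        map_add' := fun x y => by
          rw [← map_add]
          congr 1
          rw [Equiv.symm_apply_eq]
          change _ = ψ _
          rw [h1, hΨ, hΨ, map_add]
        map_smul' := fun a x => by
          obtain ⟨b, rfl⟩ := hs a
          rw [RingHom.id_apply, algebraMap_smul A b (e _), ← map_smul]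
          congr 1
          rw [Equiv.symm_apply_eq]
          change _ = ψ _
          rw [h2, hΨ, map_smul] }
    have hχ : Function.Injective χ := fun x y hxy => hpost t (Ψ.symm.injective (e.injective hxy))
    have : IsSimpleModule A (A ⧸ maximalIdeal A) :=
      isSimpleModule_iff_quot_maximal.2 ⟨_, inferInstance, ⟨LinearEquiv.refl _ _⟩⟩
    have hχ0 : χ ≠ 0 := by
      intro h0
      apply hne
      refine ⟨fun x y => hχ ?_⟩
      rw [h0]; rfl
    exact ⟨LinearEquiv.ofBijective χ ⟨hχ, LinearMap.surjective_of_ne_zero hχ0⟩⟩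
  refine ⟨inferInstance, fun i => ?_⟩
  obtain ⟨e⟩ := extMod_bridge A (A ⧸ maximalIdeal A) A i
  rw [ht]
  constructor
  · intro h
    have h' : i = t := Nat.cast_injective (R := WithBot ℕ∞) h
    subst h'
    obtain ⟨f⟩ := htop
    exact ⟨e.trans f⟩
  · intro h
    have := hz i (by rintro rfl; apply h; have : i = t := by omega
                     rw [this]; rfl)
    exact e.toEquiv.subsingleton
end

section
set_option linter.unusedSectionVars false

namespace LC
section
variable {S S' : Type} [CommRing S] [CommRing S'] [Algebra S S'] (T : Submonoid S)

/-- A map which behaves like a localization map of modules. -/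
structure LMap (X X' : Type) [AddCommGroup X] [Module S X] [AddCommGroup X'] [Module S' X']
    (l : X → X') : Prop where
  add : ∀ x y, l (x + y) = l x + l y
  smul : ∀ (s : S) x, l (s • x) = algebraMap S S' s • l x
  ker : ∀ x, l x = 0 → ∃ t ∈ T, t • x = 0
  surj : ∀ x', ∃ x, ∃ t ∈ T, algebraMap S S' t • x' = l x

variable {T}
theorem LMap.map_zero {X X' : Type} [AddCommGroup X] [Module S X] [AddCommGroup X'] [Module S' X']
    {l : X → X'} (h : LMap (S' := S') T X X' l) : l 0 = 0 := by
  have := h.smul 0 0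
  rwa [zero_smul, _root_.map_zero, zero_smul] at this

theorem LMap.map_sub {X X' : Type} [AddCommGroup X] [Module S X] [AddCommGroup X'] [Module S' X']
    {l : X → X'} (h : LMap (S' := S') T X X' l) (x y : X) : l (x - y) = l x - l y := by
  have := h.add (x - y) y
  rw [sub_add_cancel] at this
  rw [this, add_sub_cancel_right]

theorem induced {X X' Y Y' : Type} [AddCommGroup X] [Module S X] [AddCommGroup Y] [Module S Y]
    [AddCommGroup X'] [Module S' X'] [AddCommGroup Y'] [Module S' Y'] (d : X →ₗ[S] Y)
    (d' : X' →ₗ[S'] Y') (hd : Function.Surjective d) (hd' : Function.Surjective d')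
    {l : X → X'} (hl : LMap (S' := S') T X X' l) (hk : ∀ x, d x = 0 → d' (l x) = 0)
    (hk' : ∀ x, d' (l x) = 0 → ∃ t ∈ T, d (t • x) = 0) :
    ∃ m : Y → Y', LMap (S' := S') T Y Y' m ∧ ∀ x, m (d x) = d' (l x) := by
  choose s hss using hd
  have key : ∀ x, d' (l (s (d x))) = d' (l x) := fun x => by
    rw [← sub_eq_zero, ← map_sub, ← hl.map_sub]
    apply hk
    rw [map_sub, hss, sub_self]
  refine ⟨fun y => d' (l (s y)), ⟨fun x y => ?_, fun b x => ?_, fun y hy => ?_, fun y' => ?_⟩, key⟩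
  · have := key (s x + s y)
    rw [map_add, hss, hss] at this
    change d' (l (s (x + y))) = _
    rw [this, hl.add, map_add]
  · have := key (b • s x)
    rw [map_smul, hss] at this
    change d' (l (s (b • x))) = _
    rw [this, hl.smul, map_smul]
  · obtain ⟨t, ht, h⟩ := hk' _ hy
    refine ⟨t, ht, ?_⟩
    rwa [map_smul, hss] at h
  · obtain ⟨x', rfl⟩ := hd' y'
    obtain ⟨x, t, ht, h⟩ := hl.surj x'
    refine ⟨d x, t, ht, ?_⟩
    rw [← map_smul, h, key]
end

section
variable {S : Type} [CommRing S] [IsNoetherianRing S] (T : Submonoid S)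

theorem ses_kernel_loc {n : ℕ} {M M' : Type} [AddCommGroup M] [Module S M] [AddCommGroup M']
    [Module S M'] [Module (Localization T) M'] [IsScalarTower S (Localization T) M']
    (f : M →ₗ[S] M') [IsLocalizedModule T f] (π : (Fin n → S) →ₗ[S] M) (hπ : Function.Surjective π) :
    let K := LinearMap.ker π
    let fF : (Fin n → S) →ₗ[S] (Fin n → Localization T) :=
      .pi fun i ↦ Algebra.linearMap S (Localization T) ∘ₗ .proj i
    let ι' := IsLocalizedModule.mapExtendScalars T (LocalizedModule.mkLinearMap T K) fF
      (Localization T) K.subtype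
    let π' := IsLocalizedModule.mapExtendScalars T fF f (Localization T) π
    Function.Injective ι' ∧ Function.Surjective π' ∧ Function.Exact ι' π' := by
  intro K fF ι' π'
  refine ⟨?_, ?_, ?_⟩
  · exact IsLocalizedModule.map_injective T (LocalizedModule.mkLinearMap T K) fF K.subtype K.subtype_injective
  · exact IsLocalizedModule.map_surjective T fF f π hπ
  · exact IsLocalizedModule.map_exact T (LocalizedModule.mkLinearMap T K) fF f K.subtype π
      (LinearMap.exact_subtype_ker_map π)

/-- Degree zero localization map. -/
noncomputable def L0 {M M' : Type} [AddCommGroup M] [Module S M] [AddCommGroup M']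
    [Module S M'] [Module (Localization T) M'] [IsScalarTower S (Localization T) M']
    (f : M →ₗ[S] M') [IsLocalizedModule T f] (e : EX S M S 0) : EX (Localization T) M' (Localization T) 0 :=
  (EX.zeroEquiv _ _ _).symm (IsLocalizedModule.mapExtendScalars T f
    (Algebra.linearMap S (Localization T)) (Localization T) (EX.zeroEquiv _ _ _ e))

theorem L0_LMap {M M' : Type} [AddCommGroup M] [Module S M] [Module.Finite S M] [AddCommGroup M']
    [Module S M'] [Module (Localization T) M'] [IsScalarTower S (Localization T) M']
    (f : M →ₗ[S] M') [IsLocalizedModule T f] : LMap T (S' := Localization T) _ _ (L0 T f) := by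
  have : Module.FinitePresentation S M := Module.finitePresentation_of_finite S M
  set φ := IsLocalizedModule.mapExtendScalars T f
    (Algebra.linearMap S (Localization T)) (Localization T) with hφ
  have hloc : IsLocalizedModule T φ := inferInstance
  refine ⟨fun x y => ?_, fun s x => ?_, fun x hx => ?_, fun x => ?_⟩
  · simp only [L0, map_add]
  · rw [L0, L0, ← map_smul, map_smul (EX.zeroEquiv S M S), map_smul, algebraMap_smul]
  · rw [L0, LinearEquiv.map_eq_zero_iff] at hx
    obtain ⟨t, ht⟩ := (IsLocalizedModule.eq_zero_iff T φ).1 hx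
    refine ⟨t, t.2, (EX.zeroEquiv S M S).injective ?_⟩
    rw [map_smul, map_zero]; exact ht
  · obtain ⟨⟨y, t⟩, hy⟩ := IsLocalizedModule.surj T φ (EX.zeroEquiv _ _ _ x)
    refine ⟨(EX.zeroEquiv _ _ _).symm y, t, t.2, ?_⟩
    apply (EX.zeroEquiv _ _ _).injective
    rw [L0, LinearEquiv.apply_symm_apply, LinearEquiv.apply_symm_apply, map_smul, algebraMap_smul]
    exact hy

theorem L0_nat {M M' F F' : Type} [AddCommGroup M] [Module S M] [AddCommGroup M']
    [Module S M'] [Module (Localization T) M'] [IsScalarTower S (Localization T) M']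
    (f : M →ₗ[S] M') [IsLocalizedModule T f]
    [AddCommGroup F] [Module S F] [AddCommGroup F']
    [Module S F'] [Module (Localization T) F'] [IsScalarTower S (Localization T) F']
    (g : F →ₗ[S] F') [IsLocalizedModule T g] (h : M →ₗ[S] F) (e : EX S F S 0) :
    L0 T f (EX.pre S h 0 e) = EX.pre _ (IsLocalizedModule.mapExtendScalars T f g (Localization T) h) 0
      (L0 T g e) := by
  rw [L0, L0, EX.pre_zeroEquiv_symm, EX.zeroEquiv_pre]
  congr 1
  apply LinearMap.restrictScalars_injective S
  apply IsLocalizedModule.linearMap_ext T f (Algebra.linearMap S (Localization T))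
  ext x
  simp

theorem ext_loc (i : ℕ) : ∀ (M M' : Type) [AddCommGroup M] [Module S M] [Module.Finite S M]
    [AddCommGroup M'] [Module S M'] [Module (Localization T) M']
    [IsScalarTower S (Localization T) M'] (f : M →ₗ[S] M') [IsLocalizedModule T f],
    ∃ l, LMap T (S' := Localization T) (EX S M S i) (EX (Localization T) M' (Localization T) i) l := by
  induction i with
  | zero =>
    intro M M' _ _ _ _ _ _ _ f _
    exact ⟨L0 T f, L0_LMap T f⟩
  | succ i ih =>
    intro M M' _ _ _ _ _ _ _ f _
    obtain ⟨n, π, hπ⟩ := Module.Finite.exists_fin' S M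
    obtain ⟨hi', hp', he'⟩ := ses_kernel_loc T f π hπ
    set K := LinearMap.ker π
    set fF : (Fin n → S) →ₗ[S] (Fin n → Localization T) :=
      .pi fun i ↦ Algebra.linearMap S (Localization T) ∘ₗ .proj i
    set ι' := IsLocalizedModule.mapExtendScalars T (LocalizedModule.mkLinearMap T K) fF
      (Localization T) K.subtype
    set π' := IsLocalizedModule.mapExtendScalars T fF f (Localization T) π
    obtain ⟨δ, h1, h2, h3⟩ := EX.les S K.subtype π K.subtype_injective hπ (LinearMap.exact_subtype_ker_map π)
    obtain ⟨δ', h1', h2', h3'⟩ :=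
      EX.les (R := Localization T) (M := LocalizedModule T K) (M' := Fin n → Localization T)
        (Localization T) ι' π' hi' hp' he'
    have hd : Function.Surjective (δ i) := fun e => by
      have := EX.subsingleton_projective (R := S) (M := Fin n → S) (N := S) i
      exact (h3 i e).1 (Subsingleton.elim _ _)
    have hd' : Function.Surjective (δ' i) := fun e => by
      have := EX.subsingleton_projective (R := Localization T) (M := Fin n → Localization T)
        (N := Localization T) i
      exact (h3' i e).1 (Subsingleton.elim _ _)
    cases i with
    | zero =>
      have hK := L0_LMap T (M := K) (M' := LocalizedModule T K) (LocalizedModule.mkLinearMap T K)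
      have hF := L0_LMap T fF
      obtain ⟨m, hm, -⟩ := induced (δ 0) (δ' 0) hd hd' hK (fun x hx => by
        obtain ⟨y, rfl⟩ := (h2 0 x).1 hx
        rw [h2' 0, L0_nat T (M := K) (M' := LocalizedModule T K) _ fF]
        exact ⟨_, rfl⟩) (fun x hx => by
        obtain ⟨y', hy'⟩ := (h2' 0 _).1 hx
        obtain ⟨y, t, ht, hy⟩ := hF.surj y'
        have h4 : L0 T (M := K) (M' := LocalizedModule T K) (LocalizedModule.mkLinearMap T K) (t • x - EX.pre S K.subtype 0 y) = 0 := by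
          rw [hK.map_sub, hK.smul, ← hy', L0_nat T (M := K) (M' := LocalizedModule T K) _ fF, ← hy, map_smul, sub_self]
        obtain ⟨t2, ht2, h5⟩ := hK.ker _ h4
        refine ⟨t2 * t, T.mul_mem ht2 ht, ?_⟩
        rw [h2 0]
        refine ⟨t2 • y, ?_⟩
        rw [smul_sub, sub_eq_zero] at h5
        rw [map_smul, mul_smul, h5])
      exact ⟨m, hm⟩
    | succ i =>
      obtain ⟨l, hl⟩ := ih K (LocalizedModule T K) (LocalizedModule.mkLinearMap T K)
      obtain ⟨m, hm, -⟩ := induced (δ (i+1)) (δ' (i+1)) hd hd' hl (fun x hx => by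
        obtain ⟨y, rfl⟩ := (h2 _ x).1 hx
        have := EX.subsingleton_projective (R := S) (M := Fin n → S) (N := S) i
        rw [Subsingleton.elim y 0, map_zero, hl.map_zero, map_zero]) (fun x hx => by
        obtain ⟨y', hy'⟩ := (h2' _ _).1 hx
        have := EX.subsingleton_projective (R := Localization T) (M := Fin n → Localization T)
          (N := Localization T) i
        rw [Subsingleton.elim y' 0, map_zero] at hy'
        obtain ⟨t, ht, h⟩ := hl.ker _ hy'.symm
        exact ⟨t, ht, by rw [h, map_zero]⟩)
      exact ⟨m, hm⟩

end
end LC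
end

section
open IsLocalRing RingTheory.Sequence
set_option linter.unusedSectionVars false

set_option linter.style.haveILetI false
namespace LS
section
variable {S R : Type} [CommRing S] [CommRing R] [Algebra S R] (𝔭 : Ideal R) [𝔭.IsPrime]

/-- The pulled back prime. -/
abbrev P (S : Type) {R : Type} [CommRing S] [CommRing R] [Algebra S R] (𝔭 : Ideal R) : Ideal S :=
  𝔭.comap (algebraMap S R)
/-- Localized base ring. -/
abbrev B (S : Type) {R : Type} [CommRing S] [CommRing R] [Algebra S R] (𝔭 : Ideal R) [𝔭.IsPrime] :
    Type := Localization (P S 𝔭).primeCompl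
/-- Localized ring. -/
abbrev A {R : Type} [CommRing R] (𝔭 : Ideal R) [𝔭.IsPrime] : Type := Localization.AtPrime 𝔭

/-- The local algebra. -/
@[reducible]
noncomputable def locAlg : Algebra (B S 𝔭) (A 𝔭) :=
  (Localization.localRingHom (P S 𝔭) 𝔭 (algebraMap S R) rfl).toAlgebra

attribute [local instance] locAlg

theorem locTower : IsScalarTower S (B S 𝔭) (A 𝔭) :=
  IsScalarTower.of_algebraMap_eq fun x ↦
    ((Localization.localRingHom_to_map (P S 𝔭) 𝔭 (algebraMap S R) rfl x).trans
      (IsScalarTower.algebraMap_apply S R (A 𝔭) x).symm).symm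

attribute [local instance] locTower

theorem submonoid_eq (hs : Function.Surjective (algebraMap S R)) :
    Algebra.algebraMapSubmonoid R (P S 𝔭).primeCompl = 𝔭.primeCompl := by
  ext r
  constructor
  · rintro ⟨s, hs, rfl⟩
    exact hs
  · intro h
    obtain ⟨s, rfl⟩ := hs r
    exact ⟨s, h, rfl⟩

theorem isLoc (hs : Function.Surjective (algebraMap S R)) :
    IsLocalizedModule (P S 𝔭).primeCompl (IsScalarTower.toAlgHom S R (A 𝔭)).toLinearMap := by
  rw [isLocalizedModule_iff_isLocalization, submonoid_eq 𝔭 hs]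
  infer_instance

theorem locSurj (hs : Function.Surjective (algebraMap S R)) :
    Function.Surjective (algebraMap (B S 𝔭) (A 𝔭)) := by
  intro a
  obtain ⟨⟨r, t⟩, h⟩ := IsLocalization.surj 𝔭.primeCompl a
  obtain ⟨r, rfl⟩ := hs r
  obtain ⟨t, ht⟩ := t
  obtain ⟨t, rfl⟩ := hs t
  refine ⟨IsLocalization.mk' (B S 𝔭) r (⟨t, ht⟩ : (P S 𝔭).primeCompl), ?_⟩
  have hu : IsUnit (algebraMap R (A 𝔭) (algebraMap S R t)) := IsLocalization.map_units _ (⟨_, ht⟩ : 𝔭.primeCompl)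
  rw [← hu.mul_left_inj]
  refine Eq.trans ?_ h.symm
  change _ * _ = algebraMap R (A 𝔭) (algebraMap S R r)
  rw [← IsScalarTower.algebraMap_apply S R, ← IsScalarTower.algebraMap_apply S R,
    IsScalarTower.algebraMap_apply S (B S 𝔭) (A 𝔭) t, ← map_mul, IsLocalization.mk'_spec,
    ← IsScalarTower.algebraMap_apply]

variable [IsNoetherianRing S]

theorem finR (hs : Function.Surjective (algebraMap S R)) : Module.Finite S R :=
  Module.Finite.of_surjective (Algebra.linearMap S R) hs

theorem exLoc (hs : Function.Surjective (algebraMap S R)) (i : ℕ) :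
    ∃ l, LC.LMap (P S 𝔭).primeCompl (S' := B S 𝔭) (EX S R S i) (EX (B S 𝔭) (A 𝔭) (B S 𝔭) i) l := by
  have := finR (S := S) hs
  have := isLoc 𝔭 hs
  exact LC.ext_loc _ i R (A 𝔭) (IsScalarTower.toAlgHom S R (A 𝔭)).toLinearMap

theorem van_iff (hs : Function.Surjective (algebraMap S R)) (i : ℕ) :
    Subsingleton (EX (B S 𝔭) (A 𝔭) (B S 𝔭) i) ↔
      ∀ e : EX S R S i, ∃ t ∈ (P S 𝔭).primeCompl, t • e = 0 := by
  obtain ⟨l, hl⟩ := exLoc 𝔭 hs i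
  constructor
  · intro h e
    exact hl.ker e (Subsingleton.elim _ _)
  · intro h
    have : ∀ x' : EX (B S 𝔭) (A 𝔭) (B S 𝔭) i, x' = 0 := by
      intro x'
      obtain ⟨x, t, ht, hx⟩ := hl.surj x'
      obtain ⟨t2, ht2, hx2⟩ := h x
      have h3 := congrArg l hx2
      rw [hl.smul, hl.map_zero, ← hx, smul_smul, ← map_mul] at h3
      have hu : IsUnit (algebraMap S (B S 𝔭) (t2 * t)) :=
        IsLocalization.map_units _ (⟨_, mul_mem ht2 ht⟩ : (P S 𝔭).primeCompl)
      exact (hu.smul_eq_zero).1 h3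
    exact ⟨fun x y => (this x).trans (this y).symm⟩

/-- L6 at the maximal ideal. -/
theorem van_max (hs : Function.Surjective (algebraMap S R)) {N d : ℕ}
    (hB : ExtSelf (B S 𝔭) (B S 𝔭 ⧸ maximalIdeal (B S 𝔭)) N)
    (hCM : ∀ i < d, Subsingleton (EX R (R ⧸ 𝔭) R i)) (hd : ringKrullDim (A 𝔭) ≤ d)
    (i : ℕ) (hi : i + d ≠ N) : Subsingleton (EX (B S 𝔭) (A 𝔭) (B S 𝔭) i) := by
  have : IsNoetherianRing R := isNoetherianRing_of_surjective S R _ hs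
  obtain ⟨rs, hl, hm, hr⟩ := rees 𝔭 (Ideal.IsPrime.ne_top inferInstance) d hCM
  have hr' := hr.1.isRegular_of_isLocalization_of_mem (A 𝔭) 𝔭 hm
  obtain ⟨rs', h1, h2, h3, h4, -⟩ := lift_list (locSurj 𝔭 hs) (rs.map (algebraMap R (A 𝔭))) (by
    intro r h
    obtain ⟨r, h', rfl⟩ := List.mem_map.1 h
    exact (IsLocalization.AtPrime.to_map_mem_maximal_iff (A 𝔭) 𝔭 r).2 (hm r h')) hr'.1
    (dim_quot_le _ hr' hd (by simpa using hl))
  have := finR (S := B S 𝔭) (locSurj 𝔭 hs)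
  exact ext_vanish hB rs' (A 𝔭) h2 h3 h4 i (by rw [h1, List.length_map, hl]; exact hi)

theorem van_prime (hs : Function.Surjective (algebraMap S R)) (𝔮 : Ideal R) [𝔮.IsPrime] (h : 𝔮 ≤ 𝔭)
    (i : ℕ) (hi : Subsingleton (EX (B S 𝔭) (A 𝔭) (B S 𝔭) i)) :
    Subsingleton (EX (B S 𝔮) (A 𝔮) (B S 𝔮) i) := by
  rw [van_iff 𝔮 hs]
  rw [van_iff 𝔭 hs] at hi
  intro e
  obtain ⟨t, ht, h1⟩ := hi e
  exact ⟨t, fun h2 => ht (h h2), h1⟩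

variable {ω : Type} [AddCommGroup ω] [Module R ω] [Module S ω] [IsScalarTower S R ω]

/-- P1, forward. -/
theorem gor_fwd (hs : Function.Surjective (algebraMap S R)) {N c : ℕ}
    (hB : ExtSelf (B S 𝔭) (B S 𝔭 ⧸ maximalIdeal (B S 𝔭)) N) (hN : ringKrullDim (B S 𝔭) = N)
    (hvan : ∀ i, i ≠ c → Subsingleton (EX (B S 𝔭) (A 𝔭) (B S 𝔭) i))
    (e : ω ≃ₗ[S] EX S R S c) (hA : IsGorensteinLocalRing (A 𝔭)) :
    (∃ t : ℕ, ringKrullDim (A 𝔭) = t ∧ c + t = N) ∧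
    ∃ g : ω, (∀ m : ω, ∃ s ∉ 𝔭, ∃ r : R, s • m = r • g) ∧ 
      (∀ r : R, r • g = 0 → ∃ s ∉ 𝔭, s * r = 0) := by
  have hsl := locSurj 𝔭 hs
  have : IsNoetherianRing (A 𝔭) := hA.1
  obtain ⟨t, ht⟩ : ∃ t : ℕ, ringKrullDim (A 𝔭) = t := by
    have hfin := finiteRingKrullDim_iff_ne_bot_and_top.1 (inferInstance : FiniteRingKrullDim (A 𝔭))
    obtain ⟨t, ht⟩ := WithBot.ne_bot_iff_exists.1 hfin.1
    cases t with
    | top => exact absurd ht.symm hfin.2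
    | coe t => exact ⟨t, ht.symm⟩
  have htN : t ≤ N := by
    have := ringKrullDim_le_of_surjective _ hsl
    rw [hN, ht] at this
    exact_mod_cast this
  obtain ⟨h1, h2⟩ := ext_of_gor hsl hB ht hA
  have hc : c + t = N := by
    by_contra hne
    have h3 := hvan (N - t) (by omega)
    obtain ⟨γ⟩ := h2 (N - t) (by omega)
    have : Subsingleton (A 𝔭) := γ.symm.toEquiv.subsingleton
    exact not_subsingleton _ this
  refine ⟨⟨t, ht, hc⟩, ?_⟩
  obtain ⟨γ⟩ := h2 c hc
  obtain ⟨l, hl⟩ := exLoc 𝔭 hs c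
  obtain ⟨x, t0, ht0, hx⟩ := hl.surj (γ.symm 1)
  have hγ : ∀ (s : S) y, γ (l (s • y)) = algebraMap R (A 𝔭) (algebraMap S R s) * γ (l y) := by
    intro s y
    rw [hl.smul, map_smul, Algebra.smul_def, ← IsScalarTower.algebraMap_apply,
      ← IsScalarTower.algebraMap_apply]
  have hγx : γ (l x) = algebraMap R (A 𝔭) (algebraMap S R t0) := by
    rw [← hx, map_smul, γ.apply_symm_apply, Algebra.smul_def, ← IsScalarTower.algebraMap_apply,
      ← IsScalarTower.algebraMap_apply, mul_one]
  refine ⟨e.symm x, fun m => ?_, fun r hr => ?_⟩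
  · obtain ⟨⟨r, s⟩, h⟩ := IsLocalization.surj 𝔭.primeCompl (γ (l (e m)))
    obtain ⟨r, rfl⟩ := hs r
    obtain ⟨s, hs'⟩ := s
    obtain ⟨s, rfl⟩ := hs s
    simp only at h
    have h5 : l ((t0 * s) • e m - r • x) = 0 := by
      apply γ.injective
      rw [hl.map_sub, map_sub, map_zero, hγ, hγ, hγx, ← h, map_mul, map_mul]
      ring
    obtain ⟨t1, ht1, h6⟩ := hl.ker _ h5
    rw [smul_sub, sub_eq_zero, smul_smul, smul_smul] at h6
    refine ⟨algebraMap S R (t1 * (t0 * s)), ?_, algebraMap S R (t1 * r), ?_⟩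
    · rw [map_mul, map_mul]
      exact 𝔭.primeCompl.mul_mem ht1 (𝔭.primeCompl.mul_mem ht0 hs')
    · rw [algebraMap_smul, algebraMap_smul]
      apply e.injective
      rw [map_smul, map_smul, e.apply_symm_apply, h6]
  · obtain ⟨r, rfl⟩ := hs r
    rw [algebraMap_smul] at hr
    have h7 : r • x = 0 := by
      have := congrArg e hr
      rwa [map_smul, e.apply_symm_apply, map_zero] at this
    have h8 := hγ r x
    rw [h7, hl.map_zero, map_zero, hγx, ← map_mul, eq_comm, ← map_zero (algebraMap R (A 𝔭)),
      IsLocalization.eq_iff_exists 𝔭.primeCompl] at h8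
    obtain ⟨s, hs2⟩ := h8
    refine ⟨s * algebraMap S R t0, 𝔭.primeCompl.mul_mem s.2 ht0, ?_⟩
    rw [mul_zero] at hs2
    rw [← hs2]; ring

/-- Localized module, as a type of its own. -/
def WW (ω : Type) [AddCommGroup ω] [Module R ω] : Type := LocalizedModule 𝔭.primeCompl ω

noncomputable instance (ω : Type) [AddCommGroup ω] [Module R ω] : AddCommGroup (WW 𝔭 ω) :=
  inferInstanceAs (AddCommGroup (LocalizedModule 𝔭.primeCompl ω))
noncomputable instance (ω : Type) [AddCommGroup ω] [Module R ω] : Module (A 𝔭) (WW 𝔭 ω) :=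
  inferInstanceAs (Module (A 𝔭) (LocalizedModule 𝔭.primeCompl ω))
noncomputable instance (ω : Type) [AddCommGroup ω] [Module R ω] : Module R (WW 𝔭 ω) :=
  inferInstanceAs (Module R (LocalizedModule 𝔭.primeCompl ω))
instance (ω : Type) [AddCommGroup ω] [Module R ω] : IsScalarTower R (A 𝔭) (WW 𝔭 ω) :=
  inferInstanceAs (IsScalarTower R (A 𝔭) (LocalizedModule 𝔭.primeCompl ω))
/-- The localization map. -/
noncomputable def wmk (ω : Type) [AddCommGroup ω] [Module R ω] : ω →ₗ[R] WW 𝔭 ω :=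
  LocalizedModule.mkLinearMap 𝔭.primeCompl ω
instance (ω : Type) [AddCommGroup ω] [Module R ω] : IsLocalizedModule 𝔭.primeCompl (wmk 𝔭 ω) :=
  inferInstanceAs (IsLocalizedModule 𝔭.primeCompl (LocalizedModule.mkLinearMap 𝔭.primeCompl ω))

/-- B-module structure on localized module. -/
@[reducible]
noncomputable def locMod (ω : Type) [AddCommGroup ω] [Module R ω] :
    Module (B S 𝔭) (WW 𝔭 ω) :=
  Module.compHom _ (algebraMap (B S 𝔭) (A 𝔭))
attribute [local instance] locMod

theorem locModTower : IsScalarTower (B S 𝔭) (A 𝔭) (WW 𝔭 ω) :=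
  ⟨fun x y z => by
    rw [Algebra.smul_def, mul_smul]; rfl⟩
attribute [local instance] locModTower

theorem exW (hs : Function.Surjective (algebraMap S R)) {c : ℕ}
    (e : ω ≃ₗ[S] EX S R S c) :
    Nonempty (WW 𝔭 ω ≃ₗ[B S 𝔭] EX (B S 𝔭) (A 𝔭) (B S 𝔭) c) := by
  obtain ⟨l, hl⟩ := exLoc 𝔭 hs c
  set T := (P S 𝔭).primeCompl
  letI : Module S (EX (B S 𝔭) (A 𝔭) (B S 𝔭) c) := Module.compHom _ (algebraMap S (B S 𝔭))
  haveI : IsScalarTower S (B S 𝔭) (EX (B S 𝔭) (A 𝔭) (B S 𝔭) c) :=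
    ⟨fun x y z => by rw [Algebra.smul_def, mul_smul]; rfl⟩
  letI : Module S (WW 𝔭 ω) := Module.compHom _ (algebraMap S R)
  haveI : IsScalarTower S R (WW 𝔭 ω) :=
    ⟨fun x y z => by rw [Algebra.smul_def, mul_smul]; rfl⟩
  haveI : IsScalarTower S (A 𝔭) (WW 𝔭 ω) :=
    ⟨fun x y z => by
      rw [Algebra.smul_def, mul_smul, IsScalarTower.algebraMap_apply S R (A 𝔭), algebraMap_smul,
        algebraMap_smul]⟩
  haveI : IsScalarTower S (B S 𝔭) (WW 𝔭 ω) :=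
    ⟨fun x y z => by
      rw [← algebraMap_smul (A 𝔭) (x • y), ← algebraMap_smul (A 𝔭) y, Algebra.smul_def, map_mul,
        mul_smul, ← IsScalarTower.algebraMap_apply, algebraMap_smul]⟩
  let L : ω →ₗ[S] EX (B S 𝔭) (A 𝔭) (B S 𝔭) c :=
    { toFun := fun m => l (e m)
      map_add' := fun x y => by rw [map_add, hl.add]
      map_smul' := fun s x => by rw [map_smul, hl.smul]; rfl }
  have hu : ∀ t : T, IsUnit (algebraMap S (B S 𝔭) t) := fun t => IsLocalization.map_units _ t
  haveI h1 : IsLocalizedModule T L := by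
    refine ⟨fun t => ?_, fun y => ?_, fun {x y} hxy => ?_⟩
    · rw [Module.End.isUnit_iff]
      have : (fun y : EX (B S 𝔭) (A 𝔭) (B S 𝔭) c => algebraMap S (B S 𝔭) t • y).Bijective :=
        (MulAction.bijective (hu t).unit)
      exact this
    · obtain ⟨x, t, ht, h⟩ := hl.surj y
      refine ⟨⟨e.symm x, ⟨t, ht⟩⟩, ?_⟩
      change algebraMap S (B S 𝔭) t • y = l (e (e.symm x))
      rw [e.apply_symm_apply, h]
    · have : l (e x - e y) = 0 := by rw [hl.map_sub]; exact sub_eq_zero.2 hxy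
      obtain ⟨t, ht, h⟩ := hl.ker _ this
      refine ⟨⟨t, ht⟩, e.injective ?_⟩
      rw [← map_sub, ← map_smul, map_eq_zero_iff _ e.injective, smul_sub, sub_eq_zero] at h
      exact congrArg e h
  let q : ω →ₗ[S] WW 𝔭 ω :=
    (wmk 𝔭 ω).restrictScalars S
  haveI h2 : IsLocalizedModule T q := by
    have hT : ∀ t : T, algebraMap S R t ∈ 𝔭.primeCompl := fun t => t.2
    refine ⟨fun t => ?_, fun y => ?_, fun {x y} hxy => ?_⟩
    · rw [Module.End.isUnit_iff]
      have := (Module.End.isUnit_iff _).1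
        (IsLocalizedModule.map_units (wmk 𝔭 ω) ⟨_, hT t⟩)
      convert this using 1
      ext y
      exact (algebraMap_smul R (t : S) y).symm
    · obtain ⟨⟨x, t⟩, h⟩ := IsLocalizedModule.surj 𝔭.primeCompl (wmk 𝔭 ω) y
      obtain ⟨t, ht⟩ := t
      obtain ⟨t, rfl⟩ := hs t
      refine ⟨⟨x, ⟨t, ht⟩⟩, ?_⟩
      refine Eq.trans ?_ h
      exact (algebraMap_smul R t y).symm
    · obtain ⟨t, h⟩ := IsLocalizedModule.exists_of_eq (S := 𝔭.primeCompl) 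
        (f := wmk 𝔭 ω) hxy
      obtain ⟨t, ht⟩ := t
      obtain ⟨t, rfl⟩ := hs t
      refine ⟨⟨t, ht⟩, ?_⟩
      have h' : algebraMap S R t • x = algebraMap S R t • y := h
      rwa [algebraMap_smul, algebraMap_smul] at h'
  exact ⟨(IsLocalizedModule.linearEquiv T q L).extendScalarsOfIsLocalization T (B S 𝔭)⟩

/-- P1, backward. -/
theorem gor_bwd (hs : Function.Surjective (algebraMap S R)) {N c : ℕ}
    (hB : ExtSelf (B S 𝔭) (B S 𝔭 ⧸ maximalIdeal (B S 𝔭)) N) (hN : ringKrullDim (B S 𝔭) = N)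
    (hvan : ∀ i, i ≠ c → Subsingleton (EX (B S 𝔭) (A 𝔭) (B S 𝔭) i))
    (e : ω ≃ₗ[S] EX S R S c) (f : ω →ₗ[R] R) (m : ω) (hm : f m ∉ 𝔭) :
    IsGorensteinLocalRing (A 𝔭) := by
  obtain ⟨θ⟩ := exW 𝔭 hs e
  let F := IsLocalizedModule.mapExtendScalars 𝔭.primeCompl (wmk 𝔭 ω)
    (Algebra.linearMap R (A 𝔭)) (A 𝔭) f
  refine gor_of_surj (locSurj 𝔭 hs) hB hN hvan θ F ?_
  have hu : IsUnit (algebraMap R (A 𝔭) (f m)) := IsLocalization.map_units _ (⟨_, hm⟩ : 𝔭.primeCompl)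
  have h1 : F (wmk 𝔭 ω m) = algebraMap R (A 𝔭) (f m) := by
    simp only [F, IsLocalizedModule.mapExtendScalars_apply_apply, IsLocalizedModule.map_apply]
    rfl
  intro a
  obtain ⟨b, hb⟩ := hu.exists_left_inv
  refine ⟨(a * b) • wmk 𝔭 ω m, ?_⟩
  rw [map_smul, h1, smul_eq_mul, mul_assoc, hb, mul_one]

/-- Depth fact. -/
theorem socle_zero (hs : Function.Surjective (algebraMap S R)) {N c : ℕ}
    (hB : ExtSelf (B S 𝔭) (B S 𝔭 ⧸ maximalIdeal (B S 𝔭)) N) (hcN : c ≠ N)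
    (hvan : ∀ i, i ≠ c → Subsingleton (EX (B S 𝔭) (A 𝔭) (B S 𝔭) i))
    (e : ω ≃ₗ[S] EX S R S c) (u : ω) (hu : ∀ r ∈ 𝔭, r • u = 0) : ∃ s ∉ 𝔭, s • u = 0 := by
  obtain ⟨θ⟩ := exW 𝔭 hs e
  have hsl := locSurj 𝔭 hs
  have hloc : IsLocalHom (algebraMap (B S 𝔭) (A 𝔭)) := IsLocalHom.of_surjective _ hsl
  have eκ : (B S 𝔭 ⧸ maximalIdeal (B S 𝔭)) ≃ₗ[B S 𝔭] (A 𝔭 ⧸ maximalIdeal (A 𝔭)) := by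
    let q : B S 𝔭 →ₗ[B S 𝔭] (A 𝔭 ⧸ maximalIdeal (A 𝔭)) := Algebra.linearMap (B S 𝔭) _
    have hq : Function.Surjective q := Ideal.Quotient.mk_surjective.comp hsl
    refine (Submodule.quotEquivOfEq _ _ ?_).trans (q.quotKerEquivOfSurjective hq)
    ext b
    have : q b = Ideal.Quotient.mk (maximalIdeal (A 𝔭)) (algebraMap (B S 𝔭) (A 𝔭) b) := rfl
    rw [LinearMap.mem_ker, this, Ideal.Quotient.eq_zero_iff_mem]
    simp only [mem_maximalIdeal, mem_nonunits_iff, isUnit_map_iff]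
  have hκ : ExtSelf (B S 𝔭) (A 𝔭 ⧸ maximalIdeal (A 𝔭)) N := extSelf_congr eκ hB
  have : IsNoetherianRing (A 𝔭) := isNoetherianRing_of_surjective _ _ _ hsl
  have h0 := hκ.1 c hcN
  have hH : Subsingleton ((A 𝔭 ⧸ maximalIdeal (A 𝔭)) →ₗ[A 𝔭] WW 𝔭 ω) :=
    Function.Surjective.subsingleton (fun y => DS.Th_surj hsl θ hvan y)
  have hw : ∀ a ∈ maximalIdeal (A 𝔭), a • wmk 𝔭 ω u = 0 := by
    intro a ha
    obtain ⟨⟨r, s⟩, h⟩ := IsLocalization.surj 𝔭.primeCompl a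
    simp only at h
    have hus : IsUnit (algebraMap R (A 𝔭) s) := IsLocalization.map_units _ s
    have hr : r ∈ 𝔭 := by
      rw [← IsLocalization.AtPrime.to_map_mem_maximal_iff (A 𝔭) 𝔭 r, ← h]
      exact Ideal.mul_mem_right _ _ ha
    rw [← hus.smul_eq_zero, smul_smul, mul_comm, h, algebraMap_smul, ← map_smul, hu r hr, map_zero]
  let φ : (A 𝔭 ⧸ maximalIdeal (A 𝔭)) →ₗ[A 𝔭] WW 𝔭 ω :=
    Submodule.liftQ (maximalIdeal (A 𝔭)) (LinearMap.toSpanSingleton (A 𝔭) _ (wmk 𝔭 ω u))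
      (fun a ha => by rw [LinearMap.mem_ker]; exact hw a ha)
  have h1 : wmk 𝔭 ω u = 0 := by
    have : φ (Submodule.Quotient.mk 1) = 0 := by rw [Subsingleton.elim φ 0]; rfl
    rw [← this]
    exact (one_smul (A 𝔭) _).symm
  obtain ⟨s, hs⟩ := (IsLocalizedModule.eq_zero_iff 𝔭.primeCompl (wmk 𝔭 ω)).1 h1
  exact ⟨s, s.2, hs⟩

end
end LS
end

section
open IsLocalRing RingTheory.Sequence
set_option linter.unusedSectionVars false

namespace SRL
section
open MvPolynomial
variable {k : Type} [Field k] {n : ℕ} {Δ : SC n}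

theorem mem_sr (p : MvPolynomial (Fin n) k) :
    p ∈ srIdeal k Δ ↔ ∀ m ∈ p.support, m.support ∉ Δ.faces := by
  classical
  have h : srIdeal k Δ = Ideal.span ((fun s => monomial s (1 : k)) ''
      ((fun σ : Finset (Fin n) => Finsupp.indicator σ (fun _ _ => 1)) '' {σ | σ ∉ Δ.faces})) := by
    unfold srIdeal
    congr 1
    ext m
    simp only [Set.mem_ofPred_eq, Set.mem_image, exists_exists_and_eq_and]
    refine exists_congr fun σ => and_congr_right fun _ => ?_
    rw [eq_comm]
    refine Eq.congr ?_ rfl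
    rw [MvPolynomial.monomial_eq, C_1, one_mul, Finsupp.prod]
    refine Finset.prod_subset_one_on_sdiff ?_ ?_ ?_ |>.symm
    · intro i hi
      by_contra h
      simp [Finsupp.indicator_apply, h] at hi
    · intro i hi
      simp [Finsupp.indicator_apply] at hi
    · intro i hi
      by_cases h : i ∈ σ <;> simp [Finsupp.indicator_apply, h] at hi ⊢
  rw [h, mem_ideal_span_monomial_image]
  refine forall₂_congr fun m _ => ?_
  simp only [Set.mem_image, Set.mem_ofPred_eq, exists_exists_and_eq_and]
  constructor
  · rintro ⟨σ, hσ, hle⟩ hm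
    refine hσ (Δ.down_closed hm ?_)
    intro i hi
    have := hle i
    rw [Finsupp.indicator_of_mem hi] at this
    simp; omega
  · intro hm
    refine ⟨m.support, hm, fun i => ?_⟩
    by_cases h : i ∈ m.support
    · rw [Finsupp.indicator_of_mem h]
      simp at h; omega
    · rw [Finsupp.indicator_of_notMem h]; exact Nat.zero_le _

/-- Prime generated by variables. -/
noncomputable def PS (k : Type) [Field k] {n : ℕ} (s : Finset (Fin n)) : Ideal (MvPolynomial (Fin n) k) :=
  Ideal.span (X '' (s : Set (Fin n)))

theorem mem_PS (s : Finset (Fin n)) (p : MvPolynomial (Fin n) k) :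
    p ∈ PS k s ↔ ∀ m ∈ p.support, ∃ i ∈ s, m i ≠ 0 :=
  mem_ideal_span_X_image

instance PS_prime (s : Finset (Fin n)) : (PS k s).IsPrime := by
  classical
  let φ : MvPolynomial (Fin n) k →ₐ[k] MvPolynomial (Fin n) k :=
    aeval (fun i => if i ∈ s then 0 else X i)
  have h1 : ∀ p, p - φ p ∈ PS k s := by
    intro p
    induction p using MvPolynomial.induction_on with
    | C a => 
      have : φ (C a) = C a := φ.commutes a
      rw [this, sub_self]; exact Ideal.zero_mem _
    | add p q hp hq =>
      have : p + q - φ (p + q) = (p - φ p) + (q - φ q) := by rw [map_add]; ring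
      rw [this]; exact Ideal.add_mem _ hp hq
    | mul_X p i hp =>
      have : p * X i - φ (p * X i) = (p - φ p) * X i + φ p * (X i - φ (X i)) := by
        rw [map_mul]; ring
      rw [this]
      refine Ideal.add_mem _ (Ideal.mul_mem_right _ _ hp) (Ideal.mul_mem_left _ _ ?_)
      by_cases h : i ∈ s
      · simp only [φ, aeval_X, h, if_true, sub_zero]
        exact Ideal.subset_span ⟨i, h, rfl⟩
      · simp [φ, h]
  have h2 : PS k s = RingHom.ker φ := by
    apply le_antisymm
    · refine Ideal.span_le.2 ?_
      rintro _ ⟨i, hi, rfl⟩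
      have hi' : i ∈ s := hi
      simp [φ, RingHom.mem_ker, hi']
    · intro p hp
      have := h1 p
      rw [RingHom.mem_ker] at hp
      rwa [hp, sub_zero] at this
  rw [h2]
  exact RingHom.ker_isPrime _

theorem PS_height (s : Finset (Fin n)) : (PS k s).height = s.card := by
  classical
  apply le_antisymm
  · refine (Ideal.height_le_spanFinrank (PS k s) (Ideal.IsPrime.ne_top inferInstance)).trans ?_
    have h3 : (Submodule.spanFinrank (PS k s)) ≤ (X '' (s : Set (Fin n)) : Set (MvPolynomial (Fin n) k)).ncard :=
      Submodule.spanFinrank_span_le_ncard_of_finite (Set.toFinite _)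
    have h4 := h3.trans (Set.ncard_image_le s.finite_toSet)
    rw [Set.ncard_coe_finset] at h4
    exact_mod_cast h4
  · induction s using Finset.induction_on with
    | empty => simp
    | insert a s ha ih =>
      have hlt : PS k s < PS k (insert a s) := by
        refine lt_of_le_of_ne (Ideal.span_mono (Set.image_mono (by simp))) fun h => ?_
        have : (X a : MvPolynomial (Fin n) k) ∈ PS k s := by
          rw [h]; exact Ideal.subset_span ⟨a, by simp, rfl⟩
        rw [mem_PS] at this
        obtain ⟨i, hi, h⟩ := this (Finsupp.single a 1) (by simp)
        rw [Finsupp.single_apply] at h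
        split_ifs at h with hh
        · exact ha (hh ▸ hi)
        · exact h rfl
      rw [Finset.card_insert_of_notMem ha]
      push_cast
      exact (add_le_add_left ih 1).trans (Ideal.height_add_one_le_of_lt_of_isPrime hlt)

theorem sr_le_PS (s : Finset (Fin n)) (hs : sᶜ ∈ Δ.faces) : srIdeal k Δ ≤ PS k s := by
  classical
  intro p hp
  rw [mem_sr] at hp
  rw [mem_PS]
  intro m hm
  by_contra! h
  refine hp m hm (Δ.down_closed hs ?_)
  intro i hi
  simp at hi ⊢
  exact fun h' => hi (h i h')

/-- Prime of the quotient. -/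
noncomputable def Q (k : Type) [Field k] {n : ℕ} (Δ : SC n) (s : Finset (Fin n)) : Ideal (SRRing k Δ) :=
  (PS k s).map (Ideal.Quotient.mk (srIdeal k Δ))

theorem Q_comap (s : Finset (Fin n)) (hs : sᶜ ∈ Δ.faces) :
    (Q k Δ s).comap (Ideal.Quotient.mk (srIdeal k Δ)) = PS k s := by
  unfold Q
  rw [Ideal.comap_map_of_surjective _ Ideal.Quotient.mk_surjective]
  have : Ideal.comap (Ideal.Quotient.mk (srIdeal k Δ)) ⊥ = srIdeal k Δ := by
    rw [← RingHom.ker_eq_comap_bot, Ideal.mk_ker]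
  rw [this]
  exact sup_of_le_left (sr_le_PS s hs)

theorem Q_prime (s : Finset (Fin n)) (hs : sᶜ ∈ Δ.faces) : (Q k Δ s).IsPrime :=
  Ideal.map_isPrime_of_surjective Ideal.Quotient.mk_surjective
    (by rw [Ideal.mk_ker]; exact sr_le_PS s hs)

theorem mk_mem_Q (s : Finset (Fin n)) (hs : sᶜ ∈ Δ.faces) (p : MvPolynomial (Fin n) k) :
    Ideal.Quotient.mk (srIdeal k Δ) p ∈ Q k Δ s ↔ p ∈ PS k s := by
  rw [← Q_comap s hs]; rfl

theorem srMax_eq : srMax k Δ = Q k Δ Finset.univ := by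
  unfold srMax quotMax Q PS
  rw [Ideal.map_span, Set.image_image]
  simp

theorem univ_c : (Finset.univ : Finset (Fin n))ᶜ ∈ Δ.faces := by
  simpa using Δ.empty_mem

theorem srMax_prime : (srMax k Δ).IsPrime := by
  rw [srMax_eq]; exact Q_prime _ univ_c

theorem PS_homog (s : Finset (Fin n)) : IsHomogIdeal k (PS k s) := by
  intro p hp d
  rw [mem_PS] at hp ⊢
  intro m hm
  apply hp
  rw [mem_support_iff, coeff_homogeneousComponent] at hm
  rw [mem_support_iff]
  intro h
  rw [h] at hm
  simp at hm

/-- Every homogeneous proper prime is inside the maximal one. -/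
theorem homog_le (𝔭 : Ideal (SRRing k Δ)) [h𝔭 : 𝔭.IsPrime]
    (h : IsHomogIdeal k (𝔭.comap (Ideal.Quotient.mk (srIdeal k Δ)))) : 𝔭 ≤ srMax k Δ := by
  intro r hr
  obtain ⟨p, rfl⟩ := Ideal.Quotient.mk_surjective r
  rw [srMax_eq, mk_mem_Q _ univ_c, mem_PS]
  intro m hm
  by_contra! h0
  have hm0 : m = 0 := Finsupp.ext fun i => h0 i (Finset.mem_univ i)
  subst hm0
  have h1 := h p hr 0
  rw [homogeneousComponent_zero, Ideal.mem_comap] at h1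
  apply h𝔭.ne_top
  refine Ideal.eq_top_of_isUnit_mem _ h1 ?_
  have : IsUnit (C (coeff 0 p) : MvPolynomial (Fin n) k) :=
    (IsUnit.mk0 _ (mem_support_iff.1 hm)).map C
  exact this.map _

theorem face_card_le (σ : Finset (Fin n)) (hσ : σ ∈ Δ.faces) {d : ℕ}
    (hd : ringKrullDim (SRRing k Δ) = d) : σ.card ≤ d := by
  classical
  let φ : MvPolynomial (Fin n) k →ₐ[k] MvPolynomial σ k :=
    aeval (fun i => if h : i ∈ σ then X ⟨i, h⟩ else 0)
  have h1 : ∀ p ∈ srIdeal k Δ, φ p = 0 := by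
    have : srIdeal k Δ ≤ RingHom.ker φ := by
      unfold srIdeal
      refine Ideal.span_le.2 ?_
      rintro _ ⟨τ, hτ, rfl⟩
      have : ¬ τ ⊆ σ := fun h => hτ (Δ.down_closed hσ h)
      obtain ⟨i, hi, hi'⟩ := Finset.not_subset.1 this
      change φ _ = 0
      rw [map_prod]
      refine Finset.prod_eq_zero hi ?_
      simp [φ, hi']
    exact this
  have h2 := ringKrullDim_le_of_surjective (Ideal.Quotient.lift (srIdeal k Δ) φ.toRingHom h1) (by
    apply Ideal.Quotient.lift_surjective_of_surjective
    intro q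
    refine ⟨rename Subtype.val q, ?_⟩
    change φ _ = q
    rw [aeval_rename]
    have : ((fun i => if h : i ∈ σ then (X ⟨i, h⟩ : MvPolynomial σ k) else 0) ∘ Subtype.val) = X := by
      ext i : 1
      simp
    rw [this]
    simp)
  rw [MvPolynomial.ringKrullDim_of_isNoetherianRing, ringKrullDim_eq_zero_of_field, hd] at h2
  simp at h2
  exact_mod_cast h2

theorem d_le {d : ℕ} (hd : ringKrullDim (SRRing k Δ) = d) : d ≤ n := by
  have := ringKrullDim_le_of_surjective (Ideal.Quotient.mk (srIdeal k Δ)) Ideal.Quotient.mk_surjective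
  rw [MvPolynomial.ringKrullDim_of_isNoetherianRing, ringKrullDim_eq_zero_of_field, hd] at this
  simp at this
  exact_mod_cast this

end
end SRL
end

section
open IsLocalRing RingTheory.Sequence
set_option linter.unusedSectionVars false

namespace SRL
section
open MvPolynomial
variable {k : Type} [Field k] {n : ℕ} {Δ : SC n}
attribute [local instance] LS.locAlg LS.locTower

theorem hsurj : Function.Surjective (algebraMap (MvPolynomial (Fin n) k) (SRRing k Δ)) :=
  Ideal.Quotient.mk_surjective

theorem regN (𝔭 : Ideal (SRRing k Δ)) [𝔭.IsPrime] : ∃ N : ℕ,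
    ringKrullDim (LS.B (MvPolynomial (Fin n) k) 𝔭) = N ∧
    ExtSelf (LS.B (MvPolynomial (Fin n) k) 𝔭)
      (LS.B (MvPolynomial (Fin n) k) 𝔭 ⧸ maximalIdeal (LS.B (MvPolynomial (Fin n) k) 𝔭)) N ∧
    (LS.P (MvPolynomial (Fin n) k) 𝔭).height = N := by
  have h1 := IsLocalization.AtPrime.ringKrullDim_eq_height
    (LS.P (MvPolynomial (Fin n) k) 𝔭) (LS.B (MvPolynomial (Fin n) k) 𝔭)
  have h2 : (LS.P (MvPolynomial (Fin n) k) 𝔭).height ≠ ⊤ :=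
    Ideal.height_ne_top (Ideal.IsPrime.ne_top inferInstance)
  obtain ⟨N, hN⟩ := ENat.ne_top_iff_exists.1 h2
  have h3 : ringKrullDim (LS.B (MvPolynomial (Fin n) k) 𝔭) = N := by
    rw [h1, ← hN]; rfl
  have : IsRegularLocalRing (LS.B (MvPolynomial (Fin n) k) 𝔭) :=
    IsRegularRing.isRegularLocalRing_localization (LS.P (MvPolynomial (Fin n) k) 𝔭)
  exact ⟨N, h3, extSelf_residue _ N h3, hN.symm⟩

theorem regQ (s : Finset (Fin n)) (hs : sᶜ ∈ Δ.faces) [(Q k Δ s).IsPrime] :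
    ringKrullDim (LS.B (MvPolynomial (Fin n) k) (Q k Δ s)) = s.card ∧
    ExtSelf (LS.B (MvPolynomial (Fin n) k) (Q k Δ s))
      (LS.B (MvPolynomial (Fin n) k) (Q k Δ s) ⧸ maximalIdeal (LS.B (MvPolynomial (Fin n) k) (Q k Δ s))) s.card := by
  obtain ⟨N, h1, h2, h3⟩ := regN (Q k Δ s)
  have h4 : LS.P (MvPolynomial (Fin n) k) (Q k Δ s) = PS k s := Q_comap s hs
  rw [h4, PS_height] at h3
  have h5 : s.card = N := by exact_mod_cast h3
  subst h5
  exact ⟨h1, h2⟩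

variable {d : ℕ}

theorem cm_ex (hd : ringKrullDim (SRRing k Δ) = d) (hCM : IsCohenMacaulayAt (SRRing k Δ) (srMax k Δ)) (i : ℕ) (hi : i < d) :
    Subsingleton (EX (SRRing k Δ) (SRRing k Δ ⧸ srMax k Δ) (SRRing k Δ) i) := by
  have h := hCM.2 i (by rw [hd]; exact Nat.cast_lt.2 hi)
  obtain ⟨e⟩ := extMod_bridge (SRRing k Δ) (SRRing k Δ ⧸ srMax k Δ) (SRRing k Δ) i
  exact e.toEquiv.symm.subsingleton

theorem van (hd : ringKrullDim (SRRing k Δ) = d) (hCM : IsCohenMacaulayAt (SRRing k Δ) (srMax k Δ))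
    (𝔭 : Ideal (SRRing k Δ)) [𝔭.IsPrime] (h𝔭 : 𝔭 ≤ srMax k Δ) (i : ℕ) (hi : i ≠ n - d) :
    Subsingleton (EX (LS.B (MvPolynomial (Fin n) k) 𝔭) (LS.A 𝔭) (LS.B (MvPolynomial (Fin n) k) 𝔭) i) := by
  have hc := cm_ex hd hCM
  rw [srMax_eq] at h𝔭 hc
  have := Q_prime (k := k) (Δ := Δ) _ univ_c
  refine LS.van_prime (Q k Δ Finset.univ) hsurj 𝔭 h𝔭 i ?_
  refine LS.van_max (N := n) (d := d) (Q k Δ Finset.univ) hsurj ?_ hc ?_ i ?_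
  · have := (regQ (k := k) (Δ := Δ) Finset.univ univ_c).2
    rwa [Finset.card_univ, Fintype.card_fin] at this
  · rw [← hd, IsLocalization.AtPrime.ringKrullDim_eq_height (Q k Δ Finset.univ)]
    exact Ideal.height_le_ringKrullDim_of_ne_top (Ideal.IsPrime.ne_top inferInstance)
  · have := d_le hd
    omega

variable {ω : Type} [AddCommGroup ω] [Module (SRRing k Δ) ω] [Module (MvPolynomial (Fin n) k) ω]
  [IsScalarTower (MvPolynomial (Fin n) k) (SRRing k Δ) ω]

theorem out_bwd (hd : ringKrullDim (SRRing k Δ) = d) (hCM : IsCohenMacaulayAt (SRRing k Δ) (srMax k Δ))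
    (e : ω ≃ₗ[MvPolynomial (Fin n) k] EX (MvPolynomial (Fin n) k) (SRRing k Δ) (MvPolynomial (Fin n) k) (n - d))
    {i : ℕ} (htr : traceIdeal (SRRing k Δ) ω = srMax k Δ ^ i) : GorensteinPunctured k (srIdeal k Δ) := by
  intro 𝔭 h𝔭 hh hne
  have hle := homog_le 𝔭 hh
  have h1 : ¬ traceIdeal (SRRing k Δ) ω ≤ 𝔭 := by
    rw [htr]
    intro h
    exact hne (le_antisymm hle (Ideal.IsPrime.le_of_pow_le h))
  have h2 : ∃ f : ω →ₗ[SRRing k Δ] SRRing k Δ, ∃ m, f m ∉ 𝔭 := by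
    by_contra! h
    apply h1
    unfold traceIdeal
    refine iSup_le fun f => ?_
    rintro _ ⟨m, rfl⟩
    exact h f m
  obtain ⟨f, m, hm⟩ := h2
  obtain ⟨N, hN, hB, _⟩ := regN 𝔭
  exact LS.gor_bwd 𝔭 hsurj hB hN (fun i hi => van hd hCM 𝔭 hle i hi) e f m hm

theorem out_socle (hd : ringKrullDim (SRRing k Δ) = d) (hCM : IsCohenMacaulayAt (SRRing k Δ) (srMax k Δ))
    (e : ω ≃ₗ[MvPolynomial (Fin n) k] EX (MvPolynomial (Fin n) k) (SRRing k Δ) (MvPolynomial (Fin n) k) (n - d))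
    (hd1 : 1 ≤ d) (u : ω) (hu : ∀ r ∈ srMax k Δ, r • u = 0) : ∃ s ∉ srMax k Δ, s • u = 0 := by
  have := Q_prime (k := k) (Δ := Δ) _ univ_c
  have hv := van hd hCM (Q k Δ Finset.univ) (h𝔭 := srMax_eq.ge)
  rw [srMax_eq] at hu ⊢
  have hB := (regQ (k := k) (Δ := Δ) Finset.univ univ_c).2
  rw [Finset.card_univ, Fintype.card_fin] at hB
  exact LS.socle_zero (Q k Δ Finset.univ) hsurj hB (by have := d_le hd; omega) hv e u hu

theorem erase_c {v : Fin n} (hv : {v} ∈ Δ.faces) : (Finset.univ.erase v)ᶜ ∈ Δ.faces := by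
  have : (Finset.univ.erase v)ᶜ = {v} := by ext; simp
  rwa [this]

theorem Q_le (s : Finset (Fin n)) : Q k Δ s ≤ srMax k Δ := by
  rw [srMax_eq]
  exact Ideal.map_mono (Ideal.span_mono (Set.image_mono (by simp)))

theorem out_fwd (hd : ringKrullDim (SRRing k Δ) = d) (hCM : IsCohenMacaulayAt (SRRing k Δ) (srMax k Δ))
    (e : ω ≃ₗ[MvPolynomial (Fin n) k] EX (MvPolynomial (Fin n) k) (SRRing k Δ) (MvPolynomial (Fin n) k) (n - d))
    (hG : GorensteinPunctured k (srIdeal k Δ)) (v : Fin n) (hv : {v} ∈ Δ.faces)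
    (𝔭 : Ideal (SRRing k Δ)) [𝔭.IsPrime] (h𝔭 : 𝔭 = Q k Δ (Finset.univ.erase v)) :
    (∀ i : ℕ, (i + 1 = d → Nonempty (EX (LS.A 𝔭) (LS.A 𝔭 ⧸ maximalIdeal (LS.A 𝔭)) (LS.A 𝔭) i ≃ₗ[LS.A 𝔭] (LS.A 𝔭 ⧸ maximalIdeal (LS.A 𝔭)))) ∧
      (i + 1 ≠ d → Subsingleton (EX (LS.A 𝔭) (LS.A 𝔭 ⧸ maximalIdeal (LS.A 𝔭)) (LS.A 𝔭) i))) ∧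
    ∃ g : ω, (∀ m : ω, ∃ s ∉ 𝔭, ∃ r : SRRing k Δ, s • m = r • g) ∧ 
      (∀ r : SRRing k Δ, r • g = 0 → ∃ s ∉ 𝔭, s * r = 0) := by
  have hhom : IsHomogIdeal k (𝔭.comap (Ideal.Quotient.mk (srIdeal k Δ))) := by
    rw [h𝔭, Q_comap _ (erase_c hv)]; exact PS_homog _
  have hne : 𝔭 ≠ quotMax k (srIdeal k Δ) := by
    intro h
    have h1 : Ideal.Quotient.mk (srIdeal k Δ) (X v) ∈ 𝔭 := by
      rw [h]; exact Ideal.subset_span ⟨v, rfl⟩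
    rw [h𝔭, mk_mem_Q _ (erase_c hv), mem_PS] at h1
    obtain ⟨i, hi, h2⟩ := h1 (Finsupp.single v 1) (by simp)
    rw [Finsupp.single_apply] at h2
    split_ifs at h2 with h3
    · subst h3; simp at hi
    · exact h2 rfl
  have hA := hG 𝔭 hhom hne
  have hle : 𝔭 ≤ srMax k Δ := h𝔭 ▸ Q_le _
  subst h𝔭
  obtain ⟨hN, hB⟩ := regQ (k := k) (Δ := Δ) _ (erase_c hv)
  set 𝔭 := Q k Δ (Finset.univ.erase v) with h𝔭
  obtain ⟨⟨t, ht, hct⟩, g, hg⟩ := LS.gor_fwd 𝔭 hsurj hB hN (fun i hi => van hd hCM 𝔭 hle i hi) e hA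
  refine ⟨fun i => ?_, g, hg⟩
  have htd : t + 1 = d := by
    have := d_le hd
    rw [Finset.card_erase_of_mem (Finset.mem_univ _), Finset.card_univ, Fintype.card_fin] at hct
    have := v.pos
    have := face_card_le _ hv hd
    simp at this
    omega
  obtain ⟨eb⟩ := extMod_bridge (LS.A 𝔭) (LS.A 𝔭 ⧸ maximalIdeal (LS.A 𝔭)) (LS.A 𝔭) i
  constructor
  · intro hi
    obtain ⟨e1⟩ := (hA.2 i).1 (by rw [show i = t by omega]; exact ht.symm)
    exact ⟨eb.symm.trans e1⟩
  · intro hi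
    have := (hA.2 i).2 (by
      intro h
      erw [ht] at h
      have := Nat.cast_injective (R := WithBot ℕ∞) h
      omega)
    exact eb.toEquiv.symm.subsingleton

end
end SRL
end

section
set_option linter.unusedSectionVars false

/-- Squarefree graded module structure. -/
structure SqGr (k : Type) [Field k] (n : ℕ) (W : Type) [AddCommGroup W]
    [Module (MvPolynomial (Fin n) k) W] where
  pr : (Fin n →₀ ℕ) → W →+ W
  pr_C : ∀ a (c : k) w, pr a ((MvPolynomial.C c : MvPolynomial (Fin n) k) • w) =
    (MvPolynomial.C c : MvPolynomial (Fin n) k) • pr a w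
  pr_same : ∀ a w, pr a (pr a w) = pr a w
  pr_ne : ∀ a b w, a ≠ b → pr a (pr b w) = 0
  sum : ∀ w, ∃ s : Finset (Fin n →₀ ℕ), ∑ a ∈ s, pr a w = w
  pr_X : ∀ a i w, pr (a + Finsupp.single i 1) ((MvPolynomial.X i : MvPolynomial (Fin n) k) • w) =
    (MvPolynomial.X i : MvPolynomial (Fin n) k) • pr a w
  inj : ∀ a i w, 1 ≤ a i → (MvPolynomial.X i : MvPolynomial (Fin n) k) • pr a w = 0 → pr a w = 0
  surj : ∀ a i w, 1 ≤ a i → ∃ w', pr (a + Finsupp.single i 1) w =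
    (MvPolynomial.X i : MvPolynomial (Fin n) k) • pr a w'

namespace SqGr
section
open MvPolynomial
variable {k : Type} [Field k] {n : ℕ} {W : Type} [AddCommGroup W] [Module (MvPolynomial (Fin n) k) W]
  {V : Type} [AddCommGroup V] [Module (MvPolynomial (Fin n) k) V]
variable (G : SqGr k n W) (H : SqGr k n V)

theorem sum_of (w : W) (s : Finset (Fin n →₀ ℕ)) (h : ∀ a, G.pr a w ≠ 0 → a ∈ s) :
    ∑ a ∈ s, G.pr a w = w := by
  classical
  obtain ⟨t, ht⟩ := G.sum w
  have h1 : ∀ a, a ∉ t → G.pr a w = 0 := by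
    intro a ha
    rw [← ht, map_sum]
    exact Finset.sum_eq_zero fun b hb => G.pr_ne a b w (fun h => ha (h ▸ hb))
  rw [Finset.sum_subset (Finset.subset_union_left (s₂ := t))
    (fun a _ ha => by by_contra h'; exact ha (h a h'))]
  rw [← Finset.sum_subset (Finset.subset_union_right (s₁ := s)) (fun a _ ha => h1 a ha), ht]

theorem fin (w : W) : {a | G.pr a w ≠ 0}.Finite := by
  classical
  obtain ⟨t, ht⟩ := G.sum w
  refine t.finite_toSet.subset fun a ha => ?_
  by_contra h
  apply ha
  rw [← ht, map_sum]
  exact Finset.sum_eq_zero fun b hb => G.pr_ne a b w (fun h' => h (h' ▸ hb))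

theorem ind {P : W → Prop} (h0 : P 0) (hadd : ∀ x y, P x → P y → P (x + y))
    (h : ∀ a w, P (G.pr a w)) (w : W) : P w := by
  classical
  obtain ⟨t, ht⟩ := G.sum w
  rw [← ht]
  exact Finset.sum_induction _ P hadd h0 (fun a _ => h a w)

theorem eq_zero (w : W) (h : ∀ a, G.pr a w = 0) : w = 0 := by
  obtain ⟨t, ht⟩ := G.sum w
  rw [← ht]
  exact Finset.sum_eq_zero fun a _ => h a

/-- Descent of a family of additive maps. -/
noncomputable def D {Y : Type} [AddCommGroup Y] (h : (Fin n →₀ ℕ) → W →+ Y) : W →+ Y where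
  toFun w := ∑ᶠ b, h b (G.pr b w)
  map_zero' := by simp
  map_add' x y := by
    have hf : ∀ w, (Function.support fun b => h b (G.pr b w)).Finite := fun w =>
      (G.fin w).subset fun b hb => by
        intro h'; apply hb; simp only; rw [h', map_zero]
    rw [← finsum_add_distrib (hf x) (hf y)]
    simp

theorem D_pr {Y : Type} [AddCommGroup Y] (h : (Fin n →₀ ℕ) → W →+ Y) (b w) :
    G.D h (G.pr b w) = h b (G.pr b w) := by
  change ∑ᶠ b', h b' (G.pr b' (G.pr b w)) = _
  rw [finsum_eq_single _ b, G.pr_same]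
  intro x hx
  rw [G.pr_ne _ _ _ hx, map_zero]

theorem X_pr (a i w) : (X i : MvPolynomial (Fin n) k) • G.pr a w =
    G.pr (a + Finsupp.single i 1) ((X i : MvPolynomial (Fin n) k) • G.pr a w) := by
  rw [G.pr_X, G.pr_same]

theorem pr_X_zero (a i w) (h : a i = 0) : G.pr a ((X i : MvPolynomial (Fin n) k) • w) = 0 := by
  refine G.ind (P := fun w => G.pr a ((X i : MvPolynomial (Fin n) k) • w) = 0) (by simp)
    (fun x y hx hy => by simp [smul_add, hx, hy]) (fun b w => ?_) w
  rw [G.X_pr, G.pr_ne]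
  intro h'
  rw [h'] at h
  simp at h

theorem pr_mon (a b : Fin n →₀ ℕ) (c : k) (w) :
    G.pr (a + b) ((monomial b c : MvPolynomial (Fin n) k) • w) =
      (monomial b c : MvPolynomial (Fin n) k) • G.pr a w := by
  revert w
  induction b using Finsupp.induction_linear generalizing a c with
  | zero =>
    intro w
    have := G.pr_C a c w
    simpa using this
  | add f g hf hg =>
    intro w
    have : (monomial (f + g) c : MvPolynomial (Fin n) k) = monomial g 1 * monomial f c := by
      rw [monomial_mul, one_mul, add_comm]
    rw [this, mul_smul, mul_smul, ← hf, ← hg, add_assoc]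
  | single i j =>
    intro w
    induction j generalizing a c w with
    | zero =>
      have := G.pr_C a c w
      simpa using this
    | succ j ih =>
      have : (monomial (Finsupp.single i (j + 1)) c : MvPolynomial (Fin n) k) =
          X i * monomial (Finsupp.single i j) c := by
        rw [X, monomial_mul, one_mul, ← Finsupp.single_add, add_comm]
      rw [this, mul_smul, mul_smul, ← ih, Finsupp.single_add, ← add_assoc, G.pr_X]

theorem mon_pr (a b : Fin n →₀ ℕ) (c : k) (w) : (monomial b c : MvPolynomial (Fin n) k) • G.pr a w =
    G.pr (a + b) ((monomial b c : MvPolynomial (Fin n) k) • G.pr a w) := by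
  rw [G.pr_mon, G.pr_same]

theorem mon_single (i : Fin n) (j : ℕ) :
    (monomial (Finsupp.single i (j + 1)) 1 : MvPolynomial (Fin n) k) =
          X i * monomial (Finsupp.single i j) 1 := by
  rw [X, monomial_mul, one_mul, ← Finsupp.single_add, add_comm]

theorem mon_inj (a b : Fin n →₀ ℕ) (w) (hb : ∀ i, b i ≠ 0 → 1 ≤ a i)
    (h : (monomial b 1 : MvPolynomial (Fin n) k) • G.pr a w = 0) : G.pr a w = 0 := by
  induction b using Finsupp.induction_linear generalizing a w with
  | zero => simpa using h
  | add f g hf hg =>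
    have : (monomial (f + g) 1 : MvPolynomial (Fin n) k) = monomial g 1 * monomial f 1 := by
      rw [monomial_mul, one_mul, add_comm]
    rw [this, mul_smul] at h
    refine hf a w (fun i hi => hb i (by simp [hi])) ?_
    rw [G.mon_pr] at h ⊢
    refine hg _ _ (fun i hi => ?_) h
    have := hb i (by simp [hi])
    simp
    omega
  | single i j =>
    induction j with
    | zero => simpa using h
    | succ j ih =>
      have hi : 1 ≤ a i := hb i (by simp)
      rw [mon_single, mul_smul] at h
      refine ih (fun i' hi' => ?_) ?_
      · rcases eq_or_ne i i' with rfl | h'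
        · exact hi
        · simp [h'] at hi'
      · rw [G.mon_pr] at h ⊢
        exact G.inj _ _ _ (by simp; omega) h

theorem mon_surj (a b : Fin n →₀ ℕ) (w) (hb : ∀ i, b i ≠ 0 → 1 ≤ a i) :
    ∃ w', G.pr (a + b) w = (monomial b 1 : MvPolynomial (Fin n) k) • G.pr a w' := by
  induction b using Finsupp.induction_linear generalizing a w with
  | zero => exact ⟨w, by simp⟩
  | add f g hf hg =>
    obtain ⟨w1, h1⟩ := hg (a + f) w (fun i hi => by
      have := hb i (by simp [hi])
      simp; omega)
    obtain ⟨w2, h2⟩ := hf a w1 (fun i hi => hb i (by simp [hi]))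
    refine ⟨w2, ?_⟩
    have : (monomial (f + g) 1 : MvPolynomial (Fin n) k) = monomial g 1 * monomial f 1 := by
      rw [monomial_mul, one_mul, add_comm]
    rw [this, mul_smul, ← h2, ← h1, add_assoc]
  | single i j =>
    induction j generalizing w with
    | zero => exact ⟨w, by simp⟩
    | succ j ih =>
      have hi : 1 ≤ a i := hb i (by simp)
      obtain ⟨w1, h1⟩ := G.surj (a + Finsupp.single i j) i w (by simp; omega)
      obtain ⟨w2, h2⟩ := ih w1 (fun i' hi' => by
        rcases eq_or_ne i i' with rfl | h'
        · exact hi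
        · simp [h'] at hi')
      refine ⟨w2, ?_⟩
      rw [mon_single, mul_smul, ← h2, ← h1, Finsupp.single_add, add_assoc]

/-- Transfer. -/
noncomputable def congr (e : W ≃ₗ[MvPolynomial (Fin n) k] V) : SqGr k n V where
  pr a := (e.toAddEquiv : W →+ V).comp ((G.pr a).comp (e.symm.toAddEquiv : V →+ W))
  pr_C a c w := by
    change e (G.pr a (e.symm _)) = _ • e (G.pr a (e.symm _))
    rw [map_smul, G.pr_C, map_smul]
  pr_same a w := by
    change e (G.pr a (e.symm (e (G.pr a (e.symm _))))) = e (G.pr a (e.symm _))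
    rw [e.symm_apply_apply, G.pr_same]
  pr_ne a b w h := by
    change e (G.pr a (e.symm (e (G.pr b (e.symm _))))) = 0
    rw [e.symm_apply_apply, G.pr_ne _ _ _ h, map_zero]
  sum w := by
    obtain ⟨s, hs⟩ := G.sum (e.symm w)
    refine ⟨s, ?_⟩
    change ∑ a ∈ s, e (G.pr a (e.symm _)) = w
    rw [← map_sum, hs, e.apply_symm_apply]
  pr_X a i w := by
    change e (G.pr _ (e.symm _)) = _ • e (G.pr a (e.symm _))
    rw [map_smul, G.pr_X, map_smul]
  inj a i w h h1 := by
    change _ • e (G.pr a (e.symm _)) = 0 at h1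
    change e (G.pr a (e.symm _)) = 0
    rw [← map_smul, LinearEquiv.map_eq_zero_iff] at h1
    rw [G.inj _ _ _ h h1, map_zero]
  surj a i w h := by
    obtain ⟨w', h'⟩ := G.surj a i (e.symm w) h
    refine ⟨e w', ?_⟩
    change e (G.pr _ (e.symm _)) = _ • e (G.pr a (e.symm _))
    rw [e.symm_apply_apply, h', map_smul]

/-- Submodule condition. -/
def Good (N : Submodule (MvPolynomial (Fin n) k) W) : Prop :=
  (∀ a, ∀ w ∈ N, G.pr a w ∈ N) ∧
    ∀ a i w, 1 ≤ a i → (X i : MvPolynomial (Fin n) k) • G.pr a w ∈ N → G.pr a w ∈ N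

/-- Submodule. -/
noncomputable def sub {N : Submodule (MvPolynomial (Fin n) k) W} (h : G.Good N) : SqGr k n N where
  pr a := { toFun := fun w => ⟨G.pr a w, h.1 a w w.2⟩
            map_zero' := by ext; simp
            map_add' := fun x y => by ext; simp }
  pr_C a c w := by ext; exact G.pr_C a c w
  pr_same a w := by ext; exact G.pr_same a w
  pr_ne a b w hh := by ext; exact G.pr_ne a b w hh
  sum w := by
    obtain ⟨s, hs⟩ := G.sum w
    refine ⟨s, ?_⟩
    ext
    rw [AddSubmonoidClass.coe_finsetSum]
    exact hs
  pr_X a i w := by ext; exact G.pr_X a i w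
  inj a i w h h1 := by
    ext
    exact G.inj a i w h (congrArg Subtype.val h1)
  surj a i w hi := by
    obtain ⟨w', h'⟩ := G.surj a i w hi
    refine ⟨⟨G.pr a w', h.2 a i w' hi (h' ▸ h.1 _ _ w.2)⟩, ?_⟩
    ext
    change G.pr _ _ = _ • G.pr a (G.pr a w')
    rw [G.pr_same, h']

/-- Quotient module. -/
noncomputable def quo {N : Submodule (MvPolynomial (Fin n) k) W} (h : G.Good N) : SqGr k n (W ⧸ N) where
  pr a := QuotientAddGroup.map N.toAddSubgroup N.toAddSubgroup (G.pr a) (fun w hw => h.1 a w hw)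
  pr_C a c w := by
    obtain ⟨w, rfl⟩ := N.mkQ_surjective w
    exact congrArg N.mkQ (G.pr_C a c w)
  pr_same a w := by
    obtain ⟨w, rfl⟩ := N.mkQ_surjective w
    exact congrArg N.mkQ (G.pr_same a w)
  pr_ne a b w hh := by
    obtain ⟨w, rfl⟩ := N.mkQ_surjective w
    exact congrArg N.mkQ (G.pr_ne a b w hh)
  sum w := by
    obtain ⟨w, rfl⟩ := N.mkQ_surjective w
    obtain ⟨s, hs⟩ := G.sum w
    refine ⟨s, ?_⟩
    have := congrArg N.mkQ hs
    rw [map_sum] at this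
    exact this
  pr_X a i w := by
    obtain ⟨w, rfl⟩ := N.mkQ_surjective w
    exact congrArg N.mkQ (G.pr_X a i w)
  inj a i w hi h1 := by
    obtain ⟨w, rfl⟩ := N.mkQ_surjective w
    have h1 : N.mkQ ((X i : MvPolynomial (Fin n) k) • G.pr a w) = 0 := h1
    change N.mkQ (G.pr a w) = 0
    rw [Submodule.mkQ_apply, Submodule.Quotient.mk_eq_zero] at h1 ⊢
    exact h.2 a i w hi h1
  surj a i w hi := by
    obtain ⟨w, rfl⟩ := N.mkQ_surjective w
    obtain ⟨w', h'⟩ := G.surj a i w hi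
    exact ⟨N.mkQ w', congrArg N.mkQ h'⟩

/-- Graded maps. -/
def Hm (f : W →ₗ[MvPolynomial (Fin n) k] V) : Prop := ∀ a w, f (G.pr a w) = H.pr a (f w)

variable {G H}
theorem Hm.ker {f : W →ₗ[MvPolynomial (Fin n) k] V} (hf : Hm G H f) : G.Good (LinearMap.ker f) := by
  constructor
  · intro a w hw
    rw [LinearMap.mem_ker] at hw ⊢
    rw [hf, hw, map_zero]
  · intro a i w hi h
    rw [LinearMap.mem_ker] at h ⊢
    rw [map_smul, hf] at h
    rw [hf]
    exact H.inj _ _ _ hi h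

theorem Hm.range {f : W →ₗ[MvPolynomial (Fin n) k] V} (hf : Hm G H f) : H.Good (LinearMap.range f) := by
  constructor
  · rintro a _ ⟨w, rfl⟩
    exact ⟨G.pr a w, hf a w⟩
  · rintro a i w hi ⟨u, hu⟩
    obtain ⟨u', hu'⟩ := G.surj a i u hi
    refine ⟨G.pr a u', ?_⟩
    have h1 : (X i : MvPolynomial (Fin n) k) • (H.pr a w - f (G.pr a u')) = 0 := by
      rw [smul_sub, ← LinearMap.map_smul f, ← hu', hf, hu, ← H.X_pr, sub_self]
    have h2 : H.pr a w - f (G.pr a u') = H.pr a (w - f u') := by rw [map_sub, hf]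
    rw [h2] at h1
    have h3 := H.inj _ _ _ hi h1
    rw [← h2, sub_eq_zero] at h3
    exact h3.symm

end
end SqGr
end

section
set_option linter.unusedSectionVars false

namespace SqGr
section
open MvPolynomial
variable {k : Type} [Field k] {n : ℕ} {W : Type} [AddCommGroup W] [Module (MvPolynomial (Fin n) k) W]
  {V : Type} [AddCommGroup V] [Module (MvPolynomial (Fin n) k) V]
variable (G : SqGr k n W) (H : SqGr k n V)

open Classical in
/-- Shifted projection on the polynomial ring. -/
noncomputable def shp (σ a : Fin n →₀ ℕ) : MvPolynomial (Fin n) k →+ MvPolynomial (Fin n) k where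
  toFun p := if σ ≤ a then monomial (a - σ) (coeff (a - σ) p) else 0
  map_zero' := by simp
  map_add' x y := by split_ifs <;> simp

theorem shp_of {σ a : Fin n →₀ ℕ} (h : σ ≤ a) (p : MvPolynomial (Fin n) k) :
    shp σ a p = monomial (a - σ) (coeff (a - σ) p) := if_pos h
theorem shp_not {σ a : Fin n →₀ ℕ} (h : ¬ σ ≤ a) (p : MvPolynomial (Fin n) k) :
    shp σ a p = 0 := if_neg h

/-- Shifted polynomial ring. -/
noncomputable def shift (σ : Fin n →₀ ℕ) (hσ : ∀ i, σ i ≤ 1) : SqGr k n (MvPolynomial (Fin n) k) where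
  pr a := shp σ a
  pr_C a c w := by
    by_cases h : σ ≤ a
    · rw [shp_of h, shp_of h, smul_eq_mul, smul_eq_mul, coeff_C_mul, C_mul_monomial]
    · rw [shp_not h, shp_not h, smul_zero]
  pr_same a w := by
    by_cases h : σ ≤ a
    · rw [shp_of h, shp_of h, coeff_monomial, if_pos rfl]
    · rw [shp_not h, shp_not h]
  pr_ne a b w hab := by
    by_cases h : σ ≤ a
    · by_cases hb : σ ≤ b
      · rw [shp_of h, shp_of hb, coeff_monomial, if_neg, monomial_zero]
        intro h'
        apply hab
        rw [← tsub_add_cancel_of_le h, ← h', tsub_add_cancel_of_le hb]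
      · rw [shp_not hb, map_zero]
    · rw [shp_not h]
  sum p := by
    classical
    refine ⟨p.support.image (· + σ), ?_⟩
    rw [Finset.sum_image (fun x _ y _ h => add_right_cancel h)]
    conv_rhs => rw [← support_sum_monomial_coeff p]
    refine Finset.sum_congr rfl fun b _ => ?_
    rw [shp_of le_add_self, add_tsub_cancel_right]
  pr_X a i p := by
    classical
    by_cases h : σ ≤ a
    · rw [shp_of h, shp_of (h.trans le_self_add), smul_eq_mul, smul_eq_mul]
      have : a + Finsupp.single i 1 - σ = (a - σ) + Finsupp.single i 1 := by
        rw [tsub_add_eq_add_tsub h]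
      rw [this, mul_comm (X i), coeff_mul_X, X, monomial_mul, one_mul, add_comm]
    · rw [shp_not h, smul_zero]
      by_cases h2 : σ ≤ a + Finsupp.single i 1
      · rw [shp_of h2, smul_eq_mul, coeff_X_mul', if_neg, monomial_zero]
        intro h3
        apply h
        intro j
        have h4 := h2 j
        rcases eq_or_ne i j with rfl | hij
        · simp at h3 h4
          omega
        · simpa [Finsupp.single_apply, hij] using h4
      · rw [shp_not h2]
  inj a i p hi h := by
    rw [smul_eq_mul] at h
    exact (mul_eq_zero.1 h).resolve_left (X_ne_zero i)
  surj a i p hi := by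
    by_cases h : σ ≤ a
    · refine ⟨monomial (a - σ) (coeff (a + Finsupp.single i 1 - σ) p), ?_⟩
      rw [shp_of h, shp_of (h.trans le_self_add), coeff_monomial, if_pos rfl, smul_eq_mul, X, monomial_mul, one_mul,
        ← tsub_add_eq_add_tsub h, add_comm]
    · refine ⟨0, ?_⟩
      rw [map_zero, smul_zero, shp_not]
      intro h2
      apply h
      intro j
      have h4 := h2 j
      rcases eq_or_ne i j with rfl | hij
      · exact (hσ i).trans hi
      · simpa [Finsupp.single_apply, hij] using h4

theorem pr_smul (a σ : Fin n →₀ ℕ) (p : MvPolynomial (Fin n) k) (w : W) :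
    G.pr a (p • G.pr σ w) = shp σ a p • G.pr σ w := by
  induction p using MvPolynomial.induction_on' with
  | add p q hp hq => rw [add_smul, map_add, hp, hq, map_add, add_smul]
  | monomial b c =>
    rw [G.mon_pr]
    rcases eq_or_ne a (σ + b) with rfl | h
    · rw [G.pr_same, ← G.mon_pr, shp_of le_self_add, add_tsub_cancel_left, coeff_monomial, if_pos rfl]
    · rw [G.pr_ne _ _ _ h]
      by_cases h2 : σ ≤ a
      · rw [shp_of h2, coeff_monomial, if_neg, monomial_zero, zero_smul]
        intro h3
        apply h
        rw [h3, add_tsub_cancel_of_le h2]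
      · rw [shp_not h2, zero_smul]

/-- Finite products. -/
noncomputable def pi {ι : Type} [Fintype ι] (U : ι → Type) [∀ j, AddCommGroup (U j)]
    [∀ j, Module (MvPolynomial (Fin n) k) (U j)] (g : ∀ j, SqGr k n (U j)) : SqGr k n (∀ j, U j) where
  pr a := { toFun := fun w j => (g j).pr a (w j)
            map_zero' := by ext; simp
            map_add' := fun x y => by ext; simp }
  pr_C a c w := by ext j; exact (g j).pr_C a c (w j)
  pr_same a w := by ext j; exact (g j).pr_same a (w j)
  pr_ne a b w h := by ext j; exact (g j).pr_ne a b (w j) h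
  sum w := by
    classical
    refine ⟨Finset.univ.biUnion fun j => ((g j).fin (w j)).toFinset, ?_⟩
    ext j
    rw [Finset.sum_apply]
    refine (g j).sum_of (w j) _ fun a ha => ?_
    simp only [Finset.mem_biUnion, Finset.mem_univ, true_and, Set.Finite.mem_toFinset]
    exact ⟨j, ha⟩
  pr_X a i w := by ext j; exact (g j).pr_X a i (w j)
  inj a i w hi h := by
    ext j
    exact (g j).inj a i (w j) hi (congrFun h j)
  surj a i w hi := by
    choose w' h' using fun j => (g j).surj a i (w j) hi
    exact ⟨w', funext h'⟩

theorem gens_span : Submodule.span (MvPolynomial (Fin n) k)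
    {w : W | ∃ σ : Fin n →₀ ℕ, (∀ i, σ i ≤ 1) ∧ G.pr σ w = w} = ⊤ := by
  rw [eq_top_iff]
  intro w _
  refine G.ind (P := fun w => w ∈ Submodule.span (MvPolynomial (Fin n) k)
    {w : W | ∃ σ : Fin n →₀ ℕ, (∀ i, σ i ≤ 1) ∧ G.pr σ w = w}) (Submodule.zero_mem _)
    (fun x y => Submodule.add_mem _) (fun a w => ?_) w
  let σ : Fin n →₀ ℕ := Finsupp.equivFunOnFinite.symm fun i => min (a i) 1
  have hσ : ∀ i, σ i = min (a i) 1 := fun i => rfl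
  have h1 : a = σ + (a - σ) := by
    ext i; simp [hσ]
  obtain ⟨w', h⟩ := G.mon_surj σ (a - σ) w (fun i hi => by
    simp [hσ] at hi ⊢; omega)
  rw [← h1] at h
  rw [h]
  refine Submodule.smul_mem _ _ (Submodule.subset_span ⟨σ, fun i => ?_, G.pr_same _ _⟩)
  simp [hσ]

theorem gens [Module.Finite (MvPolynomial (Fin n) k) W] : ∃ T : Finset W,
    (∀ w ∈ T, ∃ σ : Fin n →₀ ℕ, (∀ i, σ i ≤ 1) ∧ G.pr σ w = w) ∧
    Submodule.span (MvPolynomial (Fin n) k) (T : Set W) = ⊤ := by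
  have h := G.gens_span
  have h1 : (Submodule.span (MvPolynomial (Fin n) k)
    {w : W | ∃ σ : Fin n →₀ ℕ, (∀ i, σ i ≤ 1) ∧ G.pr σ w = w}).FG := by
    rw [h]; exact Module.Finite.fg_top
  rw [Submodule.fg_span_iff_fg_span_finset_subset] at h1
  obtain ⟨T, h2, h3⟩ := h1
  exact ⟨T, fun w hw => h2 hw, by rw [← h3, h]⟩

theorem free [Module.Finite (MvPolynomial (Fin n) k) W] : ∃ (ι : Type) (_ : Fintype ι)
    (GF : SqGr k n (ι → MvPolynomial (Fin n) k)) (π : (ι → MvPolynomial (Fin n) k) →ₗ[MvPolynomial (Fin n) k] W),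
    Function.Surjective π ∧ Hm GF G π := by
  obtain ⟨T, hT, hs⟩ := G.gens
  choose σ h1 h2 using fun w : T => hT w.1 w.2
  refine ⟨T, inferInstance, pi _ fun j => shift (σ j) (h1 j), Fintype.linearCombination _ (fun j : T => (j : W)), ?_, ?_⟩
  · rw [← LinearMap.range_eq_top, Fintype.range_linearCombination]
    simpa using hs
  · intro a p
    rw [Fintype.linearCombination_apply, Fintype.linearCombination_apply, map_sum]
    refine Finset.sum_congr rfl fun j _ => ?_
    have := G.pr_smul a (σ j) (p j) j
    rw [h2] at this
    exact this.symm

/-- The constant one exponent. -/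
noncomputable def one1 : Fin n →₀ ℕ := Finsupp.equivFunOnFinite.symm fun _ => 1
/-- S(-1). -/
noncomputable abbrev SS : SqGr k n (MvPolynomial (Fin n) k) := shift one1 (fun _ => le_rfl)

/-- Additive hom projection. -/
noncomputable def hprA (a : Fin n →₀ ℕ) (φ : W →ₗ[MvPolynomial (Fin n) k] MvPolynomial (Fin n) k) :
    W →+ MvPolynomial (Fin n) k :=
  G.D fun b => (SS.pr (a + b)).comp φ.toAddMonoidHom

theorem hprA_pr (a φ b w) : G.hprA a φ (G.pr b w) = SS.pr (a + b) (φ (G.pr b w)) :=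
  G.D_pr _ b w

/-- Linear hom projection. -/
noncomputable def hpr (a : Fin n →₀ ℕ) (φ : W →ₗ[MvPolynomial (Fin n) k] MvPolynomial (Fin n) k) :
    W →ₗ[MvPolynomial (Fin n) k] MvPolynomial (Fin n) k where
  toFun := G.hprA a φ
  map_add' := map_add _
  map_smul' p := by
    simp only [RingHom.id_apply]
    induction p using MvPolynomial.induction_on with
    | C c =>
      refine fun w => G.ind (P := fun w => G.hprA a φ (_ • w) = _ • G.hprA a φ w) (by simp)
        (fun x y hx hy => by rw [smul_add, map_add, hx, hy, map_add, smul_add]) (fun b w => ?_) w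
      rw [← G.pr_C, hprA_pr, hprA_pr, G.pr_C, map_smul, SS.pr_C]
    | add p q hp hq => intro w; rw [add_smul, map_add, hp, hq, add_smul]
    | mul_X p i hp =>
      intro w
      rw [mul_smul, hp, mul_smul]
      congr 1
      refine G.ind (P := fun w => G.hprA a φ (_ • w) = _ • G.hprA a φ w) (by simp)
        (fun x y hx hy => by rw [smul_add, map_add, hx, hy, map_add, smul_add]) (fun b w => ?_) w
      rw [G.X_pr, hprA_pr, ← G.X_pr, hprA_pr, map_smul, ← add_assoc, SS.pr_X]

theorem hpr_pr (a φ b w) : G.hpr a φ (G.pr b w) = SS.pr (a + b) (φ (G.pr b w)) :=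
  G.D_pr _ b w

theorem hom_ext {φ ψ : W →ₗ[MvPolynomial (Fin n) k] V} (h : ∀ b w, φ (G.pr b w) = ψ (G.pr b w)) : φ = ψ := by
  ext w
  exact G.ind (P := fun w => φ w = ψ w) (by simp) (fun x y hx hy => by rw [map_add, map_add, hx, hy]) h w

theorem SS_ne {c : Fin n →₀ ℕ} {p : MvPolynomial (Fin n) k} (h : SS.pr c p ≠ 0) : one1 ≤ c := by
  by_contra h'
  exact h (shp_not h' p)

theorem hfin [Module.Finite (MvPolynomial (Fin n) k) W]
    (φ : W →ₗ[MvPolynomial (Fin n) k] MvPolynomial (Fin n) k) : ∃ s : Finset (Fin n →₀ ℕ), ∑ a ∈ s, G.hpr a φ = φ := by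
  classical
  obtain ⟨T, hT, hs⟩ := G.gens
  choose σ h1 h2 using fun w : T => hT w.1 w.2
  refine ⟨Finset.univ.biUnion fun j : T => (SS.fin (φ j)).toFinset.image (· - σ j), ?_⟩
  refine LinearMap.ext_on hs fun w hw => ?_
  let j : T := ⟨w, hw⟩
  have hj : w = G.pr (σ j) w := (h2 j).symm
  rw [LinearMap.sum_apply]
  have h3 : ∀ a, G.hpr a φ w = SS.pr (a + σ j) (φ w) := fun a => by
    rw [hj, hpr_pr]
  simp only [h3]
  rw [← Finset.sum_image (f := fun c => SS.pr c (φ w)) (g := (· + σ j)) (fun x _ y _ h => add_right_cancel h)]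
  refine SS.sum_of _ _ fun c hc => ?_
  simp only [Finset.mem_image, Finset.mem_biUnion, Finset.mem_univ, true_and]
  refine ⟨c - σ j, ⟨j, c, by simpa using hc, rfl⟩, tsub_add_cancel_of_le ?_⟩
  exact le_trans (fun i => h1 j i) (SS_ne hc)

/-- Hom into S(-1). -/
noncomputable def hom [Module.Finite (MvPolynomial (Fin n) k) W] :
    SqGr k n (W →ₗ[MvPolynomial (Fin n) k] MvPolynomial (Fin n) k) where
  pr a := { toFun := G.hpr a
            map_zero' := G.hom_ext fun b w => by rw [hpr_pr]; simp
            map_add' := fun φ ψ => G.hom_ext fun b w => by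
              rw [LinearMap.add_apply, hpr_pr, hpr_pr, hpr_pr, LinearMap.add_apply, map_add] }
  pr_C a c φ := G.hom_ext fun b w => by
    change G.hpr a (C c • φ) (G.pr b w) = (C c : MvPolynomial (Fin n) k) • G.hpr a φ (G.pr b w)
    rw [hpr_pr, hpr_pr, LinearMap.smul_apply, SS.pr_C]
  pr_same a φ := G.hom_ext fun b w => by
    change G.hpr _ (G.hpr _ _) _ = G.hpr _ _ _
    rw [hpr_pr, hpr_pr, SS.pr_same]
  pr_ne a b φ h := G.hom_ext fun c w => by
    change G.hpr _ (G.hpr _ _) _ = 0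
    rw [hpr_pr, hpr_pr, SS.pr_ne]
    exact fun h' => h (add_right_cancel h')
  sum := G.hfin
  pr_X a i φ := G.hom_ext fun b w => by
    change G.hpr (a + Finsupp.single i 1) ((X i : MvPolynomial (Fin n) k) • φ) (G.pr b w) = (X i : MvPolynomial (Fin n) k) • G.hpr a φ (G.pr b w)
    rw [hpr_pr, hpr_pr, LinearMap.smul_apply, add_right_comm, SS.pr_X]
  inj a i φ hi h := by
    ext w
    have := LinearMap.congr_fun h w
    rw [LinearMap.smul_apply, smul_eq_mul] at this
    rw [(mul_eq_zero.1 this).resolve_left (X_ne_zero i)]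
    rfl
  surj a i φ hi := by
    have h1 : ∀ w, ∃ p, G.hpr (a + Finsupp.single i 1) φ w = X i * p := by
      intro w
      refine G.ind (P := fun w => ∃ p, G.hpr (a + Finsupp.single i 1) φ w = X i * p) ⟨0, by simp⟩ ?_ ?_ w
      · rintro x y ⟨p, hp⟩ ⟨q, hq⟩
        exact ⟨p + q, by rw [map_add, hp, hq, mul_add]⟩
      · intro b w
        rw [hpr_pr, add_right_comm]
        obtain ⟨w', h⟩ := SS.surj (a + b) i (φ (G.pr b w)) (by simp; omega)
        exact ⟨_, h⟩
    choose f hf using h1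
    have hX : (X i : MvPolynomial (Fin n) k) ≠ 0 := X_ne_zero i
    let ψ : W →ₗ[MvPolynomial (Fin n) k] MvPolynomial (Fin n) k :=
      { toFun := f
        map_add' := fun x y => mul_left_cancel₀ hX (by rw [mul_add, ← hf, ← hf, ← hf, map_add])
        map_smul' := fun p x => mul_left_cancel₀ hX (by
          rw [← hf, map_smul, hf, RingHom.id_apply, smul_eq_mul, smul_eq_mul]; ring) }
    have hψ : (X i : MvPolynomial (Fin n) k) • ψ = G.hpr (a + Finsupp.single i 1) φ := by
      ext w : 1
      exact (hf w).symm
    refine ⟨ψ, ?_⟩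
    refine G.hom_ext fun b w => ?_
    change G.hpr (a + Finsupp.single i 1) φ (G.pr b w) = (X i : MvPolynomial (Fin n) k) • G.hpr a ψ (G.pr b w)
    rw [hpr_pr, hpr_pr, ← SS.pr_X, ← LinearMap.smul_apply, hψ, hpr_pr]
    rw [add_right_comm, SS.pr_same]

theorem hom_nat [Module.Finite (MvPolynomial (Fin n) k) W] [Module.Finite (MvPolynomial (Fin n) k) V]
    {G : SqGr k n W} {H : SqGr k n V} {f : W →ₗ[MvPolynomial (Fin n) k] V} (hf : Hm G H f) :
    Hm H.hom G.hom (LinearMap.lcomp _ (MvPolynomial (Fin n) k) f) := by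
  intro a φ
  refine G.hom_ext fun b w => ?_
  change H.hpr _ _ (f _) = G.hpr _ _ _
  rw [hpr_pr, hf, hpr_pr, LinearMap.lcomp_apply, hf]

end
end SqGr
end

section
set_option linter.unusedSectionVars false

namespace SqGr
section
open MvPolynomial
variable {k : Type} [Field k] {n : ℕ}

theorem exSq (i : ℕ) : ∀ (W : Type) [AddCommGroup W] [Module (MvPolynomial (Fin n) k) W]
    [Module.Finite (MvPolynomial (Fin n) k) W] (_ : SqGr k n W),
    Nonempty (SqGr k n (EX (MvPolynomial (Fin n) k) W (MvPolynomial (Fin n) k) i)) := by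
  induction i with
  | zero =>
    intro W _ _ _ G
    exact ⟨G.hom.congr (EX.zeroEquiv _ _ _).symm⟩
  | succ i ih =>
    intro W _ _ _ G
    obtain ⟨ι, _, GF, π, hπ, hm⟩ := G.free
    let f := (LinearMap.ker π).subtype
    have hex : Function.Exact f π := by
      intro x
      rw [← LinearMap.mem_ker]
      simp [f]
    obtain ⟨δ, h1, h2, h3⟩ := EX.les (MvPolynomial (Fin n) k) f π (Submodule.subtype_injective _) hπ hex
    have hδ : Function.Surjective (δ i) := by
      intro e
      have : Subsingleton (EX (MvPolynomial (Fin n) k) (ι → MvPolynomial (Fin n) k) (MvPolynomial (Fin n) k) (i+1)) :=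
        EX.subsingleton_projective i
      exact (h3 i e).1 (Subsingleton.elim _ _)
    have GK := GF.sub hm.ker
    cases i with
    | zero =>
      have hmf : Hm (GF.sub hm.ker) GF f := fun a w => rfl
      have hr := (hom_nat hmf).range
      let E := (δ 0) ∘ₗ (EX.zeroEquiv (MvPolynomial (Fin n) k) (LinearMap.ker π) (MvPolynomial (Fin n) k)).symm.toLinearMap
      have hE : Function.Surjective E := hδ.comp (LinearEquiv.surjective _)
      have hk : LinearMap.ker E = LinearMap.range (LinearMap.lcomp (MvPolynomial (Fin n) k) (MvPolynomial (Fin n) k) f) := by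
        ext φ
        rw [LinearMap.mem_ker]
        change δ 0 _ = 0 ↔ _
        rw [h2 0]
        constructor
        · rintro ⟨e, he⟩
          refine ⟨EX.zeroEquiv _ _ _ e, ?_⟩
          have := EX.zeroEquiv_pre (N := MvPolynomial (Fin n) k) f e
          rw [he] at this
          simp at this
          exact this.symm
        · rintro ⟨ψ, rfl⟩
          exact ⟨(EX.zeroEquiv _ _ _).symm ψ, EX.pre_zeroEquiv_symm f ψ⟩
      rw [← hk] at hr
      exact ⟨(quo _ hr).congr (E.quotKerEquivOfSurjective hE)⟩
    | succ i =>
      obtain ⟨g⟩ := ih (LinearMap.ker π) GK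
      refine ⟨g.congr (LinearEquiv.ofBijective (δ (i+1)) ⟨?_, hδ⟩)⟩
      rw [injective_iff_map_eq_zero]
      intro e he
      obtain ⟨e', rfl⟩ := (h2 (i+1) e).1 he
      have : Subsingleton (EX (MvPolynomial (Fin n) k) (ι → MvPolynomial (Fin n) k) (MvPolynomial (Fin n) k) (i+1)) :=
        EX.subsingleton_projective i
      rw [Subsingleton.elim e' 0, map_zero]

/-- The structure on the Stanley-Reisner ring. -/
theorem srSq (Δ : SC n) : Nonempty (SqGr k n (SRRing k Δ)) := by
  let G : SqGr k n (MvPolynomial (Fin n) k) := shift 0 (by simp)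
  have h : G.Good (srIdeal k Δ) := by
    have hpr : ∀ a p, G.pr a p = monomial a (coeff a p) := by
      intro a p
      refine (shp_of zero_le p).trans ?_
      rw [tsub_zero]
    constructor
    · intro a p hp
      rw [SRL.mem_sr] at hp ⊢
      rw [hpr]
      intro m hm
      rw [mem_support_iff, coeff_monomial] at hm
      split_ifs at hm with h
      · subst h; exact hp _ (mem_support_iff.2 hm)
      · exact absurd rfl hm
    · intro a i p hi hp
      rw [SRL.mem_sr] at hp ⊢
      rw [hpr] at hp ⊢
      intro m hm
      rw [mem_support_iff, coeff_monomial] at hm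
      split_ifs at hm with h
      · subst h
        have := hp (a + Finsupp.single i 1) (by
          rw [mem_support_iff, smul_eq_mul, mul_comm, coeff_mul_X, coeff_monomial, if_pos rfl]
          exact hm)
        have h5 : a.support = (a + Finsupp.single i 1).support := ?_
        · rwa [h5]
        ext j
        rcases eq_or_ne i j with rfl | hij
        · simp; omega
        · simp [Finsupp.single_apply, hij]
      · exact absurd rfl hm
  exact ⟨G.quo h⟩

theorem srExSq (Δ : SC n) (i : ℕ) : Nonempty (SqGr k n (EX (MvPolynomial (Fin n) k) (SRRing k Δ) (MvPolynomial (Fin n) k) i)) := by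
  obtain ⟨g⟩ := srSq (k := k) Δ
  exact exSq i _ g

end
end SqGr
end

section
set_option linter.unusedSectionVars false

namespace SRL
section
open MvPolynomial
variable {k : Type} [Field k] {n : ℕ} {Δ : SC n}

theorem notin_PS (v : Fin n) (s : MvPolynomial (Fin n) k) :
    s ∉ PS k (Finset.univ.erase v) ↔ ∃ j, coeff (Finsupp.single v j) s ≠ 0 := by
  rw [mem_PS]
  push Not
  constructor
  · rintro ⟨m, hm, h⟩
    refine ⟨m v, ?_⟩
    have : m = Finsupp.single v (m v) := by
      ext i
      rcases eq_or_ne i v with rfl | hi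
      · simp
      · rw [h i (by simp [hi]), Finsupp.single_eq_of_ne hi]
    rw [← this]
    exact mem_support_iff.1 hm
  · rintro ⟨j, hj⟩
    refine ⟨_, mem_support_iff.2 hj, fun i hi => ?_⟩
    have : i ≠ v := by simpa using hi
    exact Finsupp.single_eq_of_ne this

variable {ω : Type} [AddCommGroup ω] [Module (SRRing k Δ) ω] [Module (MvPolynomial (Fin n) k) ω]
  [IsScalarTower (MvPolynomial (Fin n) k) (SRRing k Δ) ω]

theorem mk_smul (p : MvPolynomial (Fin n) k) (m : ω) : (Ideal.Quotient.mk (srIdeal k Δ) p) • m = p • m :=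
  IsScalarTower.algebraMap_smul (SRRing k Δ) p m

variable (Δ) in
theorem I_smul (p : MvPolynomial (Fin n) k) (hp : p ∈ srIdeal k Δ) (m : ω) : p • m = 0 := by
  rw [← mk_smul (Δ := Δ), Ideal.Quotient.eq_zero_iff_mem.2 hp]
  exact zero_smul (SRRing k Δ) m

/-- local generator -/
def LG (Δ : SC n) (v : Fin n) (g : ω) : Prop :=
  (∀ m : ω, ∃ s ∉ PS k (Finset.univ.erase v), ∃ r : MvPolynomial (Fin n) k, s • m = r • g) ∧
    ∀ r : MvPolynomial (Fin n) k, r • g = 0 → ∃ s ∉ PS k (Finset.univ.erase v), s * r ∈ srIdeal k Δ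

theorem nmul {s : Finset (Fin n)} {p q : MvPolynomial (Fin n) k} (hp : p ∉ PS k s) (hq : q ∉ PS k s) :
    p * q ∉ PS k s := fun h => ((inferInstance : (PS k s).IsPrime).mem_or_mem h).elim hp hq

theorem LG_comp (G : SqGr k n ω) {v : Fin n} (hv : {v} ∈ Δ.faces) {g : ω} (h : LG (k := k) Δ v g) :
    ∃ a, LG (k := k) Δ v (G.pr a g) := by
  classical
  have hIP := sr_le_PS (k := k) (Δ := Δ) (Finset.univ.erase v) (by
    have : (Finset.univ.erase v)ᶜ = {v} := by ext; simp
    rwa [this])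
  obtain ⟨t, ht⟩ := G.sum g
  choose s hs r hr using fun a => h.1 (G.pr a g)
  have key : ∃ a, r a ∉ PS k (Finset.univ.erase v) := by
    by_contra! hall
    have h1 : ∏ a ∈ t, s a ∉ PS k (Finset.univ.erase v) := by
      intro h'
      obtain ⟨a, _, ha⟩ := (Ideal.IsPrime.prod_mem_iff).1 h'
      exact hs a ha
    have h2 : (∏ a ∈ t, s a) • g = (∑ a ∈ t, (∏ b ∈ t.erase a, s b) * r a) • g := by
      conv_lhs => rw [← ht]
      rw [Finset.smul_sum, Finset.sum_smul]
      refine Finset.sum_congr rfl fun a ha => ?_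
      rw [← Finset.mul_prod_erase _ _ ha, mul_comm, mul_smul, hr, mul_smul]
    have h3 : ((∏ a ∈ t, s a) - ∑ a ∈ t, (∏ b ∈ t.erase a, s b) * r a) • g = 0 := by
      rw [sub_smul, h2, sub_self]
    obtain ⟨u, hu, hu'⟩ := h.2 _ h3
    have h4 := ((inferInstance : (PS k (Finset.univ.erase v)).IsPrime).mem_or_mem (hIP hu')).resolve_left hu
    apply h1
    have h5 : ∑ a ∈ t, (∏ b ∈ t.erase a, s b) * r a ∈ PS k (Finset.univ.erase v) :=
      Ideal.sum_mem _ fun a _ => Ideal.mul_mem_left _ _ (hall a)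
    simpa using Ideal.add_mem _ h4 h5
  obtain ⟨a, ha⟩ := key
  refine ⟨a, fun m => ?_, fun q hq => ?_⟩
  · obtain ⟨s', hs', r', hr'⟩ := h.1 m
    refine ⟨r a * s', nmul ha hs', r' * s a, ?_⟩
    rw [mul_smul, hr', mul_smul, hr, ← mul_smul, ← mul_smul, mul_comm]
  · have : (q * r a) • g = 0 := by rw [mul_smul, ← hr, ← mul_smul, mul_comm, mul_smul, hq, smul_zero]
    obtain ⟨u, hu, hu'⟩ := h.2 _ this
    exact ⟨u * r a, nmul hu ha, by rwa [mul_assoc, mul_comm (r a)]⟩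

/-- Homogeneous generator data at a vertex. -/
structure GenD (Δ : SC n) (G : SqGr k n ω) (v : Fin n) (g : ω) (σ : Fin n →₀ ℕ) : Prop where
  le1 : ∀ i, σ i ≤ 1
  hv : σ v = 1
  deg : G.pr σ g = g
  gen : ∀ b m, G.pr b m = m → 1 ≤ b v → σ ≤ b →
    ∃ c : k, m = (monomial (b - σ) c : MvPolynomial (Fin n) k) • g
  gen0 : ∀ b m, G.pr b m = m → 1 ≤ b v → ¬ σ ≤ b → m = 0
  ann : ∀ e, (monomial e 1 : MvPolynomial (Fin n) k) • g = 0 ↔ insert v e.support ∉ Δ.faces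

theorem mon_face {e : Fin n →₀ ℕ} {c : k} (h : e.support ∉ Δ.faces) :
    (monomial e c : MvPolynomial (Fin n) k) ∈ srIdeal k Δ := by
  classical
  rw [mem_sr]
  intro m hm
  rw [mem_support_iff, coeff_monomial] at hm
  split_ifs at hm with h'
  · rwa [← h']
  · exact absurd rfl hm

theorem mon_unit {b : Fin n →₀ ℕ} {c : k} (hc : c ≠ 0) {m : ω}
    (h : (monomial b c : MvPolynomial (Fin n) k) • m = 0) : (monomial b 1 : MvPolynomial (Fin n) k) • m = 0 := by
  have : (monomial b 1 : MvPolynomial (Fin n) k) = C c⁻¹ * monomial b c := by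
    rw [C_mul_monomial, inv_mul_cancel₀ hc]
  rw [this, mul_smul, h, smul_zero]

theorem exists_GenD (G : SqGr k n ω) {v : Fin n} (hv : {v} ∈ Δ.faces) {g : ω} (h : LG (k := k) Δ v g) :
    ∃ g' σ, GenD Δ G v g' σ := by
  classical
  obtain ⟨a, ha⟩ := LG_comp G hv h
  have hXP : (X v : MvPolynomial (Fin n) k) ∉ PS k (Finset.univ.erase v) := by
    rw [notin_PS]; exact ⟨1, by simp [X]⟩
  let a' := a + Finsupp.single v 1
  let σ : Fin n →₀ ℕ := Finsupp.equivFunOnFinite.symm fun i => min (a' i) 1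
  have hσ : ∀ i, σ i = min (a' i) 1 := fun i => rfl
  have h1 : a' = σ + (a' - σ) := by
    ext i; simp [hσ]
  obtain ⟨w', hw⟩ := G.mon_surj σ (a' - σ) ((X v : MvPolynomial (Fin n) k) • G.pr a g) (fun i hi => by
    simp [hσ] at hi ⊢; omega)
  rw [← h1, ← G.X_pr] at hw
  have hσv : σ v = 1 := by simp [hσ, a']
  set g0 := G.pr σ w' with hg0
  have hLG : LG (k := k) Δ v g0 := by
    constructor
    · intro m
      obtain ⟨s, hs, r, hr⟩ := ha.1 m
      refine ⟨X v * s, nmul hXP hs, r * monomial (a' - σ) 1, ?_⟩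
      rw [mul_smul, hr, mul_smul, ← hw, ← mul_smul, ← mul_smul, mul_comm]
    · intro r hr
      have : (r * X v) • G.pr a g = 0 := by
        rw [mul_smul, hw, ← mul_smul, mul_comm, mul_smul, hr, smul_zero]
      obtain ⟨s, hs, h⟩ := ha.2 _ this
      exact ⟨s * X v, nmul hs hXP, by rwa [mul_assoc, mul_comm (X v)]⟩
  have hd0 : G.pr σ g0 = g0 := G.pr_same _ _
  have hkey : ∀ b m, G.pr b m = m → 1 ≤ b v → ∃ j : ℕ, ∃ c : k, ∃ r : MvPolynomial (Fin n) k, c ≠ 0 ∧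
      (monomial (Finsupp.single v j) c : MvPolynomial (Fin n) k) • m = SqGr.shp σ (b + Finsupp.single v j) r • g0 := by
    intro b m hm hb
    obtain ⟨s, hs, r, hr⟩ := hLG.1 m
    obtain ⟨j, hj⟩ := (notin_PS v s).1 hs
    refine ⟨j, _, r, hj, ?_⟩
    have h2 := G.pr_smul (b + Finsupp.single v j) b s m
    have h3 := G.pr_smul (b + Finsupp.single v j) σ r g0
    rw [hm] at h2
    rw [hd0] at h3
    rw [← h3, ← hr, h2, SqGr.shp_of le_self_add, add_tsub_cancel_left]
  have hle : ∀ b : Fin n →₀ ℕ, ∀ j, 1 ≤ b v → σ ≤ b + Finsupp.single v j → σ ≤ b := by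
    intro b j hb h i
    rcases eq_or_ne i v with rfl | hi
    · rw [hσv]; exact hb
    · have := h i
      simpa [hi.symm] using this
  have hinj : ∀ b m j, G.pr b m = m → 1 ≤ b v → (monomial (Finsupp.single v j) 1 : MvPolynomial (Fin n) k) • m = 0 →
      m = 0 := by
    intro b m j hm hb h0
    rw [← hm] at h0 ⊢
    refine G.mon_inj b _ m (fun i hi => ?_) h0
    rcases eq_or_ne i v with rfl | hiv
    · exact hb
    · simp [hiv.symm] at hi
  refine ⟨g0, σ, fun i => by simp [hσ], hσv, hd0, ?_, ?_, ?_⟩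
  · intro b m hm hb hsb
    obtain ⟨j, c, r, hc, h⟩ := hkey b m hm hb
    rw [SqGr.shp_of (hsb.trans le_self_add)] at h
    set c' := coeff (b + Finsupp.single v j - σ) r
    refine ⟨c⁻¹ * c', ?_⟩
    rw [← sub_eq_zero]
    have hdeg : G.pr b (m - (monomial (b - σ) (c⁻¹ * c') : MvPolynomial (Fin n) k) • g0) =
        m - (monomial (b - σ) (c⁻¹ * c') : MvPolynomial (Fin n) k) • g0 := by
      rw [map_sub, hm]
      congr 1
      have := G.pr_mon σ (b - σ) (c⁻¹ * c') g0
      rwa [add_tsub_cancel_of_le hsb, hd0] at this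
    refine hinj b _ j hdeg hb (mon_unit hc ?_)
    rw [smul_sub, h, ← mul_smul, monomial_mul, mul_inv_cancel_left₀ hc, ← tsub_add_eq_add_tsub hsb, add_comm, sub_self]
  · intro b m hm hb hsb
    obtain ⟨j, c, r, hc, h⟩ := hkey b m hm hb
    rw [SqGr.shp_not (fun h' => hsb (hle b j hb h')), zero_smul] at h
    exact hinj b m j hm hb (mon_unit hc h)
  · intro e
    constructor
    · intro h0
      obtain ⟨s, hs, h⟩ := hLG.2 _ h0
      obtain ⟨j, hj⟩ := (notin_PS v s).1 hs
      rw [mem_sr] at h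
      have h2 := h (Finsupp.single v j + e) (by
        rw [mem_support_iff, coeff_mul_monomial, mul_one]; exact hj)
      intro h3
      refine h2 (Δ.down_closed h3 ?_)
      intro i hi
      rcases eq_or_ne i v with rfl | hiv
      · simp
      · simp [hiv.symm] at hi ⊢
        exact Or.inr hi
    · intro h0
      have h2 : (monomial (e + Finsupp.single v 1) 1 : MvPolynomial (Fin n) k) ∈ srIdeal k Δ := by
        apply mon_face
        convert h0 using 2
        ext i
        rcases eq_or_ne i v with rfl | hiv
        · simp
        · simp [hiv]
      have h3 := I_smul Δ _ h2 g0
      have h4 : (monomial (e + Finsupp.single v 1) 1 : MvPolynomial (Fin n) k) = monomial (Finsupp.single v 1) 1 * monomial e 1 := by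
        rw [monomial_mul, one_mul, add_comm]
      rw [h4, mul_smul] at h3
      refine hinj (σ + e) _ 1 ?_ (by simp; omega) h3
      rw [G.pr_mon, hd0]

end
end SRL
end

section
set_option linter.unusedSectionVars false

namespace SRL
/-- Polynomial ring. -/
abbrev PR (k : Type) [Field k] (n : ℕ) := MvPolynomial (Fin n) k
section
open MvPolynomial
variable {k : Type} [Field k] {n : ℕ} {Δ : SC n}
variable {ω : Type} [AddCommGroup ω] [Module (SRRing k Δ) ω] [Module (PR k n) ω]
  [IsScalarTower (PR k n) (SRRing k Δ) ω] {G : SqGr k n ω}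

/-- the quotient map -/
noncomputable abbrev qm (k : Type) [Field k] {n : ℕ} (Δ : SC n) : PR k n →+* SRRing k Δ := Ideal.Quotient.mk (srIdeal k Δ)

theorem mk_eq_zero (p : PR k n) : qm k Δ p = 0 ↔ p ∈ srIdeal k Δ := Ideal.Quotient.eq_zero_iff_mem

theorem f_smul (f : ω →ₗ[SRRing k Δ] SRRing k Δ) (p : PR k n) (m : ω) : f (p • m) = qm k Δ p * f m := by
  rw [← mk_smul (Δ := Δ)]
  exact f.map_smul _ _

theorem face_of_ne {a : Fin n →₀ ℕ} {m : ω} (hm : G.pr a m = m) (h : m ≠ 0) : a.support ∈ Δ.faces := by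
  by_contra h'
  apply h
  rw [← hm]
  refine G.mon_inj a a m (fun i hi => Nat.one_le_iff_ne_zero.2 hi) ?_
  exact I_smul Δ _ (mon_face h') _

theorem supp_add (a b : Fin n →₀ ℕ) : (a + b).support = a.support ∪ b.support := by
  classical
  ext i
  simp
  tauto

theorem GenD.ne {v : Fin n} {g : ω} {σ : Fin n →₀ ℕ} (D : GenD Δ G v g σ) (hv : {v} ∈ Δ.faces) : g ≠ 0 := by
  intro h
  have := (D.ann 0).1 (by rw [h, smul_zero])
  simp [hv] at this

theorem GenD.face {v : Fin n} {g : ω} {σ : Fin n →₀ ℕ} (D : GenD Δ G v g σ) (e : Fin n →₀ ℕ)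
    (h : insert v e.support ∈ Δ.faces) : σ.support ∪ e.support ∈ Δ.faces := by
  classical
  have h1 : (monomial e 1 : PR k n) • g ≠ 0 := fun h' => (D.ann e).1 h' h
  rw [← supp_add]
  refine face_of_ne (G := G) ?_ h1
  rw [G.pr_mon, D.deg]

theorem GenD.annS {v : Fin n} {g : ω} {σ : Fin n →₀ ℕ} (D : GenD Δ G v g σ) (r : PR k n) (hr : r • g = 0) :
    r * X v ∈ srIdeal k Δ := by
  classical
  rw [mem_sr]
  intro m hm
  rw [mem_support_iff, coeff_mul_X'] at hm
  split_ifs at hm with h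
  · set e := m - Finsupp.single v 1
    have h1 := G.pr_smul (σ + e) σ r g
    rw [D.deg, hr, map_zero, SqGr.shp_of le_self_add, add_tsub_cancel_left] at h1
    have h2 := (D.ann e).1 (mon_unit hm h1.symm)
    have h3 : m = e + Finsupp.single v 1 := by
      refine (tsub_add_cancel_of_le ?_).symm
      rw [Finsupp.single_le_iff]
      exact Nat.one_le_iff_ne_zero.2 (Finsupp.mem_support_iff.1 h)
    have h4 : m.support = insert v e.support := by
      rw [h3, supp_add, Finsupp.support_single _ one_ne_zero, Finset.union_comm]; rfl
    rwa [h4]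
  · exact absurd rfl hm

theorem GenD.xgen {v : Fin n} {g : ω} {σ : Fin n →₀ ℕ} (D : GenD Δ G v g σ) (m : ω) :
    ∃ r : PR k n, (X v : PR k n) • m = r • g := by
  refine G.ind (P := fun m => ∃ r : PR k n, (X v : PR k n) • m = r • g) ⟨0, by simp⟩ ?_ ?_ m
  · rintro x y ⟨p, hp⟩ ⟨q, hq⟩
    exact ⟨p + q, by rw [smul_add, hp, hq, add_smul]⟩
  · intro a m
    have h := (G.X_pr a v m).symm
    by_cases hs : σ ≤ a + Finsupp.single v 1
    · obtain ⟨c, hc⟩ := D.gen _ _ h (by simp) hs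
      exact ⟨_, hc⟩
    · exact ⟨0, by rw [D.gen0 _ _ h (by simp) hs, zero_smul]⟩

theorem lemmaH (g : ω) (z y : PR k n) (h1 : ∀ m : ω, ∃ r : PR k n, z • m = r • g)
    (h2 : ∀ r : PR k n, r • g = 0 → r * y ∈ srIdeal k Δ) :
    ∃ f : ω →ₗ[SRRing k Δ] SRRing k Δ, ∀ (m : ω) (r : PR k n), z • m = r • g → f m = qm k Δ (r * y) := by
  choose F hF using h1
  have key : ∀ (m : ω) (r : PR k n), z • m = r • g → qm k Δ (F m * y) = qm k Δ (r * y) := by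
    intro m r h
    rw [← sub_eq_zero, ← map_sub, mk_eq_zero, ← sub_mul]
    apply h2
    rw [sub_smul, ← h, hF, sub_self]
  refine ⟨{ toFun := fun m => qm k Δ (F m * y), map_add' := fun a b => ?_, map_smul' := fun p a => ?_ }, key⟩
  · rw [← map_add, ← add_mul]
    apply key
    rw [smul_add, add_smul, hF, hF]
  · obtain ⟨p, rfl⟩ := Ideal.Quotient.mk_surjective p
    rw [RingHom.id_apply, smul_eq_mul]
    change _ = qm k Δ p * _
    rw [← map_mul, ← mul_assoc]
    apply key
    rw [mk_smul, mul_smul, ← hF, ← mul_smul, ← mul_smul, mul_comm]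

theorem GenD.fv {v : Fin n} {g : ω} {σ : Fin n →₀ ℕ} (D : GenD Δ G v g σ) :
    ∃ f : ω →ₗ[SRRing k Δ] SRRing k Δ, ∀ (m : ω) (r : PR k n), (X v : PR k n) • m = r • g →
      f m = qm k Δ (r * X v) :=
  lemmaH g _ _ D.xgen D.annS

theorem mem_tr (f : ω →ₗ[SRRing k Δ] SRRing k Δ) (m : ω) : f m ∈ traceIdeal (SRRing k Δ) ω := by
  unfold traceIdeal
  exact Submodule.mem_iSup_of_mem f ⟨m, rfl⟩

theorem C_mem {I : Ideal (SRRing k Δ)} {c : k} (hc : c ≠ 0) {p : PR k n} (h : qm k Δ (C c * p) ∈ I) :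
    qm k Δ p ∈ I := by
  have : p = C c⁻¹ * (C c * p) := by rw [← mul_assoc, ← C_mul, inv_mul_cancel₀ hc, C_1, one_mul]
  rw [this, map_mul]
  exact Ideal.mul_mem_left _ _ h

theorem edge_le {v w : Fin n} {g g' : ω} {σ τ : Fin n →₀ ℕ} (D : GenD Δ G v g σ) (D' : GenD Δ G w g' τ)
    (h : {v, w} ∈ Δ.faces) : τ ≤ σ + Finsupp.single w 1 := by
  classical
  by_contra hs
  have hdeg := (G.X_pr σ w g).symm
  rw [D.deg] at hdeg
  have h1 := D'.gen0 _ _ hdeg (by simp) hs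
  refine (D.ann (Finsupp.single w 1)).1 h1 ?_
  rwa [Finsupp.support_single _ one_ne_zero]

theorem edge {v w : Fin n} {g g' : ω} {σ τ : Fin n →₀ ℕ} (D : GenD Δ G v g σ) (D' : GenD Δ G w g' τ)
    (h : {v, w} ∈ Δ.faces) : ∃ c : k, c ≠ 0 ∧
      (X w : PR k n) • g = (monomial (σ + Finsupp.single w 1 - τ) c : PR k n) • g' := by
  classical
  have hdeg := (G.X_pr σ w g).symm
  rw [D.deg] at hdeg
  obtain ⟨c, hc⟩ := D'.gen _ _ hdeg (by simp) (edge_le D D' h)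
  refine ⟨c, ?_, hc⟩
  rintro rfl
  rw [monomial_zero, zero_smul] at hc
  refine (D.ann (Finsupp.single w 1)).1 hc ?_
  rwa [Finsupp.support_single _ one_ne_zero]

theorem edge_eq {v w : Fin n} {g g' : ω} {σ τ : Fin n →₀ ℕ} (D : GenD Δ G v g σ) (D' : GenD Δ G w g' τ)
    (h : {v, w} ∈ Δ.faces) (i : Fin n) (hv : i ≠ v) (hw : i ≠ w) : σ i = τ i := by
  have h1 := edge_le D D' h i
  have h2 := edge_le D' D (by rwa [Finset.pair_comm]) i
  simp [hv.symm, hw.symm] at h1 h2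
  omega

/-- the exponent in the edge relation -/
theorem edge_exp {v w : Fin n} (hvw : v ≠ w) {g g' : ω} {σ τ : Fin n →₀ ℕ} (D : GenD Δ G v g σ) (D' : GenD Δ G w g' τ)
    (h : {v, w} ∈ Δ.faces) : σ + Finsupp.single w 1 - τ =
      Finsupp.single w (σ w) + Finsupp.single v (1 - τ v) := by
  ext i
  have h3 := D.hv
  have h4 := D'.hv
  rcases eq_or_ne i v with rfl | hv
  · simp [h3, hvw.symm]
  · rcases eq_or_ne i w with rfl | hw
    · simp [h4, hv.symm]
    · have := edge_eq D D' h i hv hw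
      simp [hv.symm, hw.symm, this]

theorem C_smul_mon (c : k) (e : Fin n →₀ ℕ) : (monomial e c : PR k n) = C c * monomial e 1 := by
  rw [C_mul_monomial, mul_one]

/-- case (2) -/
theorem edge_mem {v w : Fin n} (hvw : v ≠ w) {g g' : ω} {σ τ : Fin n →₀ ℕ} (D : GenD Δ G v g σ) (D' : GenD Δ G w g' τ)
    (h : {v, w} ∈ Δ.faces) (h1 : σ w = 0) (h2 : τ v = 1) : qm k Δ (X w) ∈ traceIdeal (SRRing k Δ) ω := by
  obtain ⟨c, hc, hh⟩ := edge D D' h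
  rw [edge_exp hvw D D' h, h1, h2] at hh
  obtain ⟨f, hf⟩ := D'.fv
  have := mem_tr f g
  rw [hf _ _ hh] at this
  refine C_mem hc ?_
  simpa using this

theorem edge_prod {v w : Fin n} (hvw : v ≠ w) {g g' : ω} {σ τ : Fin n →₀ ℕ} (D : GenD Δ G v g σ) (D' : GenD Δ G w g' τ)
    (h : {v, w} ∈ Δ.faces) : qm k Δ (X v * X w) ∈ traceIdeal (SRRing k Δ) ω := by
  have hs1 := D.le1 w
  have hs2 := D'.le1 v
  have hcase : (σ w = 0 ∨ σ w = 1) ∧ (τ v = 0 ∨ τ v = 1) := by omega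
  obtain ⟨h1 | h1, h2 | h2⟩ := hcase
  · obtain ⟨c, hc, hh⟩ := edge D' D (by rwa [Finset.pair_comm])
    rw [edge_exp hvw.symm D' D (by rwa [Finset.pair_comm]), h1, h2] at hh
    obtain ⟨f, hf⟩ := D.fv
    have := mem_tr f g'
    rw [hf _ _ hh] at this
    refine C_mem hc ?_
    have h3 : (C c * (X v * X w) : PR k n) = (monomial (Finsupp.single v 0 + Finsupp.single w (1 - 0)) c) * X v := by
      rw [C_smul_mon]
      simp
      rw [← X]; ring
    rwa [h3]
  · rw [map_mul]
    exact Ideal.mul_mem_left _ _ (edge_mem hvw D D' h h1 h2)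
  · rw [map_mul]
    exact Ideal.mul_mem_right _ _ (edge_mem hvw.symm D' D (by rwa [Finset.pair_comm]) h2 h1)
  · obtain ⟨c, hc, hh⟩ := edge D D' h
    rw [edge_exp hvw D D' h, h1, h2] at hh
    simp at hh
    have hh2 : g = (C c : PR k n) • g' := by
      rw [← sub_eq_zero]
      have hd : τ = σ := by
        ext i
        rcases eq_or_ne i v with rfl | hv
        · rw [D.hv, h2]
        · rcases eq_or_ne i w with rfl | hw
          · rw [D'.hv, h1]
          · rw [edge_eq D D' h i hv hw]
      have hdeg : G.pr σ (g - (C c : PR k n) • g') = g - (C c : PR k n) • g' := by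
        rw [map_sub, D.deg, G.pr_C, ← hd, D'.deg]
      rw [← hdeg]
      refine G.inj σ w _ (by rw [h1]) ?_
      rw [hdeg, smul_sub, hh, ← mul_smul, C_smul_mon, mul_comm]
      exact sub_self _
    obtain ⟨f, hf⟩ := lemmaH (Δ := Δ) g (X v) (X w) D.xgen (fun r hr => by
      apply D'.annS
      rw [hh2, ← mul_smul, mul_comm, mul_smul] at hr
      have : r • g' = (C c⁻¹ : PR k n) • (C c : PR k n) • r • g' := by
        rw [← mul_smul, ← C_mul, inv_mul_cancel₀ hc, C_1, one_smul]
      rw [this, hr, smul_zero])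
    have := mem_tr f g
    rwa [hf _ _ rfl] at this

theorem X_zero {v : Fin n} (hv : {v} ∉ Δ.faces) : qm k Δ (X v) = 0 := by
  rw [mk_eq_zero]
  apply mon_face
  rwa [Finsupp.support_single _ one_ne_zero]

theorem XX_zero {v w : Fin n} (hv : {v, w} ∉ Δ.faces) : qm k Δ (X v * X w) = 0 := by
  classical
  rw [mk_eq_zero, X, X, monomial_mul]
  apply mon_face
  rwa [supp_add, Finsupp.support_single _ one_ne_zero, Finsupp.support_single _ one_ne_zero]

theorem sq_le (H : ∀ v, {v} ∈ Δ.faces → ∃ g σ, GenD Δ G v g σ) : srMax k Δ ^ 2 ≤ traceIdeal (SRRing k Δ) ω := by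
  classical
  rw [pow_two]
  unfold srMax quotMax
  rw [Ideal.span_mul_span', Ideal.span_le]
  rintro _ ⟨_, ⟨v, rfl⟩, _, ⟨w, rfl⟩, rfl⟩
  change qm k Δ (X v) * qm k Δ (X w) ∈ traceIdeal (SRRing k Δ) ω
  rw [← map_mul]
  by_cases h : {v, w} ∈ Δ.faces
  · have hv : {v} ∈ Δ.faces := Δ.down_closed h (by simp)
    have hw : {w} ∈ Δ.faces := Δ.down_closed h (by simp)
    obtain ⟨g, σ, D⟩ := H v hv
    obtain ⟨g', τ, D'⟩ := H w hw
    rcases eq_or_ne v w with rfl | hvw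
    · obtain ⟨f, hf⟩ := D.fv
      have := mem_tr f g
      rwa [hf _ _ rfl] at this
    · exact edge_prod hvw D D' h
  · rw [XX_zero h]; exact Ideal.zero_mem _

end
end SRL
end

section
set_option linter.unusedSectionVars false

namespace EXX
variable {A : Type} [CommRing A] (𝔪 : Ideal A)

theorem delta : ∃ δ : (𝔪 →ₗ[A] A) →ₗ[A] EX A (A ⧸ 𝔪) A 1, ∀ φ, δ φ = 0 → ∃ a : A, ∀ x : 𝔪, φ x = a * x := by
  obtain ⟨δ, h1, h2, h3⟩ := EX.les A 𝔪.subtype 𝔪.mkQ 𝔪.injective_subtype 𝔪.mkQ_surjective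
    (LinearMap.exact_subtype_mkQ 𝔪)
  refine ⟨(δ 0) ∘ₗ (EX.zeroEquiv A 𝔪 A).symm.toLinearMap, fun φ h => ?_⟩
  obtain ⟨y, hy⟩ := (h2 0 _).1 h
  refine ⟨EX.zeroEquiv A A A y 1, fun x => ?_⟩
  have h4 := congrArg (EX.zeroEquiv A 𝔪 A) hy
  rw [EX.zeroEquiv_pre] at h4
  have h5 : φ = (EX.zeroEquiv A A A y) ∘ₗ 𝔪.subtype := by
    rw [h4]; exact ((EX.zeroEquiv A 𝔪 A).apply_symm_apply φ).symm
  rw [h5]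
  change EX.zeroEquiv A A A y (x : A) = _
  conv_lhs => rw [← mul_one (x : A), ← smul_eq_mul, LinearMap.map_smul, smul_eq_mul, mul_comm]

theorem soc (h0 : Subsingleton (EX A (A ⧸ 𝔪) A 0)) (x : A) (hx : ∀ y ∈ 𝔪, y * x = 0) : x = 0 := by
  have h1 : Subsingleton ((A ⧸ 𝔪) →ₗ[A] A) := (EX.zeroEquiv A (A ⧸ 𝔪) A).symm.toEquiv.subsingleton
  let f : (A ⧸ 𝔪) →ₗ[A] A := 𝔪.liftQ (LinearMap.toSpanSingleton A A x) (fun y hy => hx y hy)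
  have h2 : f (𝔪.mkQ 1) = x := by
    simp only [f, Submodule.mkQ_apply]
    erw [Submodule.liftQ_apply]
    simp
  rw [← h2, Subsingleton.elim f 0]
  rfl

theorem proj (h0 : Subsingleton (EX A (A ⧸ 𝔪) A 0)) (J J' : Ideal A) (hJ : 𝔪 = J ⊔ J')
    (hm : ∀ x ∈ J, ∀ y ∈ J', x * y = 0) : ∃ ε : 𝔪 →ₗ[A] A, (∀ x : 𝔪, (x : A) ∈ J → ε x = x) ∧
      (∀ x : 𝔪, (x : A) ∈ J' → ε x = 0) := by
  have hint : ∀ x ∈ J, x ∈ J' → x = 0 := by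
    intro x hx hx'
    refine soc 𝔪 h0 x fun y hy => ?_
    rw [hJ, Submodule.mem_sup] at hy
    obtain ⟨a, ha, b, hb, rfl⟩ := hy
    rw [add_mul, hm a ha x hx', mul_comm, hm x hx b hb, add_zero]
  have hex : ∀ x : 𝔪, ∃ a ∈ J, ∃ b ∈ J', a + b = x := fun x => Submodule.mem_sup.1 (hJ ▸ x.2)
  choose a ha b hb hab using hex
  have key : ∀ x : 𝔪, ∀ u ∈ J, ∀ v ∈ J', u + v = x → a x = u := by
    intro x u hu v hv h
    rw [← sub_eq_zero]
    apply hint _ (J.sub_mem (ha x) hu)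
    have : a x - u = v - b x := by
      have := hab x
      rw [← h] at this
      linear_combination this
    rw [this]
    exact J'.sub_mem hv (hb x)
  refine ⟨{ toFun := a, map_add' := fun x y => ?_, map_smul' := fun r x => ?_ }, fun x hx => ?_, fun x hx => ?_⟩
  · refine key _ _ (J.add_mem (ha x) (ha y)) _ (J'.add_mem (hb x) (hb y)) ?_
    rw [Submodule.coe_add, ← hab x, ← hab y]; ring
  · refine key _ _ (J.smul_mem r (ha x)) _ (J'.smul_mem r (hb x)) ?_
    rw [Submodule.coe_smul, ← hab x, smul_add]; rfl
  · exact key x x hx 0 J'.zero_mem (add_zero _)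
  · exact key x 0 J.zero_mem x hx (zero_add _)

variable {ι : Type} (x : ι → A)

theorem span_mul_zero (P Q : ι → Prop) (h : ∀ i j, P i → Q j → x i * x j = 0) :
    ∀ u ∈ Ideal.span (x '' {i | P i}), ∀ v ∈ Ideal.span (x '' {i | Q i}), u * v = 0 := by
  intro u hu v hv
  have h1 : Ideal.span (x '' {i | P i}) * Ideal.span (x '' {i | Q i}) = ⊥ := by
    rw [Ideal.span_mul_span', Ideal.span_eq_bot]
    rintro _ ⟨_, ⟨i, hi, rfl⟩, _, ⟨j, hj, rfl⟩, rfl⟩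
    exact h i j hi hj
  have := Ideal.mul_mem_mul hu hv
  rwa [h1] at this

theorem span_sup (P : ι → Prop) : Ideal.span (Set.range x) =
    Ideal.span (x '' {i | P i}) ⊔ Ideal.span (x '' {i | ¬ P i}) := by
  rw [← Ideal.span_union, ← Set.image_union]
  congr 1
  rw [← Set.image_univ]
  congr 1
  ext i
  exact ⟨fun _ => em _, fun _ => trivial⟩

theorem projx (h0 : Subsingleton (EX A (A ⧸ 𝔪) A 0)) (h𝔪 : 𝔪 = Ideal.span (Set.range x)) (P : ι → Prop)
    (hP : ∀ i j, P i → ¬ P j → x i * x j = 0) : ∃ ε : 𝔪 →ₗ[A] A,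
      (∀ i (h : x i ∈ 𝔪), P i → ε ⟨x i, h⟩ = x i) ∧ (∀ i (h : x i ∈ 𝔪), ¬ P i → ε ⟨x i, h⟩ = 0) := by
  obtain ⟨ε, h1, h2⟩ := proj 𝔪 h0 _ _ (h𝔪.trans (span_sup x P)) (span_mul_zero x P _ hP)
  exact ⟨ε, fun i h hi => h1 ⟨x i, h⟩ (Ideal.subset_span ⟨i, hi, rfl⟩),
    fun i h hi => h2 ⟨x i, h⟩ (Ideal.subset_span ⟨i, hi, rfl⟩)⟩

theorem X2 (h0 : Subsingleton (EX A (A ⧸ 𝔪) A 0)) (h1 : Subsingleton (EX A (A ⧸ 𝔪) A 1))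
    (h𝔪 : 𝔪 = Ideal.span (Set.range x)) (P : ι → Prop)
    (hP : ∀ i j, P i → ¬ P j → x i * x j = 0) :
    ∃ a : A, (∀ i, P i → a * x i = x i) ∧ (∀ i, ¬ P i → a * x i = 0) := by
  have hx : ∀ i, x i ∈ 𝔪 := fun i => h𝔪 ▸ Ideal.subset_span ⟨i, rfl⟩
  obtain ⟨ε, e1, e2⟩ := projx 𝔪 x h0 h𝔪 P hP
  obtain ⟨δ, hδ⟩ := delta 𝔪
  obtain ⟨a, ha⟩ := hδ ε (Subsingleton.elim _ _)
  exact ⟨a, fun i hi => (ha ⟨x i, hx i⟩).symm.trans (e1 i (hx i) hi), fun i hi => (ha ⟨x i, hx i⟩).symm.trans (e2 i (hx i) hi)⟩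

theorem X3 (h0 : Subsingleton (EX A (A ⧸ 𝔪) A 0)) (h1 : Nonempty (EX A (A ⧸ 𝔪) A 1 ≃ₗ[A] A ⧸ 𝔪))
    (hne : 𝔪 ≠ ⊤)
    (h𝔪 : 𝔪 = Ideal.span (Set.range x)) (P Q : ι → Prop) (hPQ : ∀ i, P i → ¬ Q i)
    (hP : ∀ i j, P i → ¬ P j → x i * x j = 0) (hQ : ∀ i j, Q i → ¬ Q j → x i * x j = 0) :
    ∃ a b c : A, ¬ (a ∈ 𝔪 ∧ b ∈ 𝔪) ∧ (∀ i, P i → c * x i = a * x i) ∧ (∀ i, Q i → c * x i = b * x i) ∧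
      ∀ i, ¬ P i → ¬ Q i → c * x i = 0 := by
  have hx : ∀ i, x i ∈ 𝔪 := fun i => h𝔪 ▸ Ideal.subset_span ⟨i, rfl⟩
  obtain ⟨ε, e1, e2⟩ := projx 𝔪 x h0 h𝔪 P hP
  obtain ⟨η, e3, e4⟩ := projx 𝔪 x h0 h𝔪 Q hQ
  obtain ⟨δ, hδ⟩ := delta 𝔪
  obtain ⟨E⟩ := h1
  obtain ⟨α, hα⟩ := Ideal.Quotient.mk_surjective (E (δ ε))
  obtain ⟨β, hβ⟩ := Ideal.Quotient.mk_surjective (E (δ η))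
  have key : ∃ a b : A, ¬ (a ∈ 𝔪 ∧ b ∈ 𝔪) ∧ δ (a • ε + b • η) = 0 := by
    by_cases h : α ∈ 𝔪
    · refine ⟨1, 0, fun h => hne ((Ideal.eq_top_iff_one _).2 h.1), ?_⟩
      rw [one_smul, zero_smul, add_zero]
      apply E.injective
      rw [← hα, map_zero]
      exact Ideal.Quotient.eq_zero_iff_mem.2 h
    · refine ⟨β, -α, fun h' => h (by simpa using h'.2), ?_⟩
      apply E.injective
      rw [map_add, map_smul, map_smul, map_add, map_smul, map_smul, ← hα, ← hβ, map_zero, Algebra.smul_def,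
        Algebra.smul_def]
      change Ideal.Quotient.mk 𝔪 β * Ideal.Quotient.mk 𝔪 α + Ideal.Quotient.mk 𝔪 (-α) * Ideal.Quotient.mk 𝔪 β = 0
      rw [map_neg]; ring
  obtain ⟨a, b, hab, h⟩ := key
  obtain ⟨c, hc⟩ := hδ _ h
  refine ⟨a, b, c, hab, fun i hi => ?_, fun i hi => ?_, fun i hi hi' => ?_⟩
  · have := hc ⟨x i, hx i⟩
    rw [← this]
    simp [e1 i (hx i) hi, e4 i (hx i) (hPQ i hi)]
  · have := hc ⟨x i, hx i⟩
    rw [← this]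
    simp [e2 i (hx i) (fun h => hPQ i h hi), e3 i (hx i) hi]
  · have := hc ⟨x i, hx i⟩
    rw [← this]
    simp [e2 i (hx i) hi, e4 i (hx i) hi']

end EXX
end

section
set_option linter.unusedSectionVars false

namespace SRL
section
open MvPolynomial IsLocalRing
variable {k : Type} [Field k] {n : ℕ} {Δ : SC n} {d : ℕ}

theorem srMax_span : srMax k Δ = Ideal.span (Set.range fun i => qm k Δ (X i)) := rfl

/-- nonvanishing at the maximal ideal -/
theorem nzM {s : SRRing k Δ} (hs : s ∉ srMax k Δ) {v : Fin n} (hv : {v} ∈ Δ.faces)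
    (h : s * qm k Δ (X v) = 0) : False := by
  obtain ⟨p, rfl⟩ := Ideal.Quotient.mk_surjective s
  rw [srMax_eq, mk_mem_Q _ univ_c, mem_PS] at hs
  push Not at hs
  obtain ⟨m, hm, hm'⟩ := hs
  have hm0 : m = 0 := by ext i; exact hm' i (by simp)
  subst hm0
  have h1 : p * X v ∈ srIdeal k Δ := by
    rw [← mk_eq_zero, map_mul]; exact h
  rw [mem_sr] at h1
  refine h1 (Finsupp.single v 1) ?_ (by rwa [Finsupp.support_single _ one_ne_zero])
  rw [mem_support_iff, coeff_mul_X']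
  simpa using hm

theorem nzv {v y : Fin n} {t : SRRing k Δ} (hv : {v, y} ∈ Δ.faces) (ht : t ∉ Q k Δ (Finset.univ.erase v)) 
    (h : t * qm k Δ (X y) = 0) : False := by
  classical
  have hv' : {v} ∈ Δ.faces := Δ.down_closed hv (by simp)
  obtain ⟨p, rfl⟩ := Ideal.Quotient.mk_surjective t
  rw [mk_mem_Q _ (erase_c hv'), notin_PS] at ht
  obtain ⟨j, hj⟩ := ht
  have h1 : p * X y ∈ srIdeal k Δ := by
    rw [← mk_eq_zero, map_mul]; exact h
  rw [mem_sr] at h1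
  refine h1 (Finsupp.single v j + Finsupp.single y 1) ?_ ?_
  · rw [mem_support_iff, coeff_mul_X]
    exact hj
  · refine Δ.down_closed hv ?_
    rw [supp_add, Finsupp.support_single y one_ne_zero]
    refine Finset.union_subset (Finsupp.support_single_subset.trans ?_) ?_ <;> simp

theorem conn (hd : ringKrullDim (SRRing k Δ) = d) (hCM : IsCohenMacaulayAt (SRRing k Δ) (srMax k Δ))
    (h2 : 2 ≤ d) (P : Fin n → Prop) {v : Fin n} (hv : {v} ∈ Δ.faces) (hPv : P v)
    (hP : ∀ v w, v ≠ w → {v, w} ∈ Δ.faces → P v → P w) {w : Fin n} (hw : {w} ∈ Δ.faces) : P w := by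
  by_contra hPw
  obtain ⟨a, ha, hb⟩ := EXX.X2 (srMax k Δ) (fun i => qm k Δ (X i)) (cm_ex hd hCM 0 (by omega))
    (cm_ex hd hCM 1 (by omega)) srMax_span P (fun i j hi hj => by
      change qm k Δ (X i) * qm k Δ (X j) = 0
      rw [← map_mul]
      refine XX_zero fun h => hj (hP i j ?_ h hi)
      rintro rfl; exact hj hi)
  by_cases h : a ∈ srMax k Δ
  · have h3 : 1 - a ∉ srMax k Δ := fun h' => by
      have := Ideal.add_mem _ h' h
      rw [sub_add_cancel] at this
      exact srMax_prime.ne_top ((Ideal.eq_top_iff_one _).2 this)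
    refine nzM h3 hv ?_
    rw [sub_mul, ha v hPv, one_mul, sub_self]
  · exact nzM h hw (hb w hPw)

theorem maxA (v : Fin n) (𝔭 : Ideal (SRRing k Δ)) [𝔭.IsPrime] (h𝔭 : 𝔭 = Q k Δ (Finset.univ.erase v)) :
    maximalIdeal (LS.A 𝔭) = Ideal.span (Set.range fun i : {y : Fin n // y ≠ v} =>
      algebraMap (SRRing k Δ) (LS.A 𝔭) (qm k Δ (X i.1))) := by
  have h1 : maximalIdeal (LS.A 𝔭) = 𝔭.map (algebraMap (SRRing k Δ) (LS.A 𝔭)) :=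
    (Localization.AtPrime.map_eq_maximalIdeal (I := 𝔭)).symm
  have h2 : 𝔭 = Ideal.span (Set.range fun i : {y : Fin n // y ≠ v} => qm k Δ (X i.1)) := by
    rw [h𝔭]
    unfold Q PS
    rw [Ideal.map_span, Set.image_image]
    congr 1
    ext z
    simp
  have h3 := congrArg (Ideal.map (algebraMap (SRRing k Δ) (LS.A 𝔭))) h2
  rw [h1, h3, Ideal.map_span, ← Set.range_comp]
  rfl

theorem nzA {v y : Fin n} (𝔭 : Ideal (SRRing k Δ)) [𝔭.IsPrime] (h𝔭 : 𝔭 = Q k Δ (Finset.univ.erase v))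
    (hv : {v, y} ∈ Δ.faces) {s : LS.A 𝔭} (hs : s ∉ maximalIdeal (LS.A 𝔭))
    (h : s * algebraMap (SRRing k Δ) (LS.A 𝔭) (qm k Δ (X y)) = 0) : False := by
  have hu : IsUnit s := by
    by_contra h'; exact hs ((mem_maximalIdeal _).2 h')
  rw [hu.mul_right_eq_zero] at h
  obtain ⟨t, ht⟩ := (IsLocalization.map_eq_zero_iff 𝔭.primeCompl (LS.A 𝔭) _).1 h
  exact nzv hv (h𝔭 ▸ t.2) ht

theorem zA {v y y' : Fin n} (hvv : {v} ∈ Δ.faces) (𝔭 : Ideal (SRRing k Δ)) [𝔭.IsPrime]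
    (h𝔭 : 𝔭 = Q k Δ (Finset.univ.erase v)) (hv : {v, y, y'} ∉ Δ.faces) :
    algebraMap (SRRing k Δ) (LS.A 𝔭) (qm k Δ (X y)) * algebraMap (SRRing k Δ) (LS.A 𝔭) (qm k Δ (X y')) = 0 := by
  classical
  rw [← map_mul]
  refine (IsLocalization.map_eq_zero_iff 𝔭.primeCompl (LS.A 𝔭) _).2 ⟨⟨qm k Δ (X v), ?_⟩, ?_⟩
  · change qm k Δ (X v) ∉ 𝔭
    rw [h𝔭, mk_mem_Q _ (erase_c hvv), notin_PS]
    exact ⟨1, by simp [X]⟩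
  · change qm k Δ (X v) * (qm k Δ (X y) * qm k Δ (X y')) = 0
    rw [← map_mul, ← map_mul, mk_eq_zero, X, X, X, monomial_mul, monomial_mul]
    apply mon_face
    rwa [supp_add, supp_add, Finsupp.support_single _ one_ne_zero, Finsupp.support_single _ one_ne_zero, Finsupp.support_single _ one_ne_zero]

variable {ω : Type} [AddCommGroup ω] [Module (SRRing k Δ) ω] [Module (PR k n) ω]
  [IsScalarTower (PR k n) (SRRing k Δ) ω]

theorem linkconn (hd : ringKrullDim (SRRing k Δ) = d) (hCM : IsCohenMacaulayAt (SRRing k Δ) (srMax k Δ))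
    (e : ω ≃ₗ[PR k n] EX (PR k n) (SRRing k Δ) (PR k n) (n - d))
    (hG : GorensteinPunctured k (srIdeal k Δ)) (h3 : 3 ≤ d) (w : Fin n) (P : Fin n → Prop)
    {y : Fin n} (hyw : y ≠ w) (hy : {w, y} ∈ Δ.faces) (hPy : P y)
    (hP : ∀ y y', y ≠ w → y' ≠ w → y ≠ y' → {w, y, y'} ∈ Δ.faces → P y → P y')
    {y' : Fin n} (hyw' : y' ≠ w) (hy' : {w, y'} ∈ Δ.faces) : P y' := by
  by_contra hPy'
  have hw : {w} ∈ Δ.faces := Δ.down_closed hy (by simp)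
  obtain ⟨𝔭, h𝔭⟩ : ∃ 𝔭, 𝔭 = Q k Δ (Finset.univ.erase w) := ⟨_, rfl⟩
  have : 𝔭.IsPrime := h𝔭 ▸ Q_prime _ (erase_c hw)
  have hE := (out_fwd hd hCM e hG w hw 𝔭 h𝔭).1
  obtain ⟨a, ha, hb⟩ := EXX.X2 (maximalIdeal (LS.A 𝔭)) _ ((hE 0).2 (by omega)) ((hE 1).2 (by omega))
    (maxA w 𝔭 h𝔭) (fun i => P i.1) (fun i j hi hj => by
      refine zA hw 𝔭 h𝔭 fun h => hj (hP i.1 j.1 i.2 j.2 ?_ h hi)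
      intro hij
      rw [hij] at hi
      exact hj hi)
  by_cases h : a ∈ maximalIdeal (LS.A 𝔭)
  · have h3 : 1 - a ∉ maximalIdeal (LS.A 𝔭) := fun h' => by
      have := Ideal.add_mem _ h' h
      rw [sub_add_cancel] at this
      exact (maximalIdeal.isMaximal (LS.A 𝔭)).ne_top ((Ideal.eq_top_iff_one _).2 this)
    refine nzA 𝔭 h𝔭 hy h3 ?_
    rw [sub_mul, ha ⟨y, hyw⟩ hPy, one_mul, sub_self]
  · exact nzA 𝔭 h𝔭 hy' h (hb ⟨y', hyw'⟩ hPy')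

theorem deg2 (hd : ringKrullDim (SRRing k Δ) = d) (hCM : IsCohenMacaulayAt (SRRing k Δ) (srMax k Δ))
    (e : ω ≃ₗ[PR k n] EX (PR k n) (SRRing k Δ) (PR k n) (n - d))
    (hG : GorensteinPunctured k (srIdeal k Δ)) (h2 : d = 2) {w y1 y2 y3 : Fin n}
    (n1 : y1 ≠ w) (n2 : y2 ≠ w) (n3 : y3 ≠ w) (n12 : y1 ≠ y2) (n13 : y1 ≠ y3) (n23 : y2 ≠ y3)
    (h1 : {w, y1} ∈ Δ.faces) (h2' : {w, y2} ∈ Δ.faces) (h3 : {w, y3} ∈ Δ.faces) : False := by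
  have hw : {w} ∈ Δ.faces := Δ.down_closed h1 (by simp)
  obtain ⟨𝔭, h𝔭⟩ : ∃ 𝔭, 𝔭 = Q k Δ (Finset.univ.erase w) := ⟨_, rfl⟩
  have : 𝔭.IsPrime := h𝔭 ▸ Q_prime _ (erase_c hw)
  have hE := (out_fwd hd hCM e hG w hw 𝔭 h𝔭).1
  have hnf : ∀ i j : Fin n, i ≠ w → j ≠ w → i ≠ j → {w, i, j} ∉ Δ.faces := by
    intro i j hi hj hij h
    have := face_card_le _ h hd
    rw [Finset.card_eq_three.2 ⟨w, i, j, hi.symm, hj.symm, hij, rfl⟩] at this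
    omega
  have hz : ∀ q : {y : Fin n // y ≠ w}, ∀ i j : {y : Fin n // y ≠ w}, i.1 = q.1 → ¬ j.1 = q.1 →
      algebraMap (SRRing k Δ) (LS.A 𝔭) (qm k Δ (X i.1)) * algebraMap (SRRing k Δ) (LS.A 𝔭) (qm k Δ (X j.1)) = 0 := by
    intro q i j hi hj
    exact zA hw 𝔭 h𝔭 (hnf _ _ i.2 j.2 (fun h => hj (h.symm.trans hi)))
  obtain ⟨a, b, c, hab, ha, hb, hc⟩ := EXX.X3 (maximalIdeal (LS.A 𝔭)) _ ((hE 0).2 (by omega)) ((hE 1).1 (by omega))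
    (maximalIdeal.isMaximal (LS.A 𝔭)).ne_top
    (maxA w 𝔭 h𝔭) (fun i => i.1 = y1) (fun i => i.1 = y2) (fun i hi hi' => n12 (hi.symm.trans hi'))
      (hz ⟨y1, n1⟩) (hz ⟨y2, n2⟩)
  have hc' : c ∈ maximalIdeal (LS.A 𝔭) := by
    by_contra h
    exact nzA 𝔭 h𝔭 h3 h (hc ⟨y3, n3⟩ n13.symm n23.symm)
  have hca : c - a ∈ maximalIdeal (LS.A 𝔭) := by
    by_contra h
    exact nzA 𝔭 h𝔭 h1 h (by rw [sub_mul, ha ⟨y1, n1⟩ rfl, sub_self])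
  have hcb : c - b ∈ maximalIdeal (LS.A 𝔭) := by
    by_contra h
    exact nzA 𝔭 h𝔭 h2' h (by rw [sub_mul, hb ⟨y2, n2⟩ rfl, sub_self])
  refine hab ⟨?_, ?_⟩
  · simpa using Ideal.sub_mem _ hc' hca
  · simpa using Ideal.sub_mem _ hc' hcb

end
end SRL
end

section
set_option linter.unusedSectionVars false

namespace SRL
section
open MvPolynomial
variable {k : Type} [Field k] {n : ℕ} {Δ : SC n} {d : ℕ}

/-- coefficient functional on the Stanley-Reisner ring -/
noncomputable def cf (a : Fin n →₀ ℕ) (r : SRRing k Δ) : k :=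
  coeff a (Function.surjInv (Ideal.Quotient.mk_surjective (I := srIdeal k Δ)) r)

theorem cf_mk {a : Fin n →₀ ℕ} (ha : a.support ∈ Δ.faces) (p : PR k n) : cf a (qm k Δ p) = coeff a p := by
  unfold cf
  have h := Function.surjInv_eq (Ideal.Quotient.mk_surjective (I := srIdeal k Δ)) (qm k Δ p)
  have h1 := (Ideal.Quotient.mk_eq_mk_iff_sub_mem _ _).1 h
  rw [mem_sr] at h1
  rw [← sub_eq_zero, ← coeff_sub]
  by_contra h2
  exact h1 a (mem_support_iff.2 h2) ha

theorem lift (r : SRRing k Δ) : ∃ p, r = qm k Δ p := by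
  obtain ⟨p, rfl⟩ := Ideal.Quotient.mk_surjective r
  exact ⟨p, rfl⟩

theorem sgl {v : Fin n} (hv : {v} ∈ Δ.faces) (j : ℕ) : (Finsupp.single v j).support ∈ Δ.faces :=
  Δ.down_closed hv Finsupp.support_single_subset

theorem mem_M (p : PR k n) : qm k Δ p ∈ srMax k Δ ↔ coeff 0 p = 0 := by
  rw [srMax_eq, mk_mem_Q _ univ_c, mem_PS]
  constructor
  · intro h
    by_contra h'
    obtain ⟨i, _, hi⟩ := h 0 (mem_support_iff.2 h')
    exact hi rfl
  · intro h m hm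
    by_contra! h'
    have : m = 0 := by ext i; exact h' i (by simp)
    rw [this, mem_support_iff] at hm
    exact hm h

theorem X_mem (v : Fin n) : qm k Δ (X v) ∈ srMax k Δ := Ideal.subset_span ⟨v, rfl⟩

theorem mon_M2 {m : Fin n →₀ ℕ} (h0 : m ≠ 0) (h1 : ∀ v, m ≠ Finsupp.single v 1) (c : k) :
    qm k Δ (monomial m c) ∈ srMax k Δ ^ 2 := by
  obtain ⟨v, hv⟩ : ∃ v, m v ≠ 0 := by
    by_contra! h
    exact h0 (Finsupp.ext h)
  have hm : m = Finsupp.single v 1 + (m - Finsupp.single v 1) := by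
    rw [add_tsub_cancel_of_le]
    rw [Finsupp.single_le_iff]; omega
  set m' := m - Finsupp.single v 1
  obtain ⟨w, hw⟩ : ∃ w, m' w ≠ 0 := by
    by_contra! h
    have : m' = 0 := Finsupp.ext h
    rw [this, add_zero] at hm
    exact h1 v hm
  have hm' : m' = Finsupp.single w 1 + (m' - Finsupp.single w 1) := by
    rw [add_tsub_cancel_of_le]
    rw [Finsupp.single_le_iff]; omega
  have : (monomial m c : PR k n) = X v * X w * monomial (m' - Finsupp.single w 1) c := by
    rw [X, X, monomial_mul, monomial_mul, add_assoc, ← hm', ← hm]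
    simp
  rw [this, map_mul, map_mul, pow_two]
  exact Ideal.mul_mem_right _ _ (Ideal.mul_mem_mul (X_mem v) (X_mem w))

theorem mem_M2 {r : SRRing k Δ} (hr : r ∈ srMax k Δ) (h : ∀ v, {v} ∈ Δ.faces → cf (Finsupp.single v 1) r = 0) :
    r ∈ srMax k Δ ^ 2 := by
  obtain ⟨p, rfl⟩ := lift r
  rw [mem_M] at hr
  rw [p.as_sum, map_sum]
  refine Ideal.sum_mem _ fun m hm => ?_
  rw [mem_support_iff] at hm
  by_cases h0 : m = 0
  · subst h0; exact absurd hr hm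
  by_cases h1 : ∃ v, m = Finsupp.single v 1
  · obtain ⟨v, rfl⟩ := h1
    by_cases hv : {v} ∈ Δ.faces
    · have := h v hv
      rw [cf_mk (sgl hv 1)] at this
      exact absurd this hm
    · have : qm k Δ (monomial (Finsupp.single v 1) (coeff (Finsupp.single v 1) p)) = 0 := by
        rw [mk_eq_zero]
        apply mon_face
        rwa [Finsupp.support_single _ one_ne_zero]
      rw [this]; exact Ideal.zero_mem _
  · push Not at h1
    exact mon_M2 h0 h1 _

theorem tr_top {t : Ideal (SRRing k Δ)} (h2 : srMax k Δ ^ 2 ≤ t) (h : ¬ t ≤ srMax k Δ) : t = ⊤ := by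
  obtain ⟨r, hr, hrM⟩ := Set.not_subset.1 h
  obtain ⟨p, rfl⟩ := lift r
  have hc : coeff 0 p ≠ 0 := fun h => hrM ((mem_M p).2 h)
  set c := coeff 0 p
  have h3 : qm k Δ (1 - C c⁻¹ * p) ∈ srMax k Δ := by
    rw [mem_M, coeff_sub, coeff_C_mul, coeff_zero_one]
    change 1 - c⁻¹ * c = 0
    rw [inv_mul_cancel₀ hc, sub_self]
  have h4 : qm k Δ (1 - C c⁻¹ * p) * qm k Δ (1 - C c⁻¹ * p) ∈ t := h2 (by rw [pow_two]; exact Ideal.mul_mem_mul h3 h3)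
  rw [Ideal.eq_top_iff_one]
  have h5 : (1 : SRRing k Δ) = qm k Δ (1 - C c⁻¹ * p) * qm k Δ (1 - C c⁻¹ * p) +
      qm k Δ (2 * C c⁻¹ - C c⁻¹ * C c⁻¹ * p) * qm k Δ p := by
    rw [← map_mul, ← map_mul, ← map_add, ← map_one (qm k Δ)]
    congr 1
    ring
  rw [h5]
  exact t.add_mem h4 (t.mul_mem_left _ hr)

theorem tr_M {t : Ideal (SRRing k Δ)} (h : srMax k Δ ≤ t) : ∃ i ∈ ({0, 1, 2} : Set ℕ), t = srMax k Δ ^ i := by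
  by_cases h' : t ≤ srMax k Δ
  · exact ⟨1, by simp, (le_antisymm h' h).trans (pow_one (srMax k Δ)).symm⟩
  · exact ⟨0, by simp, (tr_top ((Ideal.pow_le_self two_ne_zero).trans h) h').trans ((pow_zero (srMax k Δ)).trans Ideal.one_eq_top).symm⟩

theorem M_le {t : Ideal (SRRing k Δ)} (h : ∀ v, {v} ∈ Δ.faces → qm k Δ (X v) ∈ t) : srMax k Δ ≤ t := by
  rw [srMax_span, Ideal.span_le]
  rintro _ ⟨v, rfl⟩
  by_cases hv : {v} ∈ Δ.faces
  · exact h v hv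
  · change qm k Δ (X v) ∈ t
    rw [X_zero hv]; exact t.zero_mem

variable {ω : Type} [AddCommGroup ω] [Module (SRRing k Δ) ω] [Module (PR k n) ω]
  [IsScalarTower (PR k n) (SRRing k Δ) ω] {G : SqGr k n ω}

theorem tr_le {t : Ideal (SRRing k Δ)} (h : ∀ (f : ω →ₗ[SRRing k Δ] SRRing k Δ) m, f m ∈ t) :
    traceIdeal (SRRing k Δ) ω ≤ t := by
  unfold traceIdeal
  refine iSup_le fun f => ?_
  rintro _ ⟨m, rfl⟩
  exact h f m

theorem notle (G : SqGr k n ω) (hM : traceIdeal (SRRing k Δ) ω ≤ srMax k Δ) (h : ¬ traceIdeal (SRRing k Δ) ω ≤ srMax k Δ ^ 2) :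
    ∃ (f : ω →ₗ[SRRing k Δ] SRRing k Δ) (a : Fin n →₀ ℕ) (m : ω) (v : Fin n), G.pr a m = m ∧ {v} ∈ Δ.faces ∧
      cf (Finsupp.single v 1) (f m) ≠ 0 := by
  by_contra! h'
  apply h
  refine tr_le fun f m => ?_
  refine G.ind (P := fun m => f m ∈ srMax k Δ ^ 2) (by rw [map_zero]; exact Ideal.zero_mem _) ?_ ?_ m
  · intro x y hx hy
    rw [map_add]; exact Ideal.add_mem _ hx hy
  · intro a m
    refine mem_M2 (hM (mem_tr f _)) fun v hv => h' f a _ v ?_ hv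
    exact G.pr_same a m

theorem socle0 (hd : ringKrullDim (SRRing k Δ) = d) (hCM : IsCohenMacaulayAt (SRRing k Δ) (srMax k Δ))
    (e : ω ≃ₗ[PR k n] EX (PR k n) (SRRing k Δ) (PR k n) (n - d)) (hd1 : 1 ≤ d) (u : ω)
    (hu : ∀ y, {y} ∈ Δ.faces → (X y : PR k n) • u = 0) : u = 0 := by
  have h1 : ∀ r ∈ srMax k Δ, r • u = 0 := by
    intro r hr
    have : srMax k Δ ≤ Ideal.comap (RingHom.id _) (Submodule.annihilator (Submodule.span (SRRing k Δ) {u})) := by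
      apply M_le
      intro v hv
      rw [Ideal.mem_comap, RingHom.id_apply, Submodule.mem_annihilator_span_singleton, mk_smul]
      exact hu v hv
    have h2 := this hr
    rwa [Ideal.mem_comap, RingHom.id_apply, Submodule.mem_annihilator_span_singleton] at h2
  obtain ⟨s, hs, hs'⟩ := out_socle hd hCM e hd1 u h1
  obtain ⟨p, rfl⟩ := lift s
  rw [mem_M] at hs
  have h3 : qm k Δ (p - C (coeff 0 p)) ∈ srMax k Δ := by
    rw [mem_M]; simp
  have h4 := h1 _ h3
  rw [mk_smul, sub_smul] at h4
  rw [mk_smul] at hs'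
  rw [hs', zero_sub, neg_eq_zero] at h4
  have : u = (C (coeff 0 p)⁻¹ : PR k n) • (C (coeff 0 p) : PR k n) • u := by
    rw [← mul_smul, ← C_mul, inv_mul_cancel₀ hs, C_1, one_smul]
  rw [this, h4, smul_zero]

/-- connectivity of the graph -/
def Conn (Δ : SC n) : Prop := ∀ (P : Fin n → Prop) (v : Fin n), {v} ∈ Δ.faces → P v →
    (∀ v w, v ≠ w → {v, w} ∈ Δ.faces → P v → P w) → ∀ w, {w} ∈ Δ.faces → P w

theorem X_degree {a : Fin n →₀ ℕ} {m : ω} (hm : G.pr a m = m) (u : Fin n) :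
    G.pr (a + Finsupp.single u 1) ((X u : PR k n) • m) = (X u : PR k n) • m := by
  have := (G.X_pr a u m).symm
  rwa [hm] at this

theorem X_degree0 {m : ω} (hm : G.pr 0 m = m) (u : Fin n) :
    G.pr (Finsupp.single u 1) ((X u : PR k n) • m) = (X u : PR k n) • m := by
  have := X_degree hm u
  rwa [zero_add] at this

theorem le_single {v : Fin n} {g : ω} {σ : Fin n →₀ ℕ} (D : GenD Δ G v g σ) (h : σ ≤ Finsupp.single v 1) :
    σ = Finsupp.single v 1 := by
  refine le_antisymm h ?_
  rw [Finsupp.single_le_iff, D.hv]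

theorem GenD.Xne {v u : Fin n} {g : ω} {σ : Fin n →₀ ℕ} (D : GenD Δ G v g σ) (h : {v, u} ∈ Δ.faces) :
    (X u : PR k n) • g ≠ 0 := by
  intro h'
  refine (D.ann (Finsupp.single u 1)).1 h' ?_
  rwa [Finsupp.support_single _ one_ne_zero]

theorem GenD.Xz {v u : Fin n} {g : ω} {σ : Fin n →₀ ℕ} (D : GenD Δ G v g σ) (h : {v, u} ∉ Δ.faces) :
    (X u : PR k n) • g = 0 := by
  refine (D.ann (Finsupp.single u 1)).2 ?_
  rwa [Finsupp.support_single _ one_ne_zero]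

/-- degree zero elements -/
theorem deg0 {v : Fin n} {g : ω} {σ : Fin n →₀ ℕ} (D : GenD Δ G v g σ) {m : ω} (hm : G.pr 0 m = m)
    (h : (X v : PR k n) • m ≠ 0) : σ = Finsupp.single v 1 ∧ ∃ c : k, c ≠ 0 ∧ (X v : PR k n) • m = (C c : PR k n) • g := by
  have h1 := X_degree0 hm v
  by_cases hs : σ ≤ Finsupp.single v 1
  · have h2 := le_single D hs
    refine ⟨h2, ?_⟩
    obtain ⟨c, hc⟩ := D.gen _ _ h1 (by simp) hs
    rw [h2, tsub_self] at hc
    refine ⟨c, ?_, hc⟩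
    rintro rfl
    rw [monomial_zero, zero_smul] at hc
    exact h hc
  · exact absurd (D.gen0 _ _ h1 (by simp) hs) h

theorem deg0_mem {v : Fin n} {g : ω} {σ : Fin n →₀ ℕ} (D : GenD Δ G v g σ) {m : ω} (hm : G.pr 0 m = m)
    (h : (X v : PR k n) • m ≠ 0) : qm k Δ (X v) ∈ traceIdeal (SRRing k Δ) ω := by
  obtain ⟨_, c, hc, h1⟩ := deg0 D hm h
  obtain ⟨f, hf⟩ := D.fv
  have := mem_tr f m
  rw [hf _ _ h1] at this
  exact C_mem hc this

theorem C_smul_ne {c : k} (hc : c ≠ 0) {m : ω} (hm : m ≠ 0) : (C c : PR k n) • m ≠ 0 := by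
  intro h
  apply hm
  have : m = (C c⁻¹ : PR k n) • (C c : PR k n) • m := by
    rw [← mul_smul, ← C_mul, inv_mul_cancel₀ hc, C_1, one_smul]
  rw [this, h, smul_zero]

theorem deg0_edge {v u : Fin n} {g : ω} {σ : Fin n →₀ ℕ} (D : GenD Δ G v g σ) {m : ω} (hm : G.pr 0 m = m)
    (huv : {v, u} ∈ Δ.faces) (h : (X v : PR k n) • m ≠ 0) : (X u : PR k n) • m ≠ 0 := by
  obtain ⟨_, c, hc, h1⟩ := deg0 D hm h
  intro h2
  have h3 : (X u : PR k n) • (X v : PR k n) • m = 0 := by rw [smul_comm, h2, smul_zero]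
  rw [h1, smul_comm] at h3
  exact C_smul_ne hc (D.Xne huv) h3

variable {g : Fin n → ω} {σ : Fin n → Fin n →₀ ℕ}

theorem W0 (hC : Conn Δ) (hs : ∀ u : ω, (∀ y, {y} ∈ Δ.faces → (X y : PR k n) • u = 0) → u = 0)
    (D : ∀ v, {v} ∈ Δ.faces → GenD Δ G v (g v) (σ v)) {v : Fin n} (hv : {v} ∈ Δ.faces) (hσ : σ v ≠ Finsupp.single v 1)
    (m : ω) (hm : G.pr 0 m = m) : m = 0 := by
  apply hs
  refine hC (fun y => (X y : PR k n) • m = 0) v hv ?_ ?_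
  · by_contra h
    exact hσ (deg0 (D v hv) hm h).1
  · intro u y huy hf hu
    by_contra hy
    exact deg0_edge (D y (Δ.down_closed hf (by simp))) hm (by rwa [Finset.pair_comm]) hy hu

/-- cone-like case -/
theorem case2 (hC : Conn Δ) (hs : ∀ u : ω, (∀ y, {y} ∈ Δ.faces → (X y : PR k n) • u = 0) → u = 0)
    (D : ∀ v, {v} ∈ Δ.faces → GenD Δ G v (g v) (σ v)) {v w : Fin n} (hv : {v} ∈ Δ.faces) (hw : {w} ∈ Δ.faces)
    (hvw : v ≠ w) (hP : ∀ y, y ≠ w → {w, y} ∈ Δ.faces → σ y w = 1) : traceIdeal (SRRing k Δ) ω = ⊤ := by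
  classical
  have hall : ∀ y, {y} ∈ Δ.faces → σ y w = 1 := by
    refine hC (fun y => σ y w = 1) w hw (D w hw).hv ?_
    intro y y' hyy hf hy
    by_cases h1 : y' = w
    · subst h1; exact (D _ hw).hv
    by_cases h2 : y = w
    · subst h2; exact hP _ h1 hf
    rw [← edge_eq (D y (Δ.down_closed hf (by simp))) (D y' (Δ.down_closed hf (by simp))) hf w (Ne.symm h2) (Ne.symm h1)]
    exact hy
  have hW0 := W0 hC hs D hv (by
    intro h
    have := hall v hv
    rw [h, Finsupp.single_eq_of_ne hvw.symm] at this
    omega)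
  have hgen : ∀ m : ω, ∃ r : PR k n, (1 : PR k n) • m = r • g w := by
    intro m
    refine G.ind (P := fun m => ∃ r : PR k n, (1 : PR k n) • m = r • g w) ⟨0, by simp⟩ ?_ ?_ m
    · rintro x y ⟨p, hp⟩ ⟨q, hq⟩
      exact ⟨p + q, by rw [smul_add, hp, hq, add_smul]⟩
    · intro a m
      have hm : G.pr a (G.pr a m) = G.pr a m := G.pr_same a m
      generalize G.pr a m = m at hm
      by_cases hm0 : m = 0
      · exact ⟨0, by rw [hm0, smul_zero, zero_smul]⟩
      have hf := face_of_ne (Δ := Δ) hm hm0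
      by_cases haw : 1 ≤ a w
      · by_cases h : σ w ≤ a
        · obtain ⟨c, hc⟩ := (D w hw).gen a m hm haw h
          exact ⟨_, by rw [one_smul]; exact hc⟩
        · exact absurd ((D w hw).gen0 a m hm haw h) hm0
      · exfalso
        apply hm0
        by_cases ha0 : a = 0
        · subst ha0; exact hW0 m hm
        obtain ⟨y, hy⟩ : ∃ y, a y ≠ 0 := by
          by_contra! h
          exact ha0 (Finsupp.ext h)
        have hyf : {y} ∈ Δ.faces := Δ.down_closed hf (by simpa using hy)
        refine (D y hyf).gen0 a m hm (by omega) fun h => ?_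
        have := h w
        rw [hall y hyf] at this
        omega
  have hann : ∀ r : PR k n, r • g w = 0 → r * 1 ∈ srIdeal k Δ := by
    intro r hr
    have h1 := (D w hw).annS r hr
    rw [mul_one, mem_sr]
    intro m hm hf
    rw [mem_sr] at h1
    refine h1 (m + Finsupp.single w 1) ?_ ?_
    · rw [mem_support_iff, coeff_mul_X]
      exact mem_support_iff.1 hm
    · rw [supp_add, Finsupp.support_single _ one_ne_zero]
      by_cases hm0 : m = 0
      · subst hm0; simpa using hw
      obtain ⟨y, hy⟩ : ∃ y, m y ≠ 0 := by
        by_contra! h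
        exact hm0 (Finsupp.ext h)
      have hyf : {y} ∈ Δ.faces := Δ.down_closed hf (by simpa using hy)
      refine Δ.down_closed ((D y hyf).face m ?_) ?_
      · rwa [Finset.insert_eq_of_mem (by simpa using hy)]
      · rw [Finset.union_comm]
        refine Finset.union_subset_union ?_ subset_rfl
        simp [hall y hyf]
  obtain ⟨f, hf⟩ := lemmaH (Δ := Δ) (g w) 1 1 hgen hann
  rw [Ideal.eq_top_iff_one]
  have := mem_tr f (g w)
  rw [hf _ _ rfl, mul_one, map_one] at this
  exact this

end
end SRL
end

section
set_option linter.unusedSectionVars false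

namespace SRL
section
open MvPolynomial
variable {k : Type} [Field k] {n : ℕ} {Δ : SC n} {d : ℕ}

theorem rad (p : PR k n) (v : Fin n) (h : p * X v * X v ∈ srIdeal k Δ) : p * X v ∈ srIdeal k Δ := by
  classical
  rw [mem_sr] at h ⊢
  intro m hm
  have h1 := h (m + Finsupp.single v 1) (by
    rw [mem_support_iff, coeff_mul_X]; exact mem_support_iff.1 hm)
  rw [mem_support_iff, coeff_mul_X'] at hm
  split_ifs at hm with h2
  · rwa [supp_add, Finsupp.support_single _ one_ne_zero, Finset.union_eq_left.2 (by simpa using h2)] at h1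
  · exact absurd rfl hm

variable {ω : Type} [AddCommGroup ω] [Module (SRRing k Δ) ω] [Module (PR k n) ω]
  [IsScalarTower (PR k n) (SRRing k Δ) ω] {G : SqGr k n ω}
variable {g : Fin n → ω} {σ : Fin n → Fin n →₀ ℕ}

theorem sig_edge {v i : Fin n} {g : ω} {σ : Fin n →₀ ℕ} (D : GenD Δ G v g σ) (hv : {v} ∈ Δ.faces)
    (hi : σ i ≠ 0) : {v, i} ∈ Δ.faces := by
  classical
  refine Δ.down_closed (D.face 0 (by simpa using hv)) ?_
  intro j hj
  rw [Finset.mem_insert, Finset.mem_singleton] at hj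
  rcases hj with rfl | rfl
  · simp [D.hv]
  · simp [hi]

theorem sig_eq {v : Fin n} {g : ω} {σ : Fin n →₀ ℕ} (D : GenD Δ G v g σ) (h : ∀ i, i ≠ v → σ i = 0) :
    σ = Finsupp.single v 1 := by
  ext i
  rcases eq_or_ne i v with rfl | hi
  · simp [D.hv]
  · rw [h i hi, Finsupp.single_eq_of_ne hi]

theorem sig_ne {v : Fin n} {g : ω} {σ : Fin n →₀ ℕ} (D : GenD Δ G v g σ) (h : σ ≠ Finsupp.single v 1) :
    ∃ w, w ≠ v ∧ σ w = 1 := by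
  by_contra! h'
  refine h (sig_eq D fun i hi => ?_)
  have := h' i hi
  have := D.le1 i
  omega

theorem case_d1 (hne : ∀ v w : Fin n, v ≠ w → {v, w} ∉ Δ.faces)
    (D : ∀ v, {v} ∈ Δ.faces → GenD Δ G v (g v) (σ v)) : srMax k Δ ≤ traceIdeal (SRRing k Δ) ω := by
  classical
  refine M_le fun v hv => ?_
  by_cases h0 : ∃ m, G.pr 0 m = m ∧ (X v : PR k n) • m ≠ 0
  · obtain ⟨m, hm, h⟩ := h0
    exact deg0_mem (D v hv) hm h
  push Not at h0
  have hσ : σ v = Finsupp.single v 1 := by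
    by_contra h
    obtain ⟨w, hw, hw'⟩ := sig_ne (D v hv) h
    exact hne v w hw.symm (sig_edge (D v hv) hv (by omega))
  have hgen : ∀ m : ω, ∃ r : PR k n, (X v : PR k n) • m = r • (X v : PR k n) • g v := by
    intro m
    refine G.ind (P := fun m => ∃ r : PR k n, (X v : PR k n) • m = r • (X v : PR k n) • g v) ⟨0, by simp⟩ ?_ ?_ m
    · rintro x y ⟨p, hp⟩ ⟨q, hq⟩
      exact ⟨p + q, by rw [smul_add, hp, hq, add_smul]⟩
    · intro a m
      have hm : G.pr a (G.pr a m) = G.pr a m := G.pr_same a m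
      generalize G.pr a m = m at hm
      by_cases hm0 : (X v : PR k n) • m = 0
      · exact ⟨0, by rw [hm0, zero_smul]⟩
      have hf := face_of_ne (Δ := Δ) (X_degree hm v) hm0
      by_cases ha0 : a = 0
      · subst ha0; exact absurd (h0 m hm) hm0
      obtain ⟨y, hy⟩ : ∃ y, a y ≠ 0 := by
        by_contra! h
        exact ha0 (Finsupp.ext h)
      by_cases hyv : y = v
      · subst hyv
        obtain ⟨c, hc⟩ := (D y hv).gen a m hm (by omega) (by rw [hσ, Finsupp.single_le_iff]; omega)
        exact ⟨_, by rw [smul_comm, ← hc]⟩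
      · exfalso
        refine hne v y (Ne.symm hyv) (Δ.down_closed hf ?_)
        intro j hj
        rw [Finset.mem_insert, Finset.mem_singleton] at hj
        rcases hj with rfl | rfl
        · simp
        · simp [hy]
  obtain ⟨f, hf⟩ := lemmaH (Δ := Δ) ((X v : PR k n) • g v) (X v) (X v) hgen (fun r hr => by
    apply rad
    apply (D v hv).annS
    rw [mul_smul, hr])
  have := mem_tr f (g v)
  rwa [hf _ 1 (by rw [one_smul]), one_mul] at this

theorem edge1 (D : ∀ v, {v} ∈ Δ.faces → GenD Δ G v (g v) (σ v)) (hσ : ∀ v, {v} ∈ Δ.faces → σ v = Finsupp.single v 1)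
    {v w : Fin n} (h : {v, w} ∈ Δ.faces) :
    ∃ c : k, c ≠ 0 ∧ (X w : PR k n) • g v = (C c * X v : PR k n) • g w := by
  have hv : {v} ∈ Δ.faces := Δ.down_closed h (by simp)
  have hw : {w} ∈ Δ.faces := Δ.down_closed h (by simp)
  obtain ⟨c, hc, hh⟩ := edge (D v hv) (D w hw) h
  refine ⟨c, hc, ?_⟩
  rw [hh, hσ v hv, hσ w hw, add_tsub_cancel_right, C_smul_mon]
  rfl

theorem case1 (hC : Conn Δ) (D : ∀ v, {v} ∈ Δ.faces → GenD Δ G v (g v) (σ v))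
    (hσ : ∀ v, {v} ∈ Δ.faces → σ v = Finsupp.single v 1) (h2 : srMax k Δ ^ 2 ≤ traceIdeal (SRRing k Δ) ω)
    (hM : traceIdeal (SRRing k Δ) ω ≤ srMax k Δ)
    (h : ¬ traceIdeal (SRRing k Δ) ω ≤ srMax k Δ ^ 2) : srMax k Δ ≤ traceIdeal (SRRing k Δ) ω := by
  classical
  obtain ⟨f, a, m, v, hm, hv, hcf⟩ := notle G hM h
  choose q hq using fun u => lift (f (g u))
  have hq0 : ∀ u, coeff 0 (q u) = 0 := by
    intro u
    rw [← mem_M (Δ := Δ), ← hq]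
    exact hM (mem_tr f _)
  by_cases ha0 : a = 0
  · subst ha0
    refine M_le fun u hu => deg0_mem (D u hu) hm ?_
    refine hC (fun y => (X y : PR k n) • m ≠ 0) v hv ?_ ?_ u hu
    · intro h0
      have h1 := f_smul f (X v) m
      obtain ⟨p, hp⟩ := lift (f m)
      rw [hp, cf_mk (sgl hv 1)] at hcf
      rw [h0, map_zero, hp, ← map_mul] at h1
      have h1 := (mk_eq_zero _).1 h1.symm
      rw [mem_sr] at h1
      refine h1 (Finsupp.single v 1 + Finsupp.single v 1) ?_ ?_
      · rw [mem_support_iff, mul_comm, coeff_mul_X]; exact hcf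
      · rw [← Finsupp.single_add]; exact sgl hv _
    · intro u y huy hf hu
      exact deg0_edge (D u (Δ.down_closed hf (by simp))) hm hf hu
  have hm0 : m ≠ 0 := by
    rintro rfl
    apply hcf
    rw [map_zero, ← map_zero (qm k Δ), cf_mk (sgl hv 1), coeff_zero]
  have haf := face_of_ne (Δ := Δ) hm hm0
  obtain ⟨w, hw⟩ : ∃ y, a y ≠ 0 := by
    by_contra! h
    exact ha0 (Finsupp.ext h)
  have hwf : {w} ∈ Δ.faces := Δ.down_closed haf (by simpa using hw)
  obtain ⟨c, hc⟩ := (D w hwf).gen a m hm (by omega) (by rw [hσ w hwf, Finsupp.single_le_iff]; omega)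
  have key : coeff (Finsupp.single v 1) (q w) ≠ 0 := by
    intro h0
    apply hcf
    rw [hc, f_smul, hq, ← map_mul, cf_mk (sgl hv 1), coeff_monomial_mul']
    split_ifs with h1
    · generalize a - σ w = e at h1
      have h2 : Finsupp.single v 1 - e = Finsupp.single v 1 ∨ Finsupp.single v 1 - e = 0 := by
        have h3 : e v = 0 ∨ e v = 1 := by
          have := h1 v
          simp at this
          omega
        rcases h3 with h3 | h3
        · left
          ext i
          rcases eq_or_ne i v with rfl | hi
          · simp [h3]
          · simp [hi.symm]
        · right
          ext i
          rcases eq_or_ne i v with rfl | hi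
          · simp [h3]
          · simp [hi.symm]
      rcases h2 with h2 | h2
      · rw [h2, h0, mul_zero]
      · rw [h2, hq0, mul_zero]
    · rfl
  have L1 : ∀ u u', {u} ∈ Δ.faces → {u'} ∈ Δ.faces → u ≠ u' → coeff (Finsupp.single u 1) (q u') = 0 := by
    intro u u' hu hu' huu
    by_contra h0
    by_cases he : {u, u'} ∈ Δ.faces
    · obtain ⟨c, hc, hh⟩ := edge1 D hσ he
      have h1 := congrArg f hh
      rw [f_smul, f_smul, hq, hq, ← map_mul, ← map_mul] at h1
      have h3 := congrArg (cf (Finsupp.single u 1 + Finsupp.single u 1)) h1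
      rw [cf_mk (by rw [← Finsupp.single_add]; exact sgl hu _), cf_mk (by rw [← Finsupp.single_add]; exact sgl hu _),
        mul_assoc, coeff_C_mul, mul_comm (X u) (q u'), coeff_mul_X, mul_comm, coeff_mul_X', if_neg] at h3
      · exact mul_ne_zero hc h0 h3.symm
      · simp [huu]
    · have h1 := (D u' hu').Xz (u := u) (by rwa [Finset.pair_comm])
      have h3 := f_smul f (X u) (g u')
      rw [h1, map_zero, hq, ← map_mul] at h3
      have h1 := (mk_eq_zero _).1 h3.symm
      rw [mem_sr] at h1
      refine h1 (Finsupp.single u 1 + Finsupp.single u 1) ?_ ?_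
      · rw [mem_support_iff, mul_comm, coeff_mul_X]; exact h0
      · rw [← Finsupp.single_add]; exact sgl hu _
  have hvw : v = w := by
    by_contra h0
    exact key (L1 v w hv hwf h0)
  subst hvw
  refine M_le fun u hu => ?_
  have hP := hC (fun u => coeff (Finsupp.single u 1) (q u) ≠ 0) v hv key (by
    intro u u' huu he hP
    have hu : {u} ∈ Δ.faces := Δ.down_closed he (by simp)
    have hu' : {u'} ∈ Δ.faces := Δ.down_closed he (by simp)
    have hs : (Finsupp.single u 1 + Finsupp.single u' 1 : Fin n →₀ ℕ).support ∈ Δ.faces := by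
      rw [supp_add, Finsupp.support_single _ one_ne_zero, Finsupp.support_single _ one_ne_zero]
      exact he
    obtain ⟨c, hc, hh⟩ := edge1 D hσ he
    have h1 := congrArg f hh
    rw [f_smul, f_smul, hq, hq, ← map_mul, ← map_mul] at h1
    have h3 := congrArg (cf (Finsupp.single u 1 + Finsupp.single u' 1)) h1
    rw [cf_mk hs, cf_mk hs, mul_comm, coeff_mul_X, mul_assoc, coeff_C_mul, mul_comm (X u), add_comm, coeff_mul_X] at h3
    intro h0
    rw [h0, mul_zero] at h3
    exact hP h3) u hu
  set c := coeff (Finsupp.single u 1) (q u) with hcdef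
  refine C_mem (Δ := Δ) hP ?_
  have h4 : qm k Δ (q u - C c * X u) ∈ srMax k Δ ^ 2 := by
    refine mem_M2 ?_ fun y hy => ?_
    · rw [mem_M, coeff_sub, hq0, coeff_C_mul]
      simp
    · rw [cf_mk (sgl hy 1), coeff_sub, coeff_C_mul, coeff_X']
      split_ifs with h5
      · have : u = y := by
          by_contra h6
          have := DFunLike.congr_fun h5 u
          simp [h6, Ne.symm h6] at this
        subst this
        rw [mul_one, ← hcdef, sub_self]
      · rw [mul_zero, sub_zero]
        refine L1 y u hy hu ?_
        rintro rfl
        exact h5 rfl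
  have h5 := h2 h4
  rw [map_sub, ← hq] at h5
  have := Ideal.sub_mem _ (mem_tr f (g u)) h5
  simpa using this

end
end SRL
end

section
set_option linter.unusedSectionVars false

namespace SRL
section
open MvPolynomial
variable {k : Type} [Field k] {n : ℕ} {Δ : SC n} {d : ℕ}

/-- potential on a path-like graph -/
theorem pot (hC : Conn Δ) (lam : Fin n → Fin n → k)
    (hlam : ∀ u y, u ≠ y → {u, y} ∈ Δ.faces → lam u y * lam y u = 1)
    (hdeg : ∀ w y1 y2 y3 : Fin n, y1 ≠ w → y2 ≠ w → y3 ≠ w → y1 ≠ y2 → y1 ≠ y3 → y2 ≠ y3 →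
      {w, y1} ∈ Δ.faces → {w, y2} ∈ Δ.faces → {w, y3} ∈ Δ.faces → False)
    {v w : Fin n} (hv : {v} ∈ Δ.faces) (hleaf : ∀ z, z ≠ v → {v, z} ∈ Δ.faces → z = w) :
    ∃ c : Fin n → k, (∀ u, {u} ∈ Δ.faces → c u ≠ 0) ∧ ∀ u y, u ≠ y → {u, y} ∈ Δ.faces → c u = c y * lam u y := by
  classical
  let V := {u : Fin n // {u} ∈ Δ.faces}
  let Gr : SimpleGraph V :=
    { Adj := fun a b => a ≠ b ∧ {a.1, b.1} ∈ Δ.faces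
      symm := ⟨fun a b h => ⟨h.1.symm, by rw [Finset.pair_comm]; exact h.2⟩⟩
      loopless := ⟨fun a h => h.1 rfl⟩ }
  have hd2 : ∀ a : V, Gr.degree a ≤ 2 := by
    intro a
    by_contra! h
    rw [← SimpleGraph.card_neighborFinset_eq_degree, Finset.two_lt_card] at h
    obtain ⟨x, hx, y, hy, z, hz, hxy, hxz, hyz⟩ := h
    rw [SimpleGraph.mem_neighborFinset] at hx hy hz
    exact hdeg a.1 x.1 y.1 z.1 (fun h => hx.1 (Subtype.ext h.symm)) (fun h => hy.1 (Subtype.ext h.symm))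
      (fun h => hz.1 (Subtype.ext h.symm)) (fun h => hxy (Subtype.ext h)) (fun h => hxz (Subtype.ext h))
      (fun h => hyz (Subtype.ext h)) hx.2 hy.2 hz.2
  have hd1 : Gr.degree ⟨v, hv⟩ ≤ 1 := by
    rw [← SimpleGraph.card_neighborFinset_eq_degree, Finset.card_le_one]
    intro x hx y hy
    rw [SimpleGraph.mem_neighborFinset] at hx hy
    exact Subtype.ext ((hleaf x.1 (fun h => hx.1 (Subtype.ext h.symm)) hx.2).trans
      (hleaf y.1 (fun h => hy.1 (Subtype.ext h.symm)) hy.2).symm)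
  have hcard : Gr.edgeFinset.card < Fintype.card V := by
    have h1 := Gr.sum_degrees_eq_twice_card_edges
    have h2 : ∑ a : V, Gr.degree a < ∑ a : V, 2 :=
      Finset.sum_lt_sum (fun a _ => hd2 a) ⟨⟨v, hv⟩, Finset.mem_univ _, by omega⟩
    rw [Finset.sum_const, Finset.card_univ, smul_eq_mul] at h2
    omega
  have hex : ∀ e : Gr.edgeSet, ∃ p : V × V, s(p.1, p.2) = e.1 := by
    rintro ⟨e, _⟩
    induction e with
    | _ a b => exact ⟨(a, b), rfl⟩
  choose p hp using hex
  let L : (V → k) →ₗ[k] (Gr.edgeSet → k) := LinearMap.pi fun e =>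
    LinearMap.proj (p e).1 - lam (p e).1.1 (p e).2.1 • LinearMap.proj (p e).2
  have hker : LinearMap.ker L ≠ ⊥ := by
    apply LinearMap.ker_ne_bot_of_finrank_lt
    rw [Module.finrank_fintype_fun_eq_card, Module.finrank_fintype_fun_eq_card]
    rwa [SimpleGraph.edgeFinset, Set.toFinset_card] at hcard
  obtain ⟨c, hc, hc0⟩ := (Submodule.ne_bot_iff _).1 hker
  have hcL : ∀ e, c (p e).1 = lam (p e).1.1 (p e).2.1 * c (p e).2 := by
    intro e
    have h1 : L c = 0 := hc
    have := congrFun h1 e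
    simp only [L, LinearMap.pi_apply, LinearMap.sub_apply, LinearMap.proj_apply, LinearMap.smul_apply,
      smul_eq_mul, Pi.zero_apply] at this
    exact sub_eq_zero.1 this
  have hedge : ∀ a b : V, a ≠ b → {a.1, b.1} ∈ Δ.faces → c a = c b * lam a.1 b.1 := by
    intro a b hab h
    have hadj : Gr.Adj a b := ⟨hab, h⟩
    have h1 := hp ⟨s(a, b), hadj⟩
    have h2 := hcL ⟨s(a, b), hadj⟩
    generalize p ⟨s(a, b), hadj⟩ = q at h1 h2
    obtain ⟨q1, q2⟩ := q
    simp only [Sym2.eq_iff] at h1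
    rcases h1 with ⟨rfl, rfl⟩ | ⟨rfl, rfl⟩
    · rw [h2, mul_comm]
    · simp only at h2
      rw [h2, mul_right_comm, hlam _ _ (fun h => hab (Subtype.ext h.symm)) (by rwa [Finset.pair_comm]), one_mul]
  refine ⟨fun u => if h : {u} ∈ Δ.faces then c ⟨u, h⟩ else 0, ?_, ?_⟩
  · obtain ⟨a, ha⟩ : ∃ a, c a ≠ 0 := by
      by_contra! h
      exact hc0 (funext h)
    refine hC (fun u => (if h : {u} ∈ Δ.faces then c ⟨u, h⟩ else 0) ≠ 0) a.1 a.2 ?_ ?_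
    · simp only [a.2, dif_pos]
      exact ha
    · intro u y huy he
      have hu : {u} ∈ Δ.faces := Δ.down_closed he (by simp)
      have hy : {y} ∈ Δ.faces := Δ.down_closed he (by simp)
      simp only [hu, hy, dif_pos]
      rw [hedge ⟨u, hu⟩ ⟨y, hy⟩ (fun h => huy (congrArg Subtype.val h)) he]
      exact fun h => left_ne_zero_of_mul h
  · intro u y huy he
    have hu : {u} ∈ Δ.faces := Δ.down_closed he (by simp)
    have hy : {y} ∈ Δ.faces := Δ.down_closed he (by simp)
    simp only [hu, hy, dif_pos]
    exact hedge ⟨u, hu⟩ ⟨y, hy⟩ (fun h => huy (congrArg Subtype.val h)) he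

theorem sq_zero {v : Fin n} (hv : {v} ∈ Δ.faces) (p : PR k n)
    (h : ∀ u, {u} ∈ Δ.faces → X u ^ 2 * p ∈ srIdeal k Δ) : p ∈ srIdeal k Δ := by
  classical
  rw [mem_sr]
  intro m hm hf
  obtain ⟨u, hu, hm'⟩ : ∃ u, {u} ∈ Δ.faces ∧ insert u m.support ∈ Δ.faces := by
    by_cases hm0 : m = 0
    · subst hm0; exact ⟨v, hv, by simpa using hv⟩
    obtain ⟨y, hy⟩ : ∃ y, m y ≠ 0 := by
      by_contra! h
      exact hm0 (Finsupp.ext h)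
    refine ⟨y, Δ.down_closed hf (by simpa using hy), ?_⟩
    rwa [Finset.insert_eq_of_mem (by simpa using hy)]
  have h1 := h u hu
  rw [mem_sr] at h1
  refine h1 (m + Finsupp.single u 1 + Finsupp.single u 1) ?_ ?_
  · rw [mem_support_iff, mul_comm, pow_two, ← mul_assoc, coeff_mul_X, coeff_mul_X]
    exact mem_support_iff.1 hm
  · rw [supp_add, supp_add, Finsupp.support_single _ one_ne_zero]
    refine Δ.down_closed hm' ?_
    intro j hj
    simp at hj ⊢
    tauto

variable {ω : Type} [AddCommGroup ω] [Module (SRRing k Δ) ω] [Module (PR k n) ω]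
  [IsScalarTower (PR k n) (SRRing k Δ) ω] {G : SqGr k n ω}
variable {g : Fin n → ω} {σ : Fin n → Fin n →₀ ℕ}

theorem lam_inv {u y : Fin n} (huy : u ≠ y) {g g' : ω} {σ τ : Fin n →₀ ℕ} (D : GenD Δ G u g σ) (D' : GenD Δ G y g' τ)
    (he : {u, y} ∈ Δ.faces) {c c' : k}
    (h : (X y : PR k n) • g = (monomial (σ + Finsupp.single y 1 - τ) c : PR k n) • g')
    (h' : (X u : PR k n) • g' = (monomial (τ + Finsupp.single u 1 - σ) c' : PR k n) • g) : c * c' = 1 := by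
  classical
  have he' : {y, u} ∈ Δ.faces := by rwa [Finset.pair_comm]
  rw [edge_exp huy D D' he] at h
  rw [edge_exp huy.symm D' D he'] at h'
  have h1 : (X u * X y : PR k n) • g = (C (c * c') : PR k n) • (X u * X y : PR k n) • g := by
    have h2 := D.le1 y
    have h3 := D'.le1 u
    have hX : (X u * X y : PR k n) = monomial (Finsupp.single u 1 + Finsupp.single y 1) 1 := by
      simp [X, monomial_mul]
    have : (Finsupp.single y (σ y) + Finsupp.single u (1 - τ u) + (Finsupp.single u (τ u) + Finsupp.single y (1 - σ y)))
        = Finsupp.single u 1 + Finsupp.single y 1 := by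
      ext i
      rcases eq_or_ne i u with rfl | hiu
      · simp [huy.symm]; omega
      · rcases eq_or_ne i y with rfl | hiy
        · simp [huy]; omega
        · simp [hiu.symm, hiy.symm]
    have hl : (X u * X y : PR k n) • g = (monomial (Finsupp.single u 1 + Finsupp.single y 1) (c * c') : PR k n) • g := by
      rw [mul_smul, h, smul_comm, h', ← mul_smul, monomial_mul, this]
    rw [← mul_smul, hX, C_mul_monomial, mul_one, ← hX]
    exact hl
  have h2 : (X u * X y : PR k n) • g ≠ 0 := by
    rw [X, X, monomial_mul, one_mul]
    intro h
    refine (D.ann _).1 h ?_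
    rw [supp_add, Finsupp.support_single _ one_ne_zero, Finsupp.support_single _ one_ne_zero]
    refine Δ.down_closed he ?_
    intro j hj
    simp at hj ⊢
    tauto
  by_contra h3
  refine C_smul_ne (k := k) (n := n) (sub_ne_zero.2 h3) h2 ?_
  rw [C_sub, sub_smul, ← h1, C_1, one_smul, sub_self]

theorem case3 (hC : Conn Δ) (hs : ∀ u : ω, (∀ y, {y} ∈ Δ.faces → (X y : PR k n) • u = 0) → u = 0)
    (D : ∀ v, {v} ∈ Δ.faces → GenD Δ G v (g v) (σ v))
    (hdeg : ∀ w y1 y2 y3 : Fin n, y1 ≠ w → y2 ≠ w → y3 ≠ w → y1 ≠ y2 → y1 ≠ y3 → y2 ≠ y3 →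
      {w, y1} ∈ Δ.faces → {w, y2} ∈ Δ.faces → {w, y3} ∈ Δ.faces → False)
    {v w : Fin n} (hv : {v} ∈ Δ.faces) (hleaf : ∀ z, z ≠ v → {v, z} ∈ Δ.faces → z = w)
    (hσv : σ v ≠ Finsupp.single v 1)
    (hstr : ∀ v, {v} ∈ Δ.faces → σ v = Finsupp.single v 1 ∨ ∃ w, w ≠ v ∧ {v, w} ∈ Δ.faces ∧ σ v w = 1 ∧ σ w v = 0) :
    srMax k Δ ≤ traceIdeal (SRRing k Δ) ω := by
  classical
  have hW0 := W0 hC hs D hv hσv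
  have hlam : ∀ u y, ∃ c : k, {u, y} ∈ Δ.faces → 
      (X y : PR k n) • g u = (monomial (σ u + Finsupp.single y 1 - σ y) c : PR k n) • g y := by
    intro u y
    by_cases he : {u, y} ∈ Δ.faces
    · obtain ⟨c, _, hc⟩ := edge (D u (Δ.down_closed he (by simp))) (D y (Δ.down_closed he (by simp))) he
      exact ⟨c, fun _ => hc⟩
    · exact ⟨0, fun h => absurd h he⟩
  choose lam hlam using hlam
  obtain ⟨c, hc0, hc⟩ := pot hC lam (fun u y huy he => by
    exact lam_inv huy (D u (Δ.down_closed he (by simp))) (D y (Δ.down_closed he (by simp))) he (hlam u y he)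
      (hlam y u (by rwa [Finset.pair_comm]))) hdeg hv hleaf
  have hfv : ∀ u, ∃ f : ω →ₗ[SRRing k Δ] SRRing k Δ, {u} ∈ Δ.faces → ∀ (m : ω) (r : PR k n),
      (X u : PR k n) • m = r • g u → f m = qm k Δ (r * X u) := by
    intro u
    by_cases hu : {u} ∈ Δ.faces
    · obtain ⟨f, hf⟩ := (D u hu).fv
      exact ⟨f, fun _ => hf⟩
    · exact ⟨0, fun h => absurd h hu⟩
  choose F hF using hfv
  -- the relation
  let Rel : ω → SRRing k Δ → Prop := fun m r => ∀ u, {u} ∈ Δ.faces →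
    qm k Δ (X u ^ 2) * r = qm k Δ (monomial (σ u) (c u)) * F u m
  have hRadd : ∀ m m' r r', Rel m r → Rel m' r' → Rel (m + m') (r + r') := by
    intro m m' r r' h h' u hu
    rw [mul_add, map_add, mul_add, h u hu, h' u hu]
  have hRsmul : ∀ (q : SRRing k Δ) m r, Rel m r → Rel (q • m) (q * r) := by
    intro q m r h u hu
    rw [map_smul, smul_eq_mul, mul_left_comm, h u hu, mul_left_comm]
  have hRuniq : ∀ m r r', Rel m r → Rel m r' → r = r' := by
    intro m r r' h h'
    obtain ⟨p, rfl⟩ := lift r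
    obtain ⟨p', rfl⟩ := lift r'
    rw [← sub_eq_zero, ← map_sub, mk_eq_zero]
    refine sq_zero hv _ fun u hu => ?_
    rw [← mk_eq_zero, map_mul, map_sub, mul_sub, h u hu, h' u hu, sub_self]
  have hRg : ∀ u, {u} ∈ Δ.faces → Rel (g u) (qm k Δ (monomial (σ u) (c u))) := by
    intro u hu y hy
    by_cases huy : u = y
    · subst huy
      rw [hF u hu _ _ rfl, mul_comm, pow_two]
    by_cases he : {u, y} ∈ Δ.faces
    · have h1 := hlam u y he
      have h2 := edge_exp huy (D u hu) (D y hy) he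
      rw [hF y hy _ _ h1, ← map_mul, ← map_mul, h2, hc u y huy he]
      have h3 := (D u hu).hv
      have h4 := (D y hy).hv
      have h5 := (D y hy).le1 u
      have hexp : Finsupp.single y 2 + σ u =
          σ y + (Finsupp.single y (σ u y) + Finsupp.single u (1 - σ y u) + Finsupp.single y 1) := by
        ext i
        rcases eq_or_ne i u with rfl | hiu
        · simp [h3, Ne.symm huy]; omega
        · rcases eq_or_ne i y with rfl | hiy
          · simp [h4, huy]; omega
          · have := edge_eq (D u hu) (D y hy) he i hiu hiy
            simp [hiu.symm, hiy.symm, this]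
      congr 1
      rw [X_pow_eq_monomial, X, monomial_mul, monomial_mul, monomial_mul, one_mul, mul_one, hexp]
    · have h1 := (D u hu).Xz he
      rw [hF y hy _ 0 (by rw [h1, zero_smul]), zero_mul, map_zero, mul_zero, ← map_mul, mk_eq_zero, X_pow_eq_monomial,
        monomial_mul]
      apply mon_face
      intro h
      apply he
      refine Δ.down_closed h ?_
      intro j hj
      rw [Finset.mem_insert, Finset.mem_singleton] at hj
      rcases hj with rfl | rfl
      · simp [(D _ hu).hv]
      · simp
  have hRex : ∀ m, ∃ r, Rel m r := by
    intro m
    have hz : Rel 0 0 := by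
      intro u hu
      rw [map_zero, mul_zero, mul_zero]
    refine G.ind (P := fun m => ∃ r, Rel m r) ⟨0, hz⟩ ?_ ?_ m
    · rintro x y ⟨p, hp⟩ ⟨q, hq⟩
      exact ⟨p + q, hRadd _ _ _ _ hp hq⟩
    · intro a m
      have hm : G.pr a (G.pr a m) = G.pr a m := G.pr_same a m
      generalize G.pr a m = m at hm
      by_cases hm0 : m = 0
      · exact ⟨0, by rw [hm0]; exact hz⟩
      have hf := face_of_ne (Δ := Δ) hm hm0
      by_cases ha0 : a = 0
      · subst ha0; exact absurd (hW0 m hm) hm0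
      obtain ⟨y, hy⟩ : ∃ y, a y ≠ 0 := by
        by_contra! h
        exact ha0 (Finsupp.ext h)
      have hyf : {y} ∈ Δ.faces := Δ.down_closed hf (by simpa using hy)
      by_cases h : σ y ≤ a
      · obtain ⟨b, hb⟩ := (D y hyf).gen a m hm (by omega) h
        rw [hb, ← mk_smul (Δ := Δ)]
        exact ⟨_, hRsmul _ _ _ (hRg y hyf)⟩
      · exact absurd ((D y hyf).gen0 a m hm (by omega) h) hm0
  choose Φ hΦ using hRex
  let f : ω →ₗ[SRRing k Δ] SRRing k Δ :=
    { toFun := Φ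
      map_add' := fun a b => hRuniq _ _ _ (hΦ _) (hRadd _ _ _ _ (hΦ a) (hΦ b))
      map_smul' := fun q a => hRuniq _ _ _ (hΦ _) (hRsmul _ _ _ (hΦ a)) }
  refine M_le fun u hu => ?_
  rcases hstr u hu with h | ⟨y, hyu, he, h1, h2⟩
  · have h1 := mem_tr f (g u)
    have h2 : f (g u) = qm k Δ (monomial (σ u) (c u)) := hRuniq _ _ _ (hΦ _) (hRg u hu)
    rw [h2, h, C_smul_mon] at h1
    exact C_mem (hc0 u hu) h1
  · exact edge_mem hyu (D y (Δ.down_closed he (by simp))) (D u hu) (by rwa [Finset.pair_comm]) h2 h1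

end
end SRL
end

section
set_option linter.unusedSectionVars false

namespace SRL
section
open MvPolynomial
variable {k : Type} [Field k] {n : ℕ} {Δ : SC n} {d : ℕ}
variable {ω : Type} [AddCommGroup ω] [Module (SRRing k Δ) ω] [Module (PR k n) ω]
  [IsScalarTower (PR k n) (SRRing k Δ) ω]

theorem ex_LG (hd : ringKrullDim (SRRing k Δ) = d) (hCM : IsCohenMacaulayAt (SRRing k Δ) (srMax k Δ))
    (e : ω ≃ₗ[PR k n] EX (PR k n) (SRRing k Δ) (PR k n) (n - d))
    (hG : GorensteinPunctured k (srIdeal k Δ)) (v : Fin n) (hv : {v} ∈ Δ.faces) :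
    ∃ g : ω, LG (k := k) Δ v g := by
  have hc := erase_c hv
  obtain ⟨𝔭, h𝔭⟩ : ∃ 𝔭, 𝔭 = Q k Δ (Finset.univ.erase v) := ⟨_, rfl⟩
  haveI : 𝔭.IsPrime := by rw [h𝔭]; exact Q_prime _ hc
  obtain ⟨-, g, h1, h2⟩ := out_fwd hd hCM e hG v hv 𝔭 h𝔭
  have hmem : ∀ p : PR k n, qm k Δ p ∉ 𝔭 → p ∉ PS k (Finset.univ.erase v) := by
    intro p hp hp'
    apply hp
    rw [h𝔭]
    exact (mk_mem_Q _ hc p).2 hp'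
  refine ⟨g, ?_, ?_⟩
  · intro m
    obtain ⟨s, hs, r, hr⟩ := h1 m
    obtain ⟨s, rfl⟩ := lift s
    obtain ⟨r, rfl⟩ := lift r
    refine ⟨s, hmem s hs, r, ?_⟩
    rw [← mk_smul (Δ := Δ), ← mk_smul (Δ := Δ)]
    exact hr
  · intro r hr
    obtain ⟨s, hs, h⟩ := h2 (qm k Δ r) ((mk_smul (Δ := Δ) r g).trans hr)
    obtain ⟨s, rfl⟩ := lift s
    refine ⟨s, hmem s hs, ?_⟩
    rw [← mk_eq_zero, map_mul]
    exact h

theorem fwd (hd : ringKrullDim (SRRing k Δ) = d) (hCM : IsCohenMacaulayAt (SRRing k Δ) (srMax k Δ))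
    (e : ω ≃ₗ[PR k n] EX (PR k n) (SRRing k Δ) (PR k n) (n - d))
    (hG : GorensteinPunctured k (srIdeal k Δ)) :
    ∃ i ∈ ({0, 1, 2} : Set ℕ), traceIdeal (SRRing k Δ) ω = srMax k Δ ^ i := by
  classical
  obtain ⟨G⟩ : Nonempty (SqGr k n ω) := ⟨(SqGr.srExSq Δ (n - d)).some.congr e.symm⟩
  have H : ∀ v, {v} ∈ Δ.faces → ∃ g σ, GenD Δ G v g σ := by
    intro v hv
    obtain ⟨g, hg⟩ := ex_LG hd hCM e hG v hv
    exact exists_GenD G hv hg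
  have h2 := sq_le H
  have H' : ∀ v, ∃ g σ, {v} ∈ Δ.faces → GenD Δ G v g σ := by
    intro v
    by_cases hv : {v} ∈ Δ.faces
    · obtain ⟨g, σ, h⟩ := H v hv
      exact ⟨g, σ, fun _ => h⟩
    · exact ⟨0, 0, fun h => absurd h hv⟩
  choose g σ D using H'
  by_cases hd1 : d ≤ 1
  · refine tr_M (case_d1 ?_ D)
    intro v w hvw h
    have := face_card_le _ h hd
    rw [Finset.card_pair hvw] at this
    omega
  have hd2 : 2 ≤ d := by omega
  have hC : Conn Δ := fun P v hv hPv hP w hw => conn hd hCM hd2 P hv hPv hP hw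
  have hs : ∀ u : ω, (∀ y, {y} ∈ Δ.faces → (X y : PR k n) • u = 0) → u = 0 :=
    socle0 hd hCM e (by omega)
  by_cases hM : traceIdeal (SRRing k Δ) ω ≤ srMax k Δ
  swap
  · exact ⟨0, by simp, (tr_top h2 hM).trans ((pow_zero (srMax k Δ)).trans Ideal.one_eq_top).symm⟩
  by_cases hM2 : traceIdeal (SRRing k Δ) ω ≤ srMax k Δ ^ 2
  · exact ⟨2, by simp, le_antisymm hM2 h2⟩
  by_cases hσ : ∀ v, {v} ∈ Δ.faces → σ v = Finsupp.single v 1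
  · exact tr_M (case1 hC D hσ h2 hM hM2)
  by_cases hp : ∃ v w, {v} ∈ Δ.faces ∧ {w} ∈ Δ.faces ∧ v ≠ w ∧ ∀ y, y ≠ w → {w, y} ∈ Δ.faces → σ y w = 1
  · obtain ⟨v, w, hv, hw, hvw, h⟩ := hp
    exact ⟨0, by simp, (case2 hC hs D hv hw hvw h).trans ((pow_zero (srMax k Δ)).trans Ideal.one_eq_top).symm⟩
  push Not at hσ
  obtain ⟨v, hv, hσv⟩ := hσ
  have pair : ∀ v w, {v} ∈ Δ.faces → σ v w = 1 → {v, w} ∈ Δ.faces := fun v w hv h =>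
    sig_edge (D v hv) hv (by rw [h]; exact one_ne_zero)
  have hno : ∀ v w, {v} ∈ Δ.faces → w ≠ v → σ v w = 1 → ∃ y, y ≠ w ∧ {w, y} ∈ Δ.faces ∧ σ y w ≠ 1 := by
    intro v w hv hwv h
    by_contra! h'
    exact hp ⟨v, w, hv, Δ.down_closed (pair v w hv h) (by simp), hwv.symm, h'⟩
  obtain ⟨w, hwv, hw1⟩ := sig_ne (D v hv) hσv
  have hvw := pair v w hv hw1
  have hdd : d = 2 := by
    by_contra hd3
    obtain ⟨y, hyw, hy, hy1⟩ := hno v w hv hwv hw1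
    refine hy1 (linkconn hd hCM e hG (by omega) w (fun y => σ y w = 1) hwv.symm
      (by rwa [Finset.pair_comm]) hw1 ?_ hyw hy)
    intro a b ha hb hab habw h
    have hab' : {a, b} ∈ Δ.faces := Δ.down_closed habw (by simp)
    rw [← edge_eq (D a (Δ.down_closed hab' (by simp))) (D b (Δ.down_closed hab' (by simp))) hab' w ha.symm hb.symm]
    exact h
  have leaf : ∀ v w, {v} ∈ Δ.faces → w ≠ v → σ v w = 1 → ∀ z, z ≠ v → {v, z} ∈ Δ.faces → z = w := by
    intro v w hv hwv h z hzv hz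
    by_contra hzw
    have h1 := (D v hv).face (Finsupp.single z 1) (by
      rwa [Finsupp.support_single _ one_ne_zero])
    have h3 : {v, w, z} ∈ Δ.faces := by
      refine Δ.down_closed h1 ?_
      intro j hj
      simp only [Finset.mem_insert, Finset.mem_singleton] at hj
      rcases hj with rfl | rfl | rfl
      · simp [(D _ hv).hv]
      · simp [h]
      · simp
    have h4 := face_card_le _ h3 hd
    rw [Finset.card_eq_three.2 ⟨v, w, z, hwv.symm, hzv.symm, Ne.symm hzw, rfl⟩] at h4
    omega
  have hstr : ∀ v, {v} ∈ Δ.faces → σ v = Finsupp.single v 1 ∨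
      ∃ w, w ≠ v ∧ {v, w} ∈ Δ.faces ∧ σ v w = 1 ∧ σ w v = 0 := by
    intro v hv
    by_cases hσv : σ v = Finsupp.single v 1
    · exact Or.inl hσv
    obtain ⟨w, hwv, hw1⟩ := sig_ne (D v hv) hσv
    have hvw := pair v w hv hw1
    have hw : {w} ∈ Δ.faces := Δ.down_closed hvw (by simp)
    refine Or.inr ⟨w, hwv, hvw, hw1, ?_⟩
    by_contra h0
    have h1 : σ w v = 1 := by have := (D w hw).le1 v; omega
    obtain ⟨y, hyw, hy, hy1⟩ := hno v w hv hwv hw1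
    have hyv : y ≠ v := fun h => hy1 (h ▸ hw1)
    have hyF : {y} ∈ Δ.faces := Δ.down_closed hy (by simp)
    have h2 := edge_eq (D w hw) (D y hyF) hy v hwv.symm hyv.symm
    have h3 := pair y v hyF (h2.symm.trans h1)
    exact hyw (leaf v w hv hwv hw1 y hyv (by rwa [Finset.pair_comm]))
  exact tr_M (case3 hC hs D (fun w y1 y2 y3 n1 n2 n3 n12 n13 n23 h1 h2' h3 =>
    deg2 hd hCM e hG hdd n1 n2 n3 n12 n13 n23 h1 h2' h3) hv (leaf v w hv hwv hw1) hσv hstr)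

end
end SRL

theorem SRL.final
    (k : Type) [Field k] {n : ℕ} (Δ : SC n)
    (hCM : IsCohenMacaulayAt (SRRing k Δ) (srMax k Δ))
    (ω : Type) [AddCommGroup ω] [Module (SRRing k Δ) ω]
    (hω : IsCanonicalModuleQ k (srIdeal k Δ) ω) :
    GorensteinPunctured k (srIdeal k Δ) ↔
      ∃ i ∈ ({0, 1, 2} : Set ℕ), traceIdeal (SRRing k Δ) ω = srMax k Δ ^ i := by
  obtain ⟨-, d, hd, ⟨e0⟩⟩ := hω
  letI : Module (MvPolynomial (Fin n) k) ω := Module.compHom ω (Ideal.Quotient.mk (srIdeal k Δ))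
  haveI : IsScalarTower (MvPolynomial (Fin n) k) (SRRing k Δ) ω := by
    refine ⟨fun x y z => ?_⟩
    obtain ⟨y, rfl⟩ := Ideal.Quotient.mk_surjective y
    exact mul_smul (Ideal.Quotient.mk (srIdeal k Δ) x) (Ideal.Quotient.mk (srIdeal k Δ) y) z
  have e := e0.trans (extMod_bridge (MvPolynomial (Fin n) k) (SRRing k Δ) (MvPolynomial (Fin n) k) (n - d)).some
  constructor
  · exact SRL.fwd hd hCM e
  · rintro ⟨i, -, hi⟩
    exact SRL.out_bwd hd hCM e hi
end

set_option maxHeartbeats 1000000 in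
set_option synthInstance.maxHeartbeats 1000000 in
/-- Let `R = k[Δ]` be a Cohen--Macaulay Stanley--Reisner ring.  Then `R` is
Gorenstein on the punctured spectrum if and only if the trace of the canonical module equals
`𝔐_R^i` for some `i ∈ {0, 1, 2}`. -/
theorem gorensteinPunctured_iff_trace_eq_pow
    (k : Type) [Field k] {n : ℕ} (Δ : SC n)
    (hCM : IsCohenMacaulayAt (SRRing k Δ) (srMax k Δ))
    (ω : Type) [AddCommGroup ω] [Module (SRRing k Δ) ω]
    (hω : IsCanonicalModuleQ k (srIdeal k Δ) ω) :
    GorensteinPunctured k (srIdeal k Δ) ↔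
      ∃ i ∈ ({0, 1, 2} : Set ℕ), traceIdeal (SRRing k Δ) ω = srMax k Δ ^ i := by
  exact SRL.final k Δ hCM ω hω
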